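/- The class of fan-crossing free graphs is closed under path-addition: if a finite simple graph G admits a fan-crossing free drawing, u and v are distinct vertices of G, and P is a path of length at least |V(G)|−1 from u to v whose internal vertices are new, then G ⊕ P ⊕ ∅ admits a fan-crossing free drawing. -/

import Mathlib

/-- Points of the plane `ℝ²`. -/
abbrev Plane : Type := ℝ × ℝ

/-- The `i`-th vertex of a path from `a` to `b` whose internal vertices are
`w 0, …, w (t-1)` (so the path has length `t + 1`). -/
def chainVertex {α : Type*} (a b : α) {t : ℕ} (w : Fin t → α) (i : Fin (t + 2)) : α :=
  if _h0 : (i : ℕ) = 0 then a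
  else if _h1 : (i : ℕ) = t + 1 then b
  else w ⟨(i : ℕ) - 1, by have := i.isLt; omega⟩

/-- The edge set of a path from `a` to `b` through the internal vertices
`w 0, …, w (t-1)`. -/
def chainEdges {α : Type*} (a b : α) {t : ℕ} (w : Fin t → α) : Set (Sym2 α) :=
  {e | ∃ i : Fin (t + 1),
    e = s(chainVertex a b w (Fin.castSucc i), chainVertex a b w (Fin.succ i))}

/-- Path-addition `G ⊕ P ⊕ F`: the graph on `V ⊕ Fin t` obtained from `G` by adding an
internally vertex-disjoint path `P = (u, w₁, …, w_t, v)` with `t` new internal vertices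
together with a set `F` of supplementary edges. -/
def pathAdd {V : Type*} (G : SimpleGraph V) (u v : V) (t : ℕ)
    (F : Set (Sym2 (V ⊕ Fin t))) : SimpleGraph (V ⊕ Fin t) :=
  SimpleGraph.fromEdgeSet
    ((Sym2.map Sum.inl '' G.edgeSet)
      ∪ chainEdges (Sum.inl u) (Sum.inl v) (fun i => Sum.inr i)
      ∪ F)

/-- A valid supplementary edge set: every supplementary edge is a non-loop with at least
one endpoint among the internal vertices `w₁, …, w_t` of the added path. -/
def ValidSupp {V : Type*} {t : ℕ} (F : Set (Sym2 (V ⊕ Fin t))) : Prop :=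
  ∀ e ∈ F, ¬ e.IsDiag ∧ ∃ i : Fin t, Sum.inr i ∈ e

/-- A drawing of a finite simple graph `G` in the plane: vertices are mapped to distinct
points, each edge to a continuous injective curve (parametrized over `[0,1]`) joining the
points of its endpoints, whose interior contains no vertex point; curves of two distinct
edges meet in finitely many points, and curves of edges sharing an endpoint meet only at
(the point of) that endpoint. -/
structure Drawing {V : Type*} (G : SimpleGraph V) where
  pos : V → Plane
  curve : Sym2 V → ℝ → Plane
  pos_inj : Function.Injective pos
  curve_cont : ∀ e ∈ G.edgeSet, ContinuousOn (curve e) (Set.Icc 0 1)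
  curve_inj : ∀ e ∈ G.edgeSet, Set.InjOn (curve e) (Set.Icc 0 1)
  curve_ends : ∀ x y : V, G.Adj x y →
    ({curve s(x, y) 0, curve s(x, y) 1} : Set Plane) = {pos x, pos y}
  no_vertex_interior : ∀ e ∈ G.edgeSet, ∀ s ∈ Set.Ioo (0 : ℝ) 1, ∀ x : V, curve e s ≠ pos x
  finite_meets : ∀ e ∈ G.edgeSet, ∀ f ∈ G.edgeSet, e ≠ f →
    (curve e '' Set.Icc 0 1 ∩ curve f '' Set.Icc 0 1).Finite
  shared_endpoint : ∀ e ∈ G.edgeSet, ∀ f ∈ G.edgeSet, e ≠ f → ∀ x : V, x ∈ e → x ∈ f →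
    curve e '' Set.Icc 0 1 ∩ curve f '' Set.Icc 0 1 ⊆ {pos x}

/-- `p` is a crossing point of the edges `e` and `f`: a point interior to both curves. -/
def Drawing.IsCrossingPt {V : Type*} {G : SimpleGraph V} (D : Drawing G)
    (e f : Sym2 V) (p : Plane) : Prop :=
  e ∈ G.edgeSet ∧ f ∈ G.edgeSet ∧ e ≠ f ∧
    (∃ s ∈ Set.Ioo (0 : ℝ) 1, D.curve e s = p) ∧
    (∃ s ∈ Set.Ioo (0 : ℝ) 1, D.curve f s = p)

/-- Two edges cross in the drawing `D`. -/
def Drawing.Crosses {V : Type*} {G : SimpleGraph V} (D : Drawing G) (e f : Sym2 V) : Prop :=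
  ∃ p : Plane, D.IsCrossingPt e f p

/-- The drawing `D` is crossing-free. -/
def Drawing.CrossingFree {V : Type*} {G : SimpleGraph V} (D : Drawing G) : Prop :=
  ∀ e f : Sym2 V, ¬ D.Crosses e f

/-- A graph is planar if it admits a crossing-free drawing in the plane. -/
def IsPlanarGraph {V : Type*} (G : SimpleGraph V) : Prop :=
  ∃ D : Drawing G, D.CrossingFree

/-- A drawing is fan-crossing free if no edge is crossed by two distinct edges that share
a common endpoint. -/
def Drawing.FanCrossingFree {V : Type*} {G : SimpleGraph V} (D : Drawing G) : Prop :=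
  ¬ ∃ (e f g : Sym2 V) (x : V), f ≠ g ∧ x ∈ f ∧ x ∈ g ∧ D.Crosses e f ∧ D.Crosses e g

/-- A graph is fan-crossing free if it admits a fan-crossing free drawing. -/
def IsFanCrossingFreeGraph {V : Type*} (G : SimpleGraph V) : Prop :=
  ∃ D : Drawing G, D.FanCrossingFree



namespace FCF

open Set

/-! ### Segments -/

theorem seg_split {y z h : Plane} (hh : h ∈ segment ℝ y z) :
    segment ℝ y h ∪ segment ℝ h z = segment ℝ y z := by
  apply Subset.antisymm
  · apply union_subset
    · exact (convex_segment y z).segment_subset (left_mem_segment ℝ y z) hh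
    · exact (convex_segment y z).segment_subset hh (right_mem_segment ℝ y z)
  · intro w hw
    rw [segment_eq_image'] at hh hw
    obtain ⟨a, ⟨ha0, ha1⟩, rfl⟩ := hh
    obtain ⟨b, ⟨hb0, hb1⟩, rfl⟩ := hw
    rcases le_total b a with hab | hab
    · left
      rw [segment_eq_image']
      rcases eq_or_lt_of_le ha0 with h0 | h0
      · have : b = 0 := by linarith
        refine ⟨0, by simp, ?_⟩
        simp [this]
      · refine ⟨b / a, ⟨by positivity, by rw [div_le_one h0]; exact hab⟩, ?_⟩
        simp only [add_sub_cancel_left, smul_smul]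
        rw [div_mul_cancel₀ _ h0.ne']
    · right
      rw [segment_eq_image']
      rcases eq_or_lt_of_le ha1 with h0 | h0
      · have : b = 1 := by linarith
        refine ⟨0, by simp, ?_⟩
        simp [this, h0]
      · have h1 : (0:ℝ) < 1 - a := by linarith
        refine ⟨(b - a) / (1 - a), ⟨div_nonneg (by linarith) h1.le,
          by rw [div_le_one h1]; linarith⟩, ?_⟩
        have e : z - (y + a • (z - y)) = (1 - a) • (z - y) := by
          rw [sub_smul, one_smul]; abel
        show y + a • (z - y) + ((b - a) / (1 - a)) • (z - (y + a • (z - y))) = _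
        rw [e, smul_smul, div_mul_cancel₀ _ h1.ne', add_assoc, ← add_smul]
        congr 2; ring

theorem seg_inter {y z h : Plane} (hh : h ∈ segment ℝ y z) :
    segment ℝ y h ∩ segment ℝ h z = {h} := by
  apply Subset.antisymm
  · rintro w ⟨h1, h2⟩
    rw [mem_segment_iff_wbtw] at *
    have h3 : Wbtw ℝ w h z := hh.trans_left_right h1
    exact ((wbtw_swap_left_iff ℝ z).1 ⟨h2, h3⟩).symm
  · rintro w rfl
    exact ⟨right_mem_segment ℝ y _, left_mem_segment ℝ _ z⟩

theorem seg_compact (y z : Plane) : IsCompact (segment ℝ y z) := by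
  rw [segment_eq_image']
  exact isCompact_Icc.image (by fun_prop)

/-! ### Polygonal arcs -/

/-- Polygonal arcs from `x` to `y` with trace `S`. -/
inductive PA : Plane → Plane → Set Plane → Prop
  | single {x y : Plane} (h : x ≠ y) : PA x y (segment ℝ x y)
  | snoc {x y z : Plane} {S : Set Plane} (h : PA x y S) (hyz : y ≠ z)
      (hS : S ∩ segment ℝ y z = {y}) (hxz : z ≠ x) : PA x z (S ∪ segment ℝ y z)

namespace PA

theorem ne {x y : Plane} {S : Set Plane} (h : PA x y S) : x ≠ y := by
  cases h with
  | single h => exact h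
  | snoc h hyz hS hxz => exact hxz.symm

theorem left_mem {x y : Plane} {S : Set Plane} (h : PA x y S) : x ∈ S := by
  induction h with
  | single h => exact left_mem_segment ℝ _ _
  | snoc h hyz hS hxz ih => exact Or.inl ih

theorem right_mem {x y : Plane} {S : Set Plane} (h : PA x y S) : y ∈ S := by
  cases h with
  | single h => exact right_mem_segment ℝ _ _
  | snoc h hyz hS hxz => exact Or.inr (right_mem_segment ℝ _ _)

theorem compact {x y : Plane} {S : Set Plane} (h : PA x y S) : IsCompact S := by
  induction h with
  | single h => exact seg_compact _ _
  | snoc h hyz hS hxz ih => exact ih.union (seg_compact _ _)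

theorem not_mem_of_snoc {y z : Plane} {S : Set Plane} (hyz : y ≠ z)
    (hS : S ∩ segment ℝ y z = {y}) : z ∉ S := fun hz => by
  have : z ∈ S ∩ segment ℝ y z := ⟨hz, right_mem_segment ℝ _ _⟩
  rw [hS] at this
  exact hyz this.symm

theorem snoc' {x y z : Plane} {S : Set Plane} (h : PA x y S) (hyz : y ≠ z)
    (hS : S ∩ segment ℝ y z = {y}) : PA x z (S ∪ segment ℝ y z) :=
  snoc h hyz hS (fun hzx => not_mem_of_snoc hyz hS (hzx ▸ h.left_mem))

theorem split {x y : Plane} {S : Set Plane} (h : PA x y S) :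
    ∀ p ∈ S, p ≠ x → p ≠ y → ∃ S1 S2, PA x p S1 ∧ PA p y S2 ∧ S1 ∪ S2 = S ∧ S1 ∩ S2 = {p} := by
  induction h with
  | single h =>
    intro p hp hx hy
    exact ⟨_, _, single hx.symm, single hy, seg_split hp, seg_inter hp⟩
  | @snoc y z S h hyz hS hxz ih =>
    intro p hp hx hz
    by_cases hpy : p = y
    · subst hpy
      exact ⟨_, _, h, single hyz, rfl, hS⟩
    by_cases hpS : p ∈ S
    · obtain ⟨S1, S2, h1, h2, hu, hi⟩ := ih p hpS hx hpy
      have hS2 : S2 ⊆ S := hu ▸ subset_union_right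
      have hS1 : S1 ⊆ S := hu ▸ subset_union_left
      refine ⟨S1, S2 ∪ segment ℝ y z, h1, h2.snoc' hyz ?_, by rw [← union_assoc, hu], ?_⟩
      · apply Subset.antisymm
        · rintro w ⟨hw1, hw2⟩
          rw [← hS]; exact ⟨hS2 hw1, hw2⟩
        · rintro w rfl
          exact ⟨h2.right_mem, left_mem_segment ℝ _ _⟩
      · apply Subset.antisymm
        · rintro w ⟨hw1, hw2 | hw2⟩
          · rw [← hi]; exact ⟨hw1, hw2⟩
          · have : w ∈ S ∩ segment ℝ y z := ⟨hS1 hw1, hw2⟩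
            rw [hS] at this
            have hwy : w = y := this
            subst hwy
            rw [← hi]; exact ⟨hw1, h2.right_mem⟩
        · rintro w rfl
          exact ⟨h1.right_mem, Or.inl h2.left_mem⟩
    · have hp' : p ∈ segment ℝ y z := hp.resolve_left hpS
      refine ⟨S ∪ segment ℝ y p, segment ℝ p z, h.snoc' (Ne.symm hpy) ?_, single hz,
        by rw [union_assoc, seg_split hp'], ?_⟩
      · apply Subset.antisymm
        · rintro w ⟨hw1, hw2⟩
          rw [← hS]; exact ⟨hw1, seg_split hp' ▸ Or.inl hw2⟩
        · rintro w rfl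
          exact ⟨h.right_mem, left_mem_segment ℝ _ _⟩
      · apply Subset.antisymm
        · rintro w ⟨hw1 | hw1, hw2⟩
          · have : w ∈ S ∩ segment ℝ y z := ⟨hw1, seg_split hp' ▸ Or.inr hw2⟩
            rw [hS] at this
            have hwy : w = y := this
            subst hwy
            rw [← seg_inter hp']; exact ⟨left_mem_segment ℝ _ _, hw2⟩
          · rw [← seg_inter hp']; exact ⟨hw1, hw2⟩
        · rintro w rfl
          exact ⟨Or.inr (right_mem_segment ℝ _ _), left_mem_segment ℝ _ _⟩

theorem append {x y z : Plane} {S S' : Set Plane} (h : PA x y S) (h' : PA y z S')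
    (hi : S ∩ S' ⊆ {y}) : PA x z (S ∪ S') := by
  induction h' with
  | single hne =>
    refine h.snoc' hne (Subset.antisymm hi ?_)
    rintro w rfl
    exact ⟨h.right_mem, left_mem_segment ℝ _ _⟩
  | @snoc a b S' h' hyz hS hxz ih =>
    have h1 := ih (fun w hw => hi ⟨hw.1, Or.inl hw.2⟩)
    rw [← union_assoc]
    refine h1.snoc' hyz (Subset.antisymm ?_ ?_)
    · rintro w ⟨hw1 | hw1, hw2⟩
      · have : w = y := hi ⟨hw1, Or.inr hw2⟩
        subst this
        rw [← hS]; exact ⟨h'.left_mem, hw2⟩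
      · rw [← hS]; exact ⟨hw1, hw2⟩
    · rintro w rfl
      exact ⟨Or.inr h'.right_mem, left_mem_segment ℝ _ _⟩

theorem symm {x y : Plane} {S : Set Plane} (h : PA x y S) : PA y x S := by
  induction h with
  | single h => rw [segment_symm]; exact single h.symm
  | @snoc y z S h hyz hS hxz ih =>
    rw [union_comm, segment_symm]
    refine (single hyz.symm).append ih ?_
    rw [segment_symm, inter_comm, hS]

theorem first {x y : Plane} {S : Set Plane} (h : PA x y S) :
    ∃ x', x' ≠ x ∧ ∃ S'', IsClosed S'' ∧ x ∉ S'' ∧ S = segment ℝ x x' ∪ S'' := by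
  induction h with
  | single h => exact ⟨_, h.symm, ∅, isClosed_empty, by simp, by simp⟩
  | @snoc y z S h hyz hS hxz ih =>
    obtain ⟨x', hx', S'', hc, hn, rfl⟩ := ih
    refine ⟨x', hx', S'' ∪ segment ℝ y z, hc.union (seg_compact _ _).isClosed, ?_,
      by rw [union_assoc]⟩
    rintro (hh | hh)
    · exact hn hh
    · have : x ∈ (segment ℝ x x' ∪ S'') ∩ segment ℝ y z := ⟨Or.inl (left_mem_segment ℝ _ _), hh⟩
      rw [hS] at this
      exact h.ne this

end PA

/-- polygonal reachability inside a set gives polygonal arcs -/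
theorem arc_of_reach {Q : Set Plane} {x y : Plane}
    (h : Relation.ReflTransGen (fun a b => segment ℝ a b ⊆ Q) x y) :
    x = y ∨ ∃ S ⊆ Q, PA x y S := by
  induction h with
  | refl => exact Or.inl rfl
  | @tail b c _ hbc ih =>
    by_cases hxc : x = c
    · exact Or.inl hxc
    right
    rcases ih with rfl | ⟨S, hSQ, hS⟩
    · exact ⟨_, hbc, PA.single hxc⟩
    have hK : IsCompact (S ∩ segment ℝ b c) := hS.compact.inter_right (seg_compact _ _).isClosed
    obtain ⟨p, ⟨hpS, hpc⟩, hmin⟩ := hK.exists_isMinOn ⟨b, hS.right_mem, left_mem_segment ℝ _ _⟩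
      (f := fun w => dist w c) (by fun_prop)
    have hsub : segment ℝ p c ⊆ Q := fun w hw => hbc (seg_split hpc ▸ Or.inr hw)
    by_cases hpx : p = x
    · subst hpx
      exact ⟨_, hsub, PA.single hxc⟩
    have h1 : ∃ S1 ⊆ S, PA x p S1 := by
      by_cases hpb : p = b
      · subst hpb; exact ⟨S, subset_rfl, hS⟩
      · obtain ⟨S1, S2, h1, -, hu, -⟩ := hS.split p hpS hpx hpb
        exact ⟨S1, hu ▸ subset_union_left, h1⟩
    obtain ⟨S1, hS1, h1⟩ := h1
    by_cases hpc' : p = c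
    · subst hpc'
      exact ⟨S1, hS1.trans hSQ, h1⟩
    refine ⟨S1 ∪ segment ℝ p c, union_subset (hS1.trans hSQ) hsub, h1.snoc' hpc' ?_⟩
    apply Subset.antisymm
    · rintro w ⟨hw1, hw2⟩
      have hw3 : w ∈ segment ℝ b c := seg_split hpc ▸ Or.inr hw2
      have h4 : dist p c ≤ dist w c := hmin ⟨hS1 hw1, hw3⟩
      rw [segment_eq_image'] at hw2
      obtain ⟨a, ⟨ha0, ha1⟩, rfl⟩ := hw2
      have e : p + a • (c - p) - c = (1 - a) • (p - c) := by
        rw [sub_smul, one_smul, ← neg_sub p c, smul_neg]; abel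
      rw [dist_eq_norm, dist_eq_norm] at h4
      simp only [e, norm_smul] at h4
      rw [Real.norm_of_nonneg (by linarith)] at h4
      have h5 : 0 < ‖p - c‖ := norm_pos_iff.2 (sub_ne_zero.2 hpc')
      have : a = 0 := by nlinarith
      simp [this]
    · rintro w rfl
      exact ⟨h1.right_mem, left_mem_segment ℝ _ _⟩

/-! ### Parametrised arcs -/

/-- `γ` is a parametrisation over `[a,b]` of the arc `S` -/
structure ArcOn (γ : ℝ → Plane) (a b : ℝ) (S : Set Plane) : Prop where
  cont : ContinuousOn γ (Icc a b)
  inj : InjOn γ (Icc a b)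
  img : γ '' Icc a b = S

theorem ArcOn.concat {γ₁ γ₂ : ℝ → Plane} {a b c : ℝ} {S₁ S₂ : Set Plane}
    (h₁ : ArcOn γ₁ a b S₁) (h₂ : ArcOn γ₂ b c S₂) (hab : a ≤ b) (hbc : b ≤ c)
    (he : γ₁ b = γ₂ b) (hi : S₁ ∩ S₂ ⊆ {γ₁ b}) :
    ArcOn (fun s => if s ≤ b then γ₁ s else γ₂ s) a c (S₁ ∪ S₂) := by
  have e1 : EqOn (fun s => if s ≤ b then γ₁ s else γ₂ s) γ₁ (Icc a b) := fun s hs => by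
    simp [hs.2]
  have e2 : EqOn (fun s => if s ≤ b then γ₁ s else γ₂ s) γ₂ (Icc b c) := fun s hs => by
    rcases eq_or_lt_of_le hs.1 with h | h
    · simp [← h, he]
    · simp [not_le.2 h]
  have hU : Icc a c = Icc a b ∪ Icc b c := (Icc_union_Icc_eq_Icc hab hbc).symm
  refine ⟨?_, ?_, ?_⟩
  · rw [hU]
    exact ContinuousOn.union_of_isClosed (h₁.cont.congr e1) (h₂.cont.congr e2) isClosed_Icc isClosed_Icc
  · have key : ∀ s ∈ Icc a b, ∀ s' ∈ Icc b c, γ₁ s = γ₂ s' → s = s' := by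
      intro s hs s' hs' hh
      have m1 : γ₁ s ∈ S₁ := h₁.img ▸ mem_image_of_mem _ hs
      have m2 : γ₁ s ∈ S₂ := by rw [hh]; exact h₂.img ▸ mem_image_of_mem _ hs'
      have hb : γ₁ s = γ₁ b := hi ⟨m1, m2⟩
      have hsb := h₁.inj hs (right_mem_Icc.2 hab) hb
      have hsb' : s' = b := h₂.inj hs' (left_mem_Icc.2 hbc) (by rw [← hh, hb, he])
      rw [hsb, hsb']
    intro s hs s' hs' hh
    rw [hU] at hs hs'
    rcases hs with hs | hs <;> rcases hs' with hs' | hs'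
    · rw [e1 hs, e1 hs'] at hh; exact h₁.inj hs hs' hh
    · rw [e1 hs, e2 hs'] at hh; exact key _ hs _ hs' hh
    · rw [e2 hs, e1 hs'] at hh; exact (key _ hs' _ hs hh.symm).symm
    · rw [e2 hs, e2 hs'] at hh; exact h₂.inj hs hs' hh
  · rw [hU, image_union, e1.image_eq, e2.image_eq, h₁.img, h₂.img]

theorem ArcOn.rescale {γ : ℝ → Plane} {a b : ℝ} {S : Set Plane} (h : ArcOn γ a b S) (hab : a < b)
    {c d : ℝ} (hcd : c < d) :
    ArcOn (fun s => γ (a + (s - c) * ((b - a) / (d - c)))) c d S := by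
  have hk : 0 < (b - a) / (d - c) := div_pos (by linarith) (by linarith)
  have hkk : (d - c) * ((b - a) / (d - c)) = b - a := by
    rw [mul_div_cancel₀]; linarith
  set k := (b - a) / (d - c) with hkdef
  have hm : ∀ s ∈ Icc c d, a + (s - c) * k ∈ Icc a b := fun s hs => by
    have := hs.1; have := hs.2
    constructor <;> nlinarith
  refine ⟨?_, ?_, ?_⟩
  · exact h.cont.comp (by fun_prop) hm
  · intro s hs s' hs' hh
    have := h.inj (hm s hs) (hm s' hs') hh
    have h2 : (s - s') * k = 0 := by linarith
    rcases mul_eq_zero.1 h2 with h3 | h3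
    · linarith
    · exact absurd h3 hk.ne'
  · rw [← h.img]
    apply Subset.antisymm
    · rintro _ ⟨s, hs, rfl⟩
      exact ⟨_, hm s hs, rfl⟩
    · rintro _ ⟨s, hs, rfl⟩
      refine ⟨c + (s - a) / k, ⟨?_, ?_⟩, ?_⟩
      · have : 0 ≤ (s - a) / k := div_nonneg (by linarith [hs.1]) hk.le
        linarith
      · have : (s - a) / k ≤ d - c := by rw [div_le_iff₀ hk]; linarith [hs.2]
        linarith
      · simp only [add_sub_cancel_left]
        rw [div_mul_cancel₀ _ hk.ne']; congr 1; ring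

theorem PA.param {x y : Plane} {S : Set Plane} (h : PA x y S) :
    ∃ γ, ArcOn γ 0 1 S ∧ γ 0 = x ∧ γ 1 = y := by
  have seg : ∀ x y : Plane, x ≠ y → ArcOn (fun s => x + s • (y - x)) 0 1 (segment ℝ x y) := by
    intro x y hxy
    refine ⟨by fun_prop, ?_, by rw [segment_eq_image']⟩
    intro s _ s' _ hh
    have : (s - s') • (y - x) = 0 := by
      rw [sub_smul, sub_eq_zero]; exact add_left_cancel hh
    rcases smul_eq_zero.1 this with h | h
    · linarith
    · exact absurd (sub_eq_zero.1 h).symm hxy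
  induction h with
  | single h => exact ⟨_, seg _ _ h, by simp, by simp⟩
  | @snoc y z S h hyz hS hxz ih =>
    obtain ⟨γ, hγ, h0, h1⟩ := ih
    have A := hγ.rescale one_pos (c := 0) (d := 1/2) (by norm_num)
    have B := (seg y z hyz).rescale one_pos (c := 1/2) (d := 1) (by norm_num)
    refine ⟨_, A.concat B (by norm_num) (by norm_num) ?_ ?_, ?_, ?_⟩
    · norm_num [h1]
    · norm_num [h1, hS]
    · norm_num [h0]
    · norm_num

end FCF


namespace FCF

open Set Filter Topology

/-- cone over the part of `A` lying on the sphere of radius `r` around `p` -/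
def coneAt (A : Set Plane) (r : ℝ) (p : Plane) : Set Plane :=
  insert p {z | ∃ τ ∈ Icc (0:ℝ) 1, ∃ a ∈ A ∩ Metric.sphere p r, z = p + τ • (a - p)}

theorem coneAt_compact {A : Set Plane} (hA : IsCompact A) (r : ℝ) (p : Plane) :
    IsCompact (coneAt A r p) := by
  have : {z | ∃ τ ∈ Icc (0:ℝ) 1, ∃ a ∈ A ∩ Metric.sphere p r, z = p + τ • (a - p)}
      = (fun w : ℝ × Plane => p + w.1 • (w.2 - p)) '' (Icc (0:ℝ) 1 ×ˢ (A ∩ Metric.sphere p r)) := by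
    ext z; constructor
    · rintro ⟨τ, hτ, a, ha, rfl⟩
      exact ⟨(τ, a), ⟨hτ, ha⟩, rfl⟩
    · rintro ⟨⟨τ, a⟩, ⟨hτ, ha⟩, rfl⟩
      exact ⟨τ, hτ, a, ha, rfl⟩
  unfold coneAt
  rw [this]
  refine IsCompact.insert (IsCompact.image ?_ (by fun_prop)) p
  exact isCompact_Icc.prod (hA.inter_right Metric.isClosed_sphere)

theorem coneAt_dist {A : Set Plane} {r : ℝ} (hr : 0 < r) {p z : Plane} (hz : z ∈ coneAt A r p) :
    z = p ∨ ∃ τ ∈ Ioc (0:ℝ) 1, ∃ a ∈ A, dist a p = r ∧ z = p + τ • (a - p) ∧ dist z p = τ * r := by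
  rcases hz with rfl | ⟨τ, hτ, a, ⟨ha, hs⟩, rfl⟩
  · exact Or.inl rfl
  · rcases eq_or_lt_of_le hτ.1 with h | h
    · left; simp [← h]
    · right
      refine ⟨τ, ⟨h, hτ.2⟩, a, ha, hs, rfl, ?_⟩
      rw [dist_eq_norm, add_sub_cancel_left, norm_smul, Real.norm_of_nonneg hτ.1, ← dist_eq_norm]
      rw [Metric.mem_sphere.1 hs]

theorem coneAt_le {A : Set Plane} {r : ℝ} (hr : 0 < r) {p z : Plane} (hz : z ∈ coneAt A r p) :
    dist z p ≤ r := by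
  rcases coneAt_dist hr hz with rfl | ⟨τ, hτ, a, ha, hs, rfl, hd⟩
  · simp [hr.le]
  · rw [hd]; nlinarith [hτ.2]

theorem small_sep {ι : Type*} [Finite ι] {A : ι → Set Plane} (hc : ∀ i, IsClosed (A i))
    {X : Set Plane} (hX : X.Finite) :
    ∃ r > 0, (∀ p ∈ X, ∀ q ∈ X, p ≠ q → 2 * r < dist p q) ∧
      ∀ p ∈ X, ∀ i, p ∉ A i → ∀ a ∈ A i, r < dist a p := by
  have h1 : ∀ᶠ r : ℝ in 𝓝[>] 0, ∀ p ∈ X, ∀ q ∈ X, p ≠ q → 2 * r < dist p q := by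
    refine (eventually_all_finite hX).2 fun p _ => (eventually_all_finite hX).2 fun q _ => ?_
    by_cases h : p = q
    · exact Eventually.of_forall fun r hr => absurd h hr
    · have : (0:ℝ) < dist p q / 2 := half_pos (dist_pos.2 h)
      filter_upwards [Ioo_mem_nhdsGT this] with r hr _
      linarith [hr.2]
  have h2 : ∀ᶠ r : ℝ in 𝓝[>] 0, ∀ p ∈ X, ∀ i, p ∉ A i → ∀ a ∈ A i, r < dist a p := by
    refine (eventually_all_finite hX).2 fun p _ => eventually_all.2 fun i => ?_
    by_cases h : p ∈ A i
    · exact Eventually.of_forall fun r hr => absurd h hr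
    · obtain ⟨ε, he, hb⟩ := Metric.isOpen_iff.1 (hc i).isOpen_compl p h
      filter_upwards [Ioo_mem_nhdsGT he] with r hr _ a ha
      by_contra hcon
      exact hb (Metric.mem_ball.2 (lt_of_le_of_lt (not_lt.1 hcon) hr.2)) ha
  obtain ⟨r, ⟨hr1, hr2⟩, hr⟩ := ((h1.and h2).and self_mem_nhdsWithin).exists
  exact ⟨r, hr, hr1, hr2⟩

theorem small_thick {ι : Type*} [Finite ι] {M K : ι → Set Plane} (hM : ∀ i, IsCompact (M i))
    (hK : ∀ i, IsClosed (K i)) (hd : ∀ i, Disjoint (M i) (K i)) :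
    ∃ δ > 0, ∀ i, Disjoint (Metric.thickening δ (M i)) (Metric.thickening δ (K i)) := by
  have h1 : ∀ᶠ r : ℝ in 𝓝[>] 0, ∀ i,
      Disjoint (Metric.thickening r (M i)) (Metric.thickening r (K i)) := by
    refine eventually_all.2 fun i => ?_
    obtain ⟨δ, hδ, h⟩ := (hd i).exists_thickenings (hM i) (hK i)
    filter_upwards [Ioo_mem_nhdsGT hδ] with r hr
    exact h.mono (Metric.thickening_mono hr.2.le _) (Metric.thickening_mono hr.2.le _)
  obtain ⟨r, h, hr⟩ := (h1.and self_mem_nhdsWithin).exists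
  exact ⟨r, hr, h⟩

theorem reach_core {A X : Set Plane} {r δ : ℝ} (hr : 0 < r) (hδ : 0 < δ)
    (hpre : IsPreconnected A) (hX : X.Finite)
    (hsep : ∀ p ∈ X, ∀ q ∈ X, p ≠ q → 2 * r < dist p q)
    (hfar : ∀ p ∈ X, p ∉ A → ∀ a ∈ A, r < dist a p)
    {M Q : Set Plane} (hM : M = {a ∈ A | ∀ p ∈ X, r ≤ dist a p})
    (hQ1 : Metric.thickening δ M ⊆ Q) (hQ2 : ∀ p ∈ X, p ∈ A → coneAt A r p ⊆ Q)
    {x y : Plane} (hx : x ∈ A) (hx' : x ∈ X) (hy : y ∈ A) (hy' : y ∈ X) :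
    Relation.ReflTransGen (fun a b => segment ℝ a b ⊆ Q) x y := by
  set Rel : Plane → Plane → Prop := fun q z => (q ∈ M ∧ z = q) ∨ (z ∈ X ∧ z ∈ A ∧ dist q z < r)
    with hRel
  have hex : ∀ q ∈ A, ∃ z, Rel q z := by
    intro q hq
    by_cases hqM : q ∈ M
    · exact ⟨q, Or.inl ⟨hqM, rfl⟩⟩
    · rw [hM] at hqM
      simp only [mem_ofPred_eq, not_and, not_forall, not_le] at hqM
      obtain ⟨p, hp, hd⟩ := hqM hq
      refine ⟨p, Or.inr ⟨hp, ?_, hd⟩⟩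
      by_contra hpA
      exact absurd (hfar p hp hpA q hq) (not_lt.2 hd.le)
  have hsymm : Std.Symm (fun a b : Plane => segment ℝ a b ⊆ Q) :=
    ⟨fun a b h => by rw [segment_symm]; exact h⟩
  have key := hpre.induction₂ (fun q q' => q ∈ A → q' ∈ A → ∀ z z', Rel q z → Rel q' z' →
      Relation.ReflTransGen (fun a b => segment ℝ a b ⊆ Q) z z') ?_ ?_ ?_ hx hy hx hy x y
      (Or.inr ⟨hx', hx, by simpa using hr⟩) (Or.inr ⟨hy', hy, by simpa using hr⟩)
  · exact key
  · intro q hq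
    by_cases hball : ∃ p ∈ X, dist q p < r
    · obtain ⟨p, hp, hd⟩ := hball
      have huniq : ∀ q', dist q' p < r → ∀ z, Rel q' z → z = p := by
        rintro q' hq' z (⟨hz, -⟩ | ⟨hz, -, hz'⟩)
        · rw [hM] at hz
          exact absurd (hz.2 p hp) (not_le.2 hq')
        · by_contra hne
          have h1 := hsep z hz p hp hne
          have h2 := dist_triangle_left z p q'
          linarith
      have : ∀ᶠ q' in 𝓝[A] q, dist q' p < r :=
        nhdsWithin_le_nhds (Metric.isOpen_ball.mem_nhds (Metric.mem_ball.2 hd))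
      filter_upwards [this] with q' hq' _ _ z z' hz hz'
      rw [huniq q hd z hz, huniq q' hq' z' hz']
    · push Not at hball
      have hqM : q ∈ M := by rw [hM]; exact ⟨hq, hball⟩
      have e1 : ∀ᶠ q' in 𝓝[A] q, ∀ p ∈ X, r < dist q p → r < dist q' p := by
        refine (eventually_all_finite hX).2 fun p _ => ?_
        by_cases h : r < dist q p
        · have : ∀ᶠ q' in 𝓝 q, r < dist q' p :=
            (isOpen_lt continuous_const (by fun_prop)).mem_nhds h
          filter_upwards [nhdsWithin_le_nhds this] with q' hq' _ using hq'
        · exact Eventually.of_forall fun _ hh => absurd hh h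
      have e2 : ∀ᶠ q' in 𝓝[A] q, dist q' q < δ :=
        nhdsWithin_le_nhds (Metric.ball_mem_nhds q hδ)
      filter_upwards [e1, e2] with q' h1 h2 _ _ z z' hz hz'
      have hzq : z = q := by
        rcases hz with ⟨-, h⟩ | ⟨h, -, h'⟩
        · exact h
        · exact absurd (hball z h) (not_le.2 h')
      subst hzq
      apply Relation.ReflTransGen.single
      rcases hz' with ⟨hm, rfl⟩ | ⟨hzX, hzA, hd⟩
      · refine Subset.trans ?_ hQ1
        have hb : segment ℝ z z' ⊆ Metric.ball z δ :=
          (convex_ball z δ).segment_subset (Metric.mem_ball_self hδ) h2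
        intro w hw
        exact Metric.mem_thickening_iff.2 ⟨z, hqM, hb hw⟩
      · refine Subset.trans ?_ (hQ2 z' hzX hzA)
        have hzr : dist z z' = r := by
          apply le_antisymm _ (hball z' hzX)
          by_contra hcon
          exact absurd (h1 z' hzX (not_le.1 hcon)) (not_lt.2 hd.le)
        rw [segment_symm, segment_eq_image']
        rintro _ ⟨τ, hτ, rfl⟩
        exact Or.inr ⟨τ, hτ, z, ⟨hq, hzr⟩, rfl⟩
  · intro a b c ha hb hc hab hbc _ _ z z' hz hz'
    obtain ⟨w, hw⟩ := hex b hb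
    exact (hab ha hb z w hz hw).trans (hbc hb hc w z' hw hz')
  · intro a b ha hb hab _ _ z z' hz hz'
    exact (Relation.ReflTransGen.stdSymm (r := fun a b : Plane => segment ℝ a b ⊆ Q)).symm _ _
      (hab ha hb z' z hz' hz)

theorem polygonalize {ι : Type*} [Finite ι] (A : ι → Set Plane) (hc : ∀ i, IsCompact (A i))
    (hp : ∀ i, IsPreconnected (A i)) (X : Set Plane) (hX : X.Finite)
    (hAX : ∀ i j, i ≠ j → A i ∩ A j ⊆ X) (x y : ι → Plane)
    (hxA : ∀ i, x i ∈ A i) (hxX : ∀ i, x i ∈ X) (hyA : ∀ i, y i ∈ A i) (hyX : ∀ i, y i ∈ X)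
    (hne : ∀ i, x i ≠ y i) :
    ∃ S : ι → Set Plane, (∀ i, PA (x i) (y i) (S i)) ∧
      (∀ i j, i ≠ j → S i ∩ S j ⊆ A i ∩ A j) ∧ ∀ i, S i ∩ X ⊆ A i := by
  obtain ⟨r, hr, hsep, hfar⟩ := small_sep (fun i => (hc i).isClosed) hX
  set M : ι → Set Plane := fun i => {a ∈ A i | ∀ p ∈ X, r ≤ dist a p} with hM
  set K : ι → Set Plane := fun i => ⋃ p ∈ X ∩ A i, coneAt (A i) r p with hK
  have hMc : ∀ i, IsCompact (M i) := by
    intro i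
    have : M i = A i ∩ ⋂ p ∈ X, {a | r ≤ dist a p} := by
      ext a; simp [hM]
    rw [this]
    refine (hc i).inter_right (isClosed_biInter fun p _ => ?_)
    exact isClosed_le continuous_const (by fun_prop)
  have hKc : ∀ i, IsClosed (K i) := fun i =>
    ((hX.inter_of_left _).isCompact_biUnion fun p _ => coneAt_compact (hc i) r p).isClosed
  have hMX : ∀ i, Disjoint (M i) X := fun i => disjoint_left.2 fun a ha haX => by
    have := ha.2 a haX
    simp at this; linarith
  have hMM : ∀ i j, i ≠ j → Disjoint (M i) (M j) := fun i j hij => disjoint_left.2 fun a ha hb =>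
    disjoint_left.1 (hMX i) ha (hAX i j hij ⟨ha.1, hb.1⟩)
  have hMK : ∀ i j, i ≠ j → Disjoint (M i) (K j) := fun i j hij => disjoint_left.2 fun a ha hb => by
    simp only [hK, mem_iUnion] at hb
    obtain ⟨p, hp, hb⟩ := hb
    have h1 := ha.2 p hp.1
    rcases coneAt_dist hr hb with rfl | ⟨τ, hτ, b, hbA, hbr, hab, hd⟩
    · exact disjoint_left.1 (hMX i) ha hp.1
    · have : τ = 1 := by
        rw [hd] at h1
        have := hτ.2
        nlinarith
      rw [this, one_smul, add_sub_cancel] at hab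
      subst hab
      exact disjoint_left.1 (hMX i) ha (hAX i j hij ⟨ha.1, hbA⟩)
  obtain ⟨δ, hδ, hthick⟩ := small_thick (ι := ι) (M := M)
    (K := fun i => X ∪ ⋃ j ∈ {j | i ≠ j}, (M j ∪ K j)) hMc
    (fun i => hX.isClosed.union ((toFinite _).isClosed_biUnion
      fun j _ => (hMc j).isClosed.union (hKc j)))
    (fun i => (hMX i).union_right (by
      simp only [disjoint_iUnion_right]
      intro j hj
      exact (hMM i j hj).union_right (hMK i j hj)))
  have hTX : ∀ i, Disjoint (Metric.thickening δ (M i)) X := fun i =>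
    (hthick i).mono_right (subset_union_left.trans (Metric.self_subset_thickening hδ _))
  have hTK : ∀ i j, i ≠ j → Disjoint (Metric.thickening δ (M i)) (K j) := fun i j hij =>
    (hthick i).mono_right (Subset.trans (fun w hw => Or.inr (mem_biUnion (x := j) hij (Or.inr hw)))
      (Metric.self_subset_thickening hδ _))
  have hTT : ∀ i j, i ≠ j → Disjoint (Metric.thickening δ (M i)) (Metric.thickening δ (M j)) :=
    fun i j hij => (hthick i).mono_right (Metric.thickening_subset_of_subset δ
      (fun w hw => Or.inr (mem_biUnion (x := j) hij (Or.inl hw))))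
  have hKK : ∀ i j, i ≠ j → K i ∩ K j ⊆ A i ∩ A j := by
    rintro i j hij z ⟨h1, h2⟩
    simp only [hK, mem_iUnion] at h1 h2
    obtain ⟨p, hp, h1⟩ := h1
    obtain ⟨q, hq, h2⟩ := h2
    have hpq : p = q := by
      by_contra hne
      have := hsep p hp.1 q hq.1 hne
      have := coneAt_le hr h1
      have := coneAt_le hr h2
      have := dist_triangle_left p q z
      linarith
    subst hpq
    rcases coneAt_dist hr h1 with rfl | ⟨τ, hτ, a, ha, har, rfl, hd⟩
    · exact ⟨hp.2, hq.2⟩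
    rcases coneAt_dist hr h2 with h | ⟨τ', hτ', b, hb, hbr, hab, hd'⟩
    · rw [h]; exact ⟨hp.2, hq.2⟩
    · exfalso
      have ht : τ = τ' := by
        rw [hd] at hd'
        exact mul_right_cancel₀ hr.ne' hd'
      subst ht
      have h3 := smul_right_injective Plane hτ.1.ne' (add_left_cancel hab)
      have h4 : a = b := sub_left_injective h3
      subst h4
      have h5 := hAX i j hij ⟨ha, hb⟩
      have : a ≠ p := fun h => by rw [h, dist_self] at har; exact hr.ne har
      have := hsep a h5 p hp.1 this
      linarith
  have hKX : ∀ i, K i ∩ X ⊆ A i := by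
    rintro i z ⟨h1, h2⟩
    simp only [hK, mem_iUnion] at h1
    obtain ⟨p, hp, h1⟩ := h1
    have := coneAt_le hr h1
    have hzp : z = p := by
      by_contra hne
      have := hsep z h2 p hp.1 hne
      linarith
    rw [hzp]; exact hp.2
  have hS : ∀ i, ∃ S ⊆ Metric.thickening δ (M i) ∪ K i, PA (x i) (y i) S := by
    intro i
    refine (arc_of_reach (reach_core hr hδ (hp i) hX hsep (fun p hp => hfar p hp i) rfl
      subset_union_left (fun p hpX hpA => ?_) (hxA i) (hxX i) (hyA i) (hyX i))).resolve_left (hne i)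
    exact fun w hw => Or.inr (mem_biUnion (x := p) ⟨hpX, hpA⟩ hw)
  choose S hSQ hSP using hS
  refine ⟨S, hSP, ?_, ?_⟩
  · rintro i j hij z ⟨h1, h2⟩
    rcases hSQ i h1 with h1 | h1 <;> rcases hSQ j h2 with h2 | h2
    · exact absurd h2 (disjoint_left.1 (hTT i j hij) h1)
    · exact absurd h2 (disjoint_left.1 (hTK i j hij) h1)
    · exact absurd h1 (disjoint_left.1 (hTK j i hij.symm) h2)
    · exact hKK i j hij ⟨h1, h2⟩
  · rintro i z ⟨h1, h2⟩
    rcases hSQ i h1 with h1 | h1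
    · exact absurd h2 (disjoint_left.1 (hTX i) h1)
    · exact hKX i ⟨h1, h2⟩

end FCF


namespace FCF

open Set Filter Topology

variable {V : Type} {G : SimpleGraph V}

/-- trace of an edge in a drawing -/
def img (D : Drawing G) (e : Sym2 V) : Set Plane := D.curve e '' Icc 0 1

theorem img_pos_mem (D : Drawing G) {e : Sym2 V} (he : e ∈ G.edgeSet) {z : V}
    (hz : D.pos z ∈ img D e) : z ∈ e := by
  obtain ⟨s, hs, h⟩ := hz
  by_cases hs' : s ∈ Ioo (0:ℝ) 1
  · exact absurd h (D.no_vertex_interior e he s hs' z)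
  · induction e using Sym2.ind with
    | _ x y =>
    have h1 : s = 0 ∨ s = 1 := by
      rcases eq_or_lt_of_le hs.1 with h | h
      · exact Or.inl h.symm
      · rcases eq_or_lt_of_le hs.2 with h' | h'
        · exact Or.inr h'
        · exact absurd ⟨h, h'⟩ hs'
    have h2 : D.pos z ∈ ({D.pos x, D.pos y} : Set Plane) := by
      rw [← D.curve_ends x y he]
      rcases h1 with rfl | rfl
      · exact Or.inl h.symm
      · exact Or.inr h.symm
    rcases h2 with h2 | h2
    · rw [D.pos_inj h2]; simp
    · rw [D.pos_inj h2]; simp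

theorem img_end_mem (D : Drawing G) {e : Sym2 V} (he : e ∈ G.edgeSet) {z : V}
    (hz : z ∈ e) : D.pos z ∈ img D e := by
  induction e using Sym2.ind with
  | _ x y =>
  have h2 : D.pos z ∈ ({D.curve s(x,y) 0, D.curve s(x,y) 1} : Set Plane) := by
    rw [D.curve_ends x y he]
    rcases Sym2.mem_iff.1 hz with rfl | rfl <;> simp
  rcases h2 with h2 | h2
  · rw [h2]; exact ⟨0, by simp, rfl⟩
  · rw [h2]; exact ⟨1, by simp, rfl⟩

theorem img_interior (D : Drawing G) {e : Sym2 V} (he : e ∈ G.edgeSet) {p : Plane}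
    (hp : p ∈ img D e) (hv : ∀ z, p ≠ D.pos z) : ∃ s ∈ Ioo (0:ℝ) 1, D.curve e s = p := by
  obtain ⟨s, hs, rfl⟩ := hp
  refine ⟨s, ?_, rfl⟩
  induction e using Sym2.ind with
  | _ x y =>
  have h0 : ∀ w, w ∈ ({D.curve s(x,y) 0, D.curve s(x,y) 1} : Set Plane) → D.curve s(x,y) s ≠ w := by
    rintro w hw rfl
    rw [D.curve_ends x y he] at hw
    rcases hw with hw | hw
    · exact hv _ hw
    · exact hv _ hw
  refine ⟨lt_of_le_of_ne hs.1 ?_, lt_of_le_of_ne hs.2 ?_⟩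
  · rintro rfl; exact h0 _ (Or.inl rfl) rfl
  · rintro rfl; exact h0 _ (Or.inr rfl) rfl

theorem crosses_iff (D : Drawing G) {e f : Sym2 V} :
    D.Crosses e f ↔ e ∈ G.edgeSet ∧ f ∈ G.edgeSet ∧ e ≠ f ∧
      ∃ p ∈ img D e ∩ img D f, ∀ z, p ≠ D.pos z := by
  constructor
  · rintro ⟨p, he, hf, hne, ⟨s, hs, rfl⟩, ⟨s', hs', h⟩⟩
    exact ⟨he, hf, hne, _, ⟨⟨s, Ioo_subset_Icc_self hs, rfl⟩, ⟨s', Ioo_subset_Icc_self hs', h⟩⟩,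
      D.no_vertex_interior e he s hs⟩
  · rintro ⟨he, hf, hne, p, ⟨h1, h2⟩, hv⟩
    exact ⟨p, he, hf, hne, img_interior D he h1 hv, img_interior D hf h2 hv⟩

/-- A fan-crossing free polygonal drawing. -/
structure PD {V : Type} (G : SimpleGraph V) where
  pos : V → Plane
  S : Sym2 V → Set Plane
  inj : Function.Injective pos
  pa : ∀ x y : V, G.Adj x y → PA (pos x) (pos y) (S s(x, y))
  fin : ∀ e ∈ G.edgeSet, ∀ f ∈ G.edgeSet, e ≠ f → (S e ∩ S f).Finite
  nov : ∀ e ∈ G.edgeSet, ∀ z, pos z ∈ S e → z ∈ e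
  shared : ∀ e ∈ G.edgeSet, ∀ f ∈ G.edgeSet, e ≠ f → ∀ x : V, x ∈ e → x ∈ f →
    S e ∩ S f ⊆ {pos x}
  fan : ∀ e ∈ G.edgeSet, ∀ f ∈ G.edgeSet, ∀ g ∈ G.edgeSet, e ≠ f → e ≠ g → f ≠ g →
    (∃ p ∈ S e ∩ S f, ∀ z, p ≠ pos z) → (∃ p ∈ S e ∩ S g, ∀ z, p ≠ pos z) →
    ∀ x, x ∈ f → x ∉ g

/-- crossing relation of a polygonal drawing -/
def PD.X (D : PD G) (e f : Sym2 V) : Prop :=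
  e ∈ G.edgeSet ∧ f ∈ G.edgeSet ∧ e ≠ f ∧ ∃ p ∈ D.S e ∩ D.S f, ∀ z, p ≠ D.pos z

theorem PD.X.symm {D : PD G} {e f : Sym2 V} (h : D.X e f) : D.X f e := by
  obtain ⟨he, hf, hne, p, hp, hv⟩ := h
  exact ⟨hf, he, hne.symm, p, ⟨hp.2, hp.1⟩, hv⟩

theorem PD.X.disj {D : PD G} {e f : Sym2 V} (h : D.X e f) (x : V) (hx : x ∈ e) : x ∉ f := by
  obtain ⟨he, hf, hne, p, hp, hv⟩ := h
  intro hx'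
  exact hv x (D.shared e he f hf hne x hx hx' hp)

theorem PD.X.fan {D : PD G} {e f g : Sym2 V} (h : D.X e f) (h' : D.X e g) (hfg : f ≠ g)
    (x : V) (hx : x ∈ f) : x ∉ g :=
  D.fan e h.1 f h.2.1 g h'.2.1 h.2.2.1 h'.2.2.1 hfg h.2.2.2 h'.2.2.2 x hx

theorem exists_PD [Finite V] (D : Drawing G) (hD : D.FanCrossingFree) : Nonempty (PD G) := by
  have hex : ∀ e : G.edgeSet, ∃ ab : V × V, e.1 = s(ab.1, ab.2) := by
    rintro ⟨e, he⟩
    induction e using Sym2.ind with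
    | _ x y => exact ⟨(x, y), rfl⟩
  choose ab hab using hex
  have hadj : ∀ e : G.edgeSet, G.Adj (ab e).1 (ab e).2 := fun e => by
    have := e.2; rw [hab e] at this; exact this
  set A : G.edgeSet → Set Plane := fun e => img D e with hA
  set X : Set Plane := range D.pos ∪ ⋃ ef ∈ {ef : G.edgeSet × G.edgeSet | ef.1 ≠ ef.2},
    (A ef.1 ∩ A ef.2) with hXdef
  have hX : X.Finite := by
    refine (finite_range _).union ((toFinite _).biUnion fun ef hef => ?_)
    exact D.finite_meets _ ef.1.2 _ ef.2.2 (fun h => hef (Subtype.ext h))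
  have hm1 : ∀ e, D.pos (ab e).1 ∈ A e := fun e => img_end_mem D e.2 (by rw [hab e]; simp)
  have hm2 : ∀ e, D.pos (ab e).2 ∈ A e := fun e => img_end_mem D e.2 (by rw [hab e]; simp)
  obtain ⟨S, hS1, hS2, hS3⟩ := polygonalize A
    (fun e => isCompact_Icc.image_of_continuousOn (D.curve_cont e e.2))
    (fun e => isPreconnected_Icc.image _ (D.curve_cont e e.2)) X hX
    (fun e f hef p hp => Or.inr (mem_biUnion (x := (e, f)) hef hp))
    (fun e => D.pos (ab e).1) (fun e => D.pos (ab e).2) hm1 (fun e => Or.inl ⟨_, rfl⟩)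
    hm2 (fun e => Or.inl ⟨_, rfl⟩) (fun e h => (hadj e).ne (D.pos_inj h))
  classical
  set S' : Sym2 V → Set Plane := fun e => if h : e ∈ G.edgeSet then S ⟨e, h⟩ else ∅ with hS'
  have hS'e : ∀ e (h : e ∈ G.edgeSet), S' e = S ⟨e, h⟩ := fun e h => by simp [hS', h]
  have hsub : ∀ e ∈ G.edgeSet, ∀ f ∈ G.edgeSet, e ≠ f → S' e ∩ S' f ⊆ img D e ∩ img D f := by
    intro e he f hf hne
    rw [hS'e e he, hS'e f hf]
    exact hS2 _ _ (fun h => hne (congrArg Subtype.val h))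
  refine ⟨⟨D.pos, S', D.pos_inj, ?_, ?_, ?_, ?_, ?_⟩⟩
  · intro x y hxy
    rw [hS'e _ hxy]
    have h1 := hS1 ⟨s(x, y), hxy⟩
    have h2 := hab ⟨s(x, y), hxy⟩
    simp only at h1 h2
    rcases Sym2.eq_iff.1 h2 with ⟨h3, h4⟩ | ⟨h3, h4⟩
    · rw [← h3, ← h4] at h1; exact h1
    · rw [← h3, ← h4] at h1; exact h1.symm
  · intro e he f hf hne
    exact (D.finite_meets e he f hf hne).subset (hsub e he f hf hne)
  · intro e he z hz
    rw [hS'e e he] at hz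
    exact img_pos_mem D he (hS3 _ ⟨hz, Or.inl ⟨z, rfl⟩⟩)
  · intro e he f hf hne x hxe hxf
    exact (hsub e he f hf hne).trans (D.shared_endpoint e he f hf hne x hxe hxf)
  · rintro e he f hf g hg hef heg hfg ⟨p, hp, hpv⟩ ⟨q, hq, hqv⟩ x hxf hxg
    exact hD ⟨e, f, g, x, hfg, hxf, hxg,
      (crosses_iff D).2 ⟨he, hf, hef, p, hsub e he f hf hef hp, hpv⟩,
      (crosses_iff D).2 ⟨he, hg, heg, q, hsub e he g hg heg hq, hqv⟩⟩

theorem PD.toDrawing (D : PD G) : ∃ D' : Drawing G, D'.pos = D.pos ∧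
    (∀ e ∈ G.edgeSet, img D' e = D.S e) ∧ D'.FanCrossingFree := by
  have hex : ∀ e : Sym2 V, ∃ γ : ℝ → Plane, e ∈ G.edgeSet → ArcOn γ 0 1 (D.S e) ∧
      ∀ x y, e = s(x, y) → ({γ 0, γ 1} : Set Plane) = {D.pos x, D.pos y} := by
    intro e
    by_cases he : e ∈ G.edgeSet
    · induction e using Sym2.ind with
      | _ x y =>
      obtain ⟨γ, h, h0, h1⟩ := (D.pa x y he).param
      refine ⟨γ, fun _ => ⟨h, ?_⟩⟩
      intro x' y' hxy
      rw [h0, h1]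
      rcases Sym2.eq_iff.1 hxy with ⟨rfl, rfl⟩ | ⟨rfl, rfl⟩
      · rfl
      · exact pair_comm _ _
    · exact ⟨fun _ => 0, fun h => absurd h he⟩
  choose γ hγ using hex
  have hi : ∀ e ∈ G.edgeSet, γ e '' Icc 0 1 = D.S e := fun e he => (hγ e he).1.img
  let D' : Drawing G :=
    { pos := D.pos
      curve := γ
      pos_inj := D.inj
      curve_cont := fun e he => (hγ e he).1.cont
      curve_inj := fun e he => (hγ e he).1.inj
      curve_ends := fun x y h => (hγ _ h).2 x y rfl
      no_vertex_interior := by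
        intro e he s hs z hz
        have h1 : D.pos z ∈ D.S e := by
          rw [← hi e he, ← hz]; exact ⟨s, Ioo_subset_Icc_self hs, rfl⟩
        have h2 := D.nov e he z h1
        obtain ⟨y, rfl⟩ := Sym2.mem_iff_exists.1 h2
        have h3 := (hγ _ he).2 z y rfl
        have h4 : D.pos z ∈ ({γ s(z, y) 0, γ s(z, y) 1} : Set Plane) := by rw [h3]; simp
        rw [← hz] at h4
        rcases h4 with h4 | h4
        · have := (hγ _ he).1.inj (Ioo_subset_Icc_self hs) (by simp) h4
          linarith [hs.1]
        · have := (hγ _ he).1.inj (Ioo_subset_Icc_self hs) (by simp) h4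
          linarith [hs.2]
      finite_meets := by
        intro e he f hf hne
        rw [hi e he, hi f hf]; exact D.fin e he f hf hne
      shared_endpoint := by
        intro e he f hf hne
        rw [hi e he, hi f hf]; exact D.shared e he f hf hne }
  have hi' : ∀ e ∈ G.edgeSet, img D' e = D.S e := hi
  refine ⟨D', rfl, hi', ?_⟩
  rintro ⟨e, f, g, x, hfg, hxf, hxg, hc1, hc2⟩
  obtain ⟨he, hf, hef, h1⟩ := (crosses_iff D').1 hc1
  obtain ⟨-, hg, heg, h2⟩ := (crosses_iff D').1 hc2
  rw [hi' e he, hi' f hf] at h1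
  rw [hi' e he, hi' g hg] at h2
  exact D.fan e he f hf g hg hef heg hfg h1 h2 x hxf hxg

end FCF


namespace FCF

open Set Filter Topology

/-! ### Polar coordinates -/

noncomputable def pol (θ : ℝ) : Plane := (Real.cos θ, Real.sin θ)

noncomputable def nrm (θ : ℝ) : Plane := (-Real.sin θ, Real.cos θ)

theorem continuous_pol : Continuous pol := by unfold pol; fun_prop

theorem pol_two_pi (θ : ℝ) : pol (θ + 2 * Real.pi) = pol θ := by simp [pol]

theorem pol_eq_iff {θ θ' : ℝ} : pol θ = pol θ' ↔ ∃ k : ℤ, θ = θ' + 2 * Real.pi * k := by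
  constructor
  · intro h
    have h1 : Real.cos θ = Real.cos θ' := congrArg Prod.fst h
    have h2 : Real.sin θ = Real.sin θ' := congrArg Prod.snd h
    have := Real.Angle.cos_sin_inj h1 h2
    obtain ⟨k, hk⟩ := Real.Angle.angle_eq_iff_two_pi_dvd_sub.1 this
    exact ⟨k, by linarith⟩
  · rintro ⟨k, rfl⟩
    simp only [pol]
    rw [mul_comm (2 * Real.pi), Real.cos_add_int_mul_two_pi, Real.sin_add_int_mul_two_pi]

theorem pol_inj_lt {θ θ' : ℝ} (h : pol θ = pol θ') (h1 : |θ - θ'| < 2 * Real.pi) : θ = θ' := by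
  obtain ⟨k, rfl⟩ := pol_eq_iff.1 h
  have hpi := Real.pi_pos
  rw [add_sub_cancel_left, abs_mul, abs_of_pos (by positivity)] at h1
  have h2 : |(k:ℝ)| < 1 := by
    by_contra hc
    push Not at hc
    nlinarith
  have h3 : |k| < 1 := by exact_mod_cast h2
  have : k = 0 := Int.abs_lt_one_iff.1 h3
  simp [this]

theorem pol_smul_inj {ρ ρ' θ θ' : ℝ} (hρ : 0 < ρ) (hρ' : 0 ≤ ρ') (h : ρ • pol θ = ρ' • pol θ') :
    ρ = ρ' ∧ pol θ = pol θ' := by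
  have h1 : ρ * Real.cos θ = ρ' * Real.cos θ' := congrArg Prod.fst h
  have h2 : ρ * Real.sin θ = ρ' * Real.sin θ' := congrArg Prod.snd h
  have h3 : ρ ^ 2 = ρ' ^ 2 := by
    have a := Real.sin_sq_add_cos_sq θ
    have b := Real.sin_sq_add_cos_sq θ'
    calc ρ ^ 2 = (ρ * Real.cos θ) ^ 2 + (ρ * Real.sin θ) ^ 2 := by rw [mul_pow, mul_pow, ← mul_add, add_comm, a, mul_one]
      _ = ρ' ^ 2 := by rw [h1, h2, mul_pow, mul_pow, ← mul_add, add_comm, b, mul_one]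
  have h4 : ρ = ρ' := by
    rcases sq_eq_sq_iff_eq_or_eq_neg.1 h3 with h | h
    · exact h
    · linarith
  subst h4
  exact ⟨rfl, smul_right_injective Plane hρ.ne' h⟩

theorem pol_ne_zero (θ : ℝ) : pol θ ≠ 0 := by
  intro h
  have h1 : Real.cos θ = 0 := congrArg Prod.fst h
  have h2 : Real.sin θ = 0 := congrArg Prod.snd h
  have a := Real.sin_sq_add_cos_sq θ
  rw [h1, h2] at a; norm_num at a

theorem norm_pol_le (θ : ℝ) : ‖pol θ‖ ≤ 1 := by
  rw [Prod.norm_def]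
  exact max_le (Real.abs_cos_le_one θ) (Real.abs_sin_le_one θ)

theorem exists_pol {w : Plane} (hw : w ≠ 0) :
    ∃ ρ > (0:ℝ), ∃ θ, w = ρ • pol θ := by
  set z : ℂ := ⟨w.1, w.2⟩ with hz
  have hz0 : z ≠ 0 := by
    intro h
    apply hw
    exact Prod.ext (congrArg Complex.re h) (congrArg Complex.im h)
  refine ⟨‖z‖, norm_pos_iff.2 hz0, z.arg, ?_⟩
  ext
  · exact (Complex.norm_mul_cos_arg z).symm
  · exact (Complex.norm_mul_sin_arg z).symm

theorem pol_rot {a b θ : ℝ} (ha : 0 < a) :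
    a • pol θ + b • nrm θ = Real.sqrt (a ^ 2 + b ^ 2) • pol (θ + Real.arctan (b / a)) := by
  have h1 : Real.sqrt (a ^ 2 + b ^ 2) = a * Real.sqrt (1 + (b / a) ^ 2) := by
    rw [show a ^ 2 + b ^ 2 = a ^ 2 * (1 + (b / a) ^ 2) by field_simp, Real.sqrt_mul (by positivity),
      Real.sqrt_sq ha.le]
  have h2 : Real.sqrt (1 + (b / a) ^ 2) ≠ 0 := by positivity
  have h3 : Real.sqrt (a ^ 2 + b ^ 2) * Real.cos (Real.arctan (b / a)) = a := by
    rw [h1, Real.cos_arctan]; field_simp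
  have h4 : Real.sqrt (a ^ 2 + b ^ 2) * Real.sin (Real.arctan (b / a)) = b := by
    rw [h1, Real.sin_arctan]; field_simp
  ext
  · simp only [pol, nrm, Prod.fst_add, Prod.smul_fst, smul_eq_mul, Real.cos_add]
    linear_combination (-Real.cos θ) * h3 + Real.sin θ * h4
  · simp only [pol, nrm, Prod.snd_add, Prod.smul_snd, smul_eq_mul, Real.sin_add]
    linear_combination (-Real.sin θ) * h3 - Real.cos θ * h4

theorem polar_near {ρ θ r ε : ℝ} (hρ : 0 < ρ) (hr : ρ < r) (hε : 0 < ε) :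
    ∀ᶠ w : Plane in 𝓝 0, ∃ ρ' ∈ Ioo 0 r, ∃ θ' ∈ Ioo (θ - ε) (θ + ε),
      ρ • pol θ + w = ρ' • pol θ' ∧
      (0 < -w.1 * Real.sin θ + w.2 * Real.cos θ → θ < θ') ∧
      (-w.1 * Real.sin θ + w.2 * Real.cos θ < 0 → θ' < θ) ∧
      (-w.1 * Real.sin θ + w.2 * Real.cos θ = 0 → θ' = θ) := by
  set α : Plane → ℝ := fun w => w.1 * Real.cos θ + w.2 * Real.sin θ with hα
  set β : Plane → ℝ := fun w => -w.1 * Real.sin θ + w.2 * Real.cos θ with hβ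
  have c1 : Continuous α := by fun_prop
  have c2 : Continuous β := by fun_prop
  have a0 : α 0 = 0 := by simp [hα]
  have b0 : β 0 = 0 := by simp [hβ]
  have e1 : ∀ᶠ w in 𝓝 (0:Plane), 0 < ρ + α w :=
    (isOpen_lt continuous_const (by fun_prop : Continuous fun w => ρ + α w)).mem_nhds
      (by simpa [a0] using hρ)
  have e2 : ∀ᶠ w in 𝓝 (0:Plane), Real.sqrt ((ρ + α w) ^ 2 + β w ^ 2) < r :=
    (isOpen_lt (by fun_prop : Continuous fun w => Real.sqrt ((ρ + α w) ^ 2 + β w ^ 2))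
      continuous_const).mem_nhds (by simpa [a0, b0, Real.sqrt_sq hρ.le] using hr)
  have e3 : ∀ᶠ w in 𝓝 (0:Plane), |Real.arctan (β w / (ρ + α w))| < ε := by
    have hc : ContinuousAt (fun w => |Real.arctan (β w / (ρ + α w))|) (0:Plane) := by
      apply ContinuousAt.abs
      apply Real.continuous_arctan.continuousAt.comp
      exact c2.continuousAt.div (by fun_prop) (by rw [a0]; linarith)
    exact hc.eventually_lt continuousAt_const (by simpa [b0] using hε)
  filter_upwards [e1, e2, e3] with w h1 h2 h3
  refine ⟨_, ⟨?_, h2⟩, θ + Real.arctan (β w / (ρ + α w)), ?_, ?_, ?_, ?_, ?_⟩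
  · apply Real.sqrt_pos.2; positivity
  · rw [abs_lt] at h3; constructor <;> linarith [h3.1, h3.2]
  · rw [← pol_rot h1]
    have hs := Real.sin_sq_add_cos_sq θ
    ext
    · simp only [pol, nrm, Prod.fst_add, Prod.smul_fst, smul_eq_mul, hα, hβ]
      linear_combination -w.1 * hs
    · simp only [pol, nrm, Prod.snd_add, Prod.smul_snd, smul_eq_mul, hα, hβ]
      linear_combination -w.2 * hs
  · intro hb
    have : 0 < Real.arctan (β w / (ρ + α w)) := Real.arctan_pos.2 (div_pos hb h1)
    linarith
  · intro hb
    have : Real.arctan (β w / (ρ + α w)) < 0 := Real.arctan_lt_zero.2 (div_neg_of_neg_of_pos hb h1)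
    linarith
  · intro hb
    have : β w = 0 := hb
    simp [this]

/-! ### Germs of polygonal arcs -/

/-- near `p`, the set `S` consists of rays with directions in `F` -/
def Germ (S : Set Plane) (p : Plane) (F : Set Plane) (r : ℝ) : Prop :=
  ∀ θ, ∀ ρ ∈ Ioo 0 r, (p + ρ • pol θ ∈ S ↔ pol θ ∈ F)

theorem Germ.mono {S F : Set Plane} {p : Plane} {r r' : ℝ} (h : Germ S p F r) (hr : r' ≤ r) :
    Germ S p F r' := fun θ ρ hρ => h θ ρ ⟨hρ.1, hρ.2.trans_le hr⟩

theorem germ_compl {S : Set Plane} (hS : IsClosed S) {p : Plane} (hp : p ∉ S) :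
    ∃ r > 0, Germ S p ∅ r := by
  obtain ⟨ε, he, hb⟩ := Metric.isOpen_iff.1 hS.isOpen_compl p hp
  refine ⟨ε, he, fun θ ρ hρ => ⟨fun h => ?_, fun h => h.elim⟩⟩
  refine (hb ?_ h).elim
  rw [Metric.mem_ball, dist_eq_norm, add_sub_cancel_left, norm_smul, Real.norm_of_nonneg hρ.1.le]
  nlinarith [norm_pol_le θ, hρ.1, hρ.2]

theorem Germ.union {S S' F F' : Set Plane} {p : Plane} {r r' : ℝ} (h : Germ S p F r)
    (h' : Germ S' p F' r') : Germ (S ∪ S') p (F ∪ F') (min r r') := fun θ ρ hρ => by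
  have h1 := h θ ρ ⟨hρ.1, hρ.2.trans_le (min_le_left _ _)⟩
  have h2 := h' θ ρ ⟨hρ.1, hρ.2.trans_le (min_le_right _ _)⟩
  simp only [mem_union, h1, h2]

theorem germ_seg {x x' : Plane} (h : x' ≠ x) :
    ∃ θ₀, ∃ r > 0, Germ (segment ℝ x x') x {pol θ₀} r := by
  obtain ⟨ℓ, hℓ, θ₀, hw⟩ := exists_pol (sub_ne_zero.2 h)
  refine ⟨θ₀, ℓ, hℓ, fun θ ρ hρ => ?_⟩
  rw [segment_eq_image', hw]
  constructor
  · rintro ⟨τ, hτ, he⟩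
    have h1 : ρ • pol θ = (τ * ℓ) • pol θ₀ := by
      rw [mul_smul]; exact (add_left_cancel he).symm
    exact (pol_smul_inj hρ.1 (mul_nonneg hτ.1 hℓ.le) h1).2
  · intro he
    have he' : pol θ = pol θ₀ := he
    refine ⟨ρ / ℓ, ⟨(div_pos hρ.1 hℓ).le, ((div_lt_one hℓ).2 hρ.2).le⟩, ?_⟩
    simp only [smul_smul]
    rw [div_mul_cancel₀ _ hℓ.ne', he']

theorem PA.germ_left {x y : Plane} {S : Set Plane} (h : PA x y S) :
    ∃ θ₀, ∃ r > 0, Germ S x {pol θ₀} r := by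
  obtain ⟨x', hx', S'', hc, hn, rfl⟩ := h.first
  obtain ⟨θ₀, r, hr, h1⟩ := germ_seg hx'
  obtain ⟨r', hr', h2⟩ := germ_compl hc hn
  refine ⟨θ₀, min r r', lt_min hr hr', ?_⟩
  have := h1.union h2
  rwa [union_empty] at this

theorem PA.germ_mid {x y p : Plane} {S : Set Plane} (h : PA x y S) (hp : p ∈ S) (hx : p ≠ x)
    (hy : p ≠ y) : ∃ θ₁ θ₂, ∃ r > 0, Germ S p {pol θ₁, pol θ₂} r := by
  obtain ⟨S1, S2, h1, h2, rfl, -⟩ := h.split p hp hx hy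
  obtain ⟨θ₁, r, hr, g1⟩ := h1.symm.germ_left
  obtain ⟨θ₂, r', hr', g2⟩ := h2.germ_left
  exact ⟨θ₁, θ₂, min r r', lt_min hr hr', g1.union g2⟩

end FCF


namespace FCF

open Set Filter Topology

variable {V : Type} {G : SimpleGraph V}

/-! ### Regions -/

/-- the trace of the whole drawing -/
def PD.Sig (D : PD G) : Set Plane := (⋃ e ∈ G.edgeSet, D.S e) ∪ range D.pos

theorem PD.closed_S (D : PD G) {e : Sym2 V} (he : e ∈ G.edgeSet) : IsClosed (D.S e) := by
  induction e using Sym2.ind with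
  | _ x y => exact (D.pa x y he).compact.isClosed

theorem PD.closed_Sig [Finite V] (D : PD G) : IsClosed D.Sig :=
  ((toFinite _).isClosed_biUnion fun _ he => D.closed_S he).union (finite_range _).isClosed

theorem PD.mem_Sig (D : PD G) {p : Plane} : p ∈ D.Sig ↔
    (∃ e ∈ G.edgeSet, p ∈ D.S e) ∨ ∃ z, D.pos z = p := by
  simp [PD.Sig]

/-- regions of the drawing -/
def PD.IsReg (D : PD G) (R : Set Plane) : Prop :=
  ∃ z ∉ D.Sig, R = connectedComponentIn D.Sigᶜ z

theorem PD.IsReg.sub {D : PD G} {R : Set Plane} (h : D.IsReg R) : R ⊆ D.Sigᶜ := by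
  obtain ⟨z, hz, rfl⟩ := h
  exact connectedComponentIn_subset _ _

theorem PD.IsReg.eq {D : PD G} {R R' : Set Plane} (h : D.IsReg R) (h' : D.IsReg R') {q : Plane}
    (hq : q ∈ R) (hq' : q ∈ R') : R = R' := by
  obtain ⟨z, hz, rfl⟩ := h
  obtain ⟨z', hz', rfl⟩ := h'
  rw [connectedComponentIn_eq hq, connectedComponentIn_eq hq']

theorem PD.IsReg.open [Finite V] {D : PD G} {R : Set Plane} (h : D.IsReg R) : IsOpen R := by
  obtain ⟨z, hz, rfl⟩ := h
  exact D.closed_Sig.isOpen_compl.connectedComponentIn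

theorem PD.IsReg.preconn {D : PD G} {R : Set Plane} (h : D.IsReg R) : IsPreconnected R := by
  obtain ⟨z, hz, rfl⟩ := h
  exact isPreconnected_connectedComponentIn

/-- `p` has straight access to `R` -/
def Acc (p : Plane) (R : Set Plane) : Prop := ∃ w : Plane, w ≠ 0 ∧ ∀ τ ∈ Ioc (0:ℝ) 1, p + τ • w ∈ R

/-- regions accessible from `p` -/
def PD.Regs (D : PD G) (p : Plane) : Set (Set Plane) := {R | D.IsReg R ∧ Acc p R}

/-- regions along an edge -/
def PD.RE (D : PD G) (e : Sym2 V) : Set (Set Plane) :=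
  {R | ∃ p ∈ D.S e, (∀ z, p ≠ D.pos z) ∧ R ∈ D.Regs p}

/-- `q` is a point of the edge `f` at which one can cross from `R` to `R'` -/
structure PD.Gate (D : PD G) (f : Sym2 V) (q : Plane) (R R' : Set Plane) : Prop where
  edge : f ∈ G.edgeSet
  mem : q ∈ D.S f
  only : ∀ g ∈ G.edgeSet, q ∈ D.S g → g = f
  nov : ∀ z, q ≠ D.pos z
  left : R ∈ D.Regs q
  right : R' ∈ D.Regs q
  sub : ∀ R'' ∈ D.Regs q, R'' = R ∨ R'' = R'

theorem PD.Gate.symm {D : PD G} {f : Sym2 V} {q : Plane} {R R' : Set Plane} (h : D.Gate f q R R') :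
    D.Gate f q R' R :=
  ⟨h.edge, h.mem, h.only, h.nov, h.right, h.left, fun R'' hR => (h.sub R'' hR).symm⟩

/-! ### Local structure at a point -/

/-- conic neighbourhood data at `p` -/
structure Loc (D : PD G) (p : Plane) where
  r : ℝ
  hr : 0 < r
  F : Sym2 V → Set Plane
  germ : ∀ e ∈ G.edgeSet, Germ (D.S e) p (F e) r
  nov : ∀ θ, ∀ ρ ∈ Ioo 0 r, ∀ z, D.pos z ≠ p + ρ • pol θ
  empty : ∀ e ∈ G.edgeSet, p ∉ D.S e → F e = ∅
  two : ∀ e ∈ G.edgeSet, p ∈ D.S e → ∃ θ₁ θ₂, F e = {pol θ₁, pol θ₂}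
  one : ∀ e ∈ G.edgeSet, ∀ x ∈ e, p = D.pos x → ∃ θ₀, F e = {pol θ₀}

theorem exists_loc [Finite V] (D : PD G) (p : Plane) : Nonempty (Loc D p) := by
  have h1 : ∀ e, ∃ F : Set Plane, ∃ r > 0, e ∈ G.edgeSet → Germ (D.S e) p F r ∧
      (p ∉ D.S e → F = ∅) ∧ (p ∈ D.S e → ∃ θ₁ θ₂, F = {pol θ₁, pol θ₂}) ∧
      (∀ x ∈ e, p = D.pos x → ∃ θ₀, F = {pol θ₀}) := by
    intro e
    by_cases he : e ∈ G.edgeSet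
    · by_cases hp : p ∈ D.S e
      · by_cases hv : ∃ x ∈ e, p = D.pos x
        · obtain ⟨x, hx, rfl⟩ := hv
          obtain ⟨y, rfl⟩ := Sym2.mem_iff_exists.1 hx
          obtain ⟨θ₀, r, hr, hg⟩ := (D.pa x y he).germ_left
          refine ⟨_, r, hr, fun _ => ⟨hg, fun h => absurd hp h, fun _ => ⟨θ₀, θ₀, by simp⟩,
            fun _ _ _ => ⟨θ₀, rfl⟩⟩⟩
        · push Not at hv
          induction e using Sym2.ind with
          | _ x y =>
          obtain ⟨θ₁, θ₂, r, hr, hg⟩ := (D.pa x y he).germ_mid hp (hv x (by simp)) (hv y (by simp))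
          exact ⟨_, r, hr, fun _ => ⟨hg, fun h => absurd hp h, fun _ => ⟨θ₁, θ₂, rfl⟩,
            fun z hz hpz => absurd hpz (hv z hz)⟩⟩
      · obtain ⟨r, hr, hg⟩ := germ_compl (D.closed_S he) hp
        refine ⟨_, r, hr, fun _ => ⟨hg, fun _ => rfl, fun h => absurd h hp, ?_⟩⟩
        rintro x hx rfl
        exfalso
        obtain ⟨y, rfl⟩ := Sym2.mem_iff_exists.1 hx
        exact hp (D.pa x y he).left_mem
    · exact ⟨∅, 1, one_pos, fun h => absurd h he⟩
  choose F R hR hF using h1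
  have e1 : ∀ᶠ r : ℝ in 𝓝[>] 0, ∀ e ∈ G.edgeSet, Germ (D.S e) p (F e) r := by
    refine (eventually_all_finite (toFinite _)).2 fun e he => ?_
    filter_upwards [Ioo_mem_nhdsGT (hR e)] with r hr
    exact (hF e he).1.mono hr.2.le
  have e2 : ∀ᶠ r : ℝ in 𝓝[>] 0, ∀ z, ∀ θ, ∀ ρ ∈ Ioo 0 r, D.pos z ≠ p + ρ • pol θ := by
    refine eventually_all.2 fun z => ?_
    by_cases hz : p = D.pos z
    · refine Eventually.of_forall fun r θ ρ hρ h => ?_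
      rw [← hz] at h
      have h2 : ρ • pol θ = 0 := by simpa using h.symm
      rcases smul_eq_zero.1 h2 with h | h
      · exact hρ.1.ne' h
      · exact pol_ne_zero θ h
    · obtain ⟨r₀, hr₀, hg⟩ := germ_compl (isClosed_singleton (x := D.pos z)) (p := p) hz
      filter_upwards [Ioo_mem_nhdsGT hr₀] with r hr θ ρ hρ h
      exact ((hg.mono hr.2.le) θ ρ hρ).1 h.symm
  obtain ⟨r, ⟨h1, h2⟩, hr⟩ := ((e1.and e2).and self_mem_nhdsWithin).exists
  exact ⟨⟨r, hr, F, h1, fun θ ρ hρ z => h2 z θ ρ hρ, fun e he => (hF e he).2.1,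
    fun e he => (hF e he).2.2.1, fun e he => (hF e he).2.2.2⟩⟩

namespace Loc

variable {D : PD G} {p : Plane} (L : Loc D p)

/-- the angles at which some edge leaves `p` -/
def Th (θ : ℝ) : Prop := ∃ e ∈ G.edgeSet, pol θ ∈ L.F e

theorem uniq {e f : Sym2 V} (he : e ∈ G.edgeSet) (hf : f ∈ G.edgeSet) {θ : ℝ}
    (h1 : pol θ ∈ L.F e) (h2 : pol θ ∈ L.F f) : e = f := by
  by_contra hne
  refine (D.fin e he f hf hne).not_infinite ?_
  have : InjOn (fun ρ : ℝ => p + ρ • pol θ) (Ioo 0 L.r) := by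
    intro a _ b _ h
    have h3 : (a - b) • pol θ = 0 := by rw [sub_smul, sub_eq_zero]; exact add_left_cancel h
    rcases smul_eq_zero.1 h3 with h | h
    · linarith
    · exact absurd h (pol_ne_zero θ)
  refine ((Ioo_infinite L.hr).image this).mono ?_
  rintro _ ⟨ρ, hρ, rfl⟩
  exact ⟨(L.germ e he θ ρ hρ).2 h1, (L.germ f hf θ ρ hρ).2 h2⟩

theorem off {θ : ℝ} (h : ¬ L.Th θ) {ρ : ℝ} (hρ : ρ ∈ Ioo 0 L.r) : p + ρ • pol θ ∉ D.Sig := by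
  rw [D.mem_Sig]
  rintro (⟨e, he, hm⟩ | ⟨z, hz⟩)
  · exact h ⟨e, he, (L.germ e he θ ρ hρ).1 hm⟩
  · exact L.nov θ ρ hρ z hz

theorem finF {e : Sym2 V} (he : e ∈ G.edgeSet) : (L.F e).Finite := by
  by_cases hp : p ∈ D.S e
  · obtain ⟨θ₁, θ₂, h⟩ := L.two e he hp
    rw [h]; exact toFinite _
  · rw [L.empty e he hp]; exact finite_empty

theorem fin_pol {F : Set Plane} (hF : F.Finite) (a b : ℝ) : {θ ∈ Icc a b | pol θ ∈ F}.Finite := by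
  have : {θ ∈ Icc a b | pol θ ∈ F} = ⋃ d ∈ F, {θ ∈ Icc a b | pol θ = d} := by
    ext θ; simp [and_comm, and_assoc]
  rw [this]
  refine hF.biUnion fun d _ => ?_
  by_cases hne : ∃ θ₀, pol θ₀ = d
  · obtain ⟨θ₀, rfl⟩ := hne
    have hpi := Real.pi_pos
    refine ((finite_Icc (⌊(a - θ₀) / (2 * Real.pi)⌋) (⌈(b - θ₀) / (2 * Real.pi)⌉)).image
      (fun k : ℤ => θ₀ + 2 * Real.pi * k)).subset ?_
    rintro θ ⟨hθ, h⟩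
    obtain ⟨k, rfl⟩ := pol_eq_iff.1 h
    refine ⟨k, ⟨?_, ?_⟩, rfl⟩
    · have : (a - θ₀) / (2 * Real.pi) ≤ k := by
        rw [div_le_iff₀ (by positivity)]; linarith [hθ.1]
      exact_mod_cast (Int.floor_le _).trans this
    · have : (k:ℝ) ≤ (b - θ₀) / (2 * Real.pi) := by
        rw [le_div_iff₀ (by positivity)]; linarith [hθ.2]
      exact_mod_cast this.trans (Int.le_ceil _)
  · refine (finite_empty).subset ?_
    rintro θ ⟨-, h⟩
    exact hne ⟨θ, h⟩

theorem fin_Th [Finite V] (a b : ℝ) : {θ ∈ Icc a b | L.Th θ}.Finite := by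
  have : {θ ∈ Icc a b | L.Th θ} = ⋃ e ∈ G.edgeSet, {θ ∈ Icc a b | pol θ ∈ L.F e} := by
    ext θ; simp only [Th]; simp
  rw [this]
  exact (toFinite _).biUnion fun e he => fin_pol (L.finF he) a b

/-- the open sector with angles in `(a,b)` belongs to the region `R` -/
def Sec (a b : ℝ) (R : Set Plane) : Prop :=
  a < b ∧ D.IsReg R ∧ ∀ θ ∈ Ioo a b, ∀ ρ ∈ Ioo 0 L.r, p + ρ • pol θ ∈ R

theorem sec_exists {a b : ℝ} (hab : a < b) (h : ∀ θ ∈ Ioo a b, ¬ L.Th θ) : ∃ R, L.Sec a b R := by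
  have hr := L.hr
  set θ₀ := (a + b) / 2
  set z := p + (L.r / 2) • pol θ₀
  have hθ₀ : θ₀ ∈ Ioo a b := ⟨by simp only [θ₀]; linarith, by simp only [θ₀]; linarith⟩
  have hρ₀ : L.r / 2 ∈ Ioo 0 L.r := ⟨by linarith, by linarith⟩
  refine ⟨connectedComponentIn D.Sigᶜ z, hab, ⟨z, L.off (h θ₀ hθ₀) hρ₀, rfl⟩, ?_⟩
  intro θ hθ ρ hρ
  have hcon : IsPreconnected ((fun w : ℝ × ℝ => p + w.1 • pol w.2) '' (Ioo 0 L.r ×ˢ Ioo a b)) := by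
    refine (isPreconnected_Ioo.prod isPreconnected_Ioo).image _ ?_
    have := continuous_pol
    fun_prop
  refine hcon.subset_connectedComponentIn (x := z) ?_ ?_ ?_
  · exact ⟨(L.r / 2, θ₀), ⟨hρ₀, hθ₀⟩, rfl⟩
  · rintro _ ⟨⟨ρ', θ'⟩, ⟨h1, h2⟩, rfl⟩
    exact L.off (h θ' h2) h1
  · exact ⟨(ρ, θ), ⟨hρ, hθ⟩, rfl⟩

variable {L}

theorem Sec.free {a b : ℝ} {R : Set Plane} (h : L.Sec a b R) : ∀ θ ∈ Ioo a b, ¬ L.Th θ := by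
  rintro θ hθ ⟨e, he, hF⟩
  have hr := L.hr
  have hρ₀ : L.r / 2 ∈ Ioo 0 L.r := ⟨by linarith, by linarith⟩
  refine h.2.1.sub (h.2.2 θ hθ _ hρ₀) (D.mem_Sig.2 (Or.inl ⟨e, he, ?_⟩))
  exact (L.germ e he θ _ hρ₀).2 hF

theorem Sec.eq {a b a' b' : ℝ} {R R' : Set Plane} (h : L.Sec a b R) (h' : L.Sec a' b' R')
    {θ : ℝ} (hθ : θ ∈ Ioo a b) (hθ' : θ ∈ Ioo a' b') : R = R' := by
  have hr := L.hr
  have hρ₀ : L.r / 2 ∈ Ioo 0 L.r := ⟨by linarith, by linarith⟩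
  exact h.2.1.eq h'.2.1 (h.2.2 θ hθ _ hρ₀) (h'.2.2 θ hθ' _ hρ₀)

theorem Sec.mono {a b a' b' : ℝ} {R : Set Plane} (h : L.Sec a b R) (hab : a' < b')
    (ha : a ≤ a') (hb : b' ≤ b) : L.Sec a' b' R :=
  ⟨hab, h.2.1, fun θ hθ => h.2.2 θ ⟨ha.trans_lt hθ.1, hθ.2.trans_le hb⟩⟩

theorem Sec.shift {a b : ℝ} {R : Set Plane} (h : L.Sec a b R) : 
    L.Sec (a + 2 * Real.pi) (b + 2 * Real.pi) R := by
  refine ⟨by linarith [h.1], h.2.1, fun θ hθ ρ hρ => ?_⟩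
  have := h.2.2 (θ - 2 * Real.pi) ⟨by linarith [hθ.1], by linarith [hθ.2]⟩ ρ hρ
  rwa [← pol_two_pi, sub_add_cancel] at this

theorem Sec.regs {a b : ℝ} {R : Set Plane} (h : L.Sec a b R) : R ∈ D.Regs p := by
  refine ⟨h.2.1, (L.r / 2) • pol ((a + b) / 2), smul_ne_zero (half_pos L.hr).ne' (pol_ne_zero _), ?_⟩
  intro τ hτ
  have hr := L.hr
  rw [smul_smul]
  refine h.2.2 _ ⟨by linarith [h.1], by linarith [h.1]⟩ _ ⟨?_, ?_⟩
  · exact mul_pos hτ.1 (by linarith)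
  · nlinarith [hτ.1, hτ.2]

variable (L)

theorem isolate [Finite V] (θ : ℝ) : ∃ ε > 0, ∀ θ', θ' ≠ θ → |θ' - θ| < ε → ¬ L.Th θ' := by
  have hfin := L.fin_Th (θ - 1) (θ + 1)
  have hcl : IsClosed ({θ' ∈ Icc (θ - 1) (θ + 1) | L.Th θ'} \ {θ}) := (hfin.subset sdiff_subset).isClosed
  obtain ⟨ε, he, hb⟩ := Metric.isOpen_iff.1 hcl.isOpen_compl θ (by simp)
  refine ⟨min ε 1, lt_min he one_pos, fun θ' hne hd hT => ?_⟩
  have h1 := hd.trans_le (min_le_left _ _)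
  have h2 := abs_lt.1 (hd.trans_le (min_le_right _ _))
  exact hb (Metric.mem_ball.2 h1) ⟨⟨⟨by linarith [h2.1], by linarith [h2.2]⟩, hT⟩, hne⟩

theorem two_secs [Finite V] (θ : ℝ) : ∃ ε > 0, ∃ R R', L.Sec (θ - ε) θ R ∧ L.Sec θ (θ + ε) R' ∧
    (¬ L.Th θ → R = R') := by
  obtain ⟨ε, he, h⟩ := L.isolate θ
  obtain ⟨R, hR⟩ := L.sec_exists (a := θ - ε) (b := θ) (by linarith) (fun θ' hθ' =>
    h θ' hθ'.2.ne (by rw [abs_lt]; constructor <;> linarith [hθ'.1, hθ'.2]))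
  obtain ⟨R', hR'⟩ := L.sec_exists (a := θ) (b := θ + ε) (by linarith) (fun θ' hθ' =>
    h θ' hθ'.1.ne' (by rw [abs_lt]; constructor <;> linarith [hθ'.1, hθ'.2]))
  refine ⟨ε, he, R, R', hR, hR', fun hT => ?_⟩
  obtain ⟨R'', hR''⟩ := L.sec_exists (a := θ - ε) (b := θ + ε) (by linarith) (fun θ' hθ' => by
    by_cases h0 : θ' = θ
    · rw [h0]; exact hT
    · exact h θ' h0 (by rw [abs_lt]; constructor <;> linarith [hθ'.1, hθ'.2]))
  rw [hR.eq hR'' (θ := θ - ε / 2) ⟨by linarith, by linarith⟩ ⟨by linarith, by linarith⟩,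
    hR'.eq hR'' (θ := θ + ε / 2) ⟨by linarith, by linarith⟩ ⟨by linarith, by linarith⟩]

theorem regs_sec [Finite V] {R : Set Plane} (hR : R ∈ D.Regs p) : ∃ a b, L.Sec a b R := by
  obtain ⟨hreg, w, hw, h⟩ := hR
  obtain ⟨ρ, hρ, θ, rfl⟩ := exists_pol hw
  obtain ⟨ε, he, R1, R2, h1, h2, h3⟩ := L.two_secs θ
  have hr := L.hr
  obtain ⟨τ, hτ1, hτ2, hτ3⟩ : ∃ τ > 0, τ ≤ 1 ∧ τ * ρ < L.r := by
    refine ⟨min 1 (L.r / (2 * ρ)), by positivity, min_le_left _ _, ?_⟩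
    calc min 1 (L.r / (2 * ρ)) * ρ ≤ (L.r / (2 * ρ)) * ρ := by gcongr; exact min_le_right _ _
      _ = L.r / 2 := by field_simp
      _ < L.r := by linarith
  have hm := h τ ⟨hτ1, hτ2⟩
  rw [smul_smul] at hm
  have hρ' : τ * ρ ∈ Ioo 0 L.r := ⟨by positivity, hτ3⟩
  have hT : ¬ L.Th θ := by
    rintro ⟨e, hE, hF⟩
    exact hreg.sub hm (D.mem_Sig.2 (Or.inl ⟨e, hE, (L.germ e hE θ _ hρ').2 hF⟩))
  obtain ⟨ε', he', hiso⟩ := L.isolate θ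
  obtain ⟨R', hR'⟩ := L.sec_exists (a := θ - ε') (b := θ + ε') (by linarith) (fun θ' hθ' => by
    by_cases h0 : θ' = θ
    · rw [h0]; exact hT
    · exact hiso θ' h0 (by rw [abs_lt]; constructor <;> linarith [hθ'.1, hθ'.2]))
  have : R = R' := hreg.eq hR'.2.1 hm (hR'.2.2 θ ⟨by linarith, by linarith⟩ _ hρ')
  rw [this]; exact ⟨_, _, hR'⟩

/-- Points on a ray of the germ are gates between the two neighbouring sectors. -/
theorem gate {e : Sym2 V} (he : e ∈ G.edgeSet) {θ ε : ℝ} (hθ : pol θ ∈ L.F e) {R R' : Set Plane}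
    (h1 : L.Sec (θ - ε) θ R) (h2 : L.Sec θ (θ + ε) R') {ρ : ℝ} (hρ : ρ ∈ Ioo 0 L.r) :
    D.Gate e (p + ρ • pol θ) R R' := by
  have hε : 0 < ε := by linarith [h1.1]
  have hnear := polar_near (θ := θ) hρ.1 hρ.2 hε
  have hlin : ∀ (τ : ℝ) (w : Plane), -(τ • w).1 * Real.sin θ + (τ • w).2 * Real.cos θ =
      τ * (-w.1 * Real.sin θ + w.2 * Real.cos θ) := by
    intro τ w; simp only [Prod.smul_fst, Prod.smul_snd, smul_eq_mul]; ring
  obtain ⟨η, hη, hb⟩ := Metric.eventually_nhds_iff.1 hnear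
  have hsmall : ∀ w : Plane, ∃ τ₀ > (0:ℝ), ∀ τ ∈ Ioc 0 τ₀, dist (τ • w) 0 < η := by
    intro w
    refine ⟨η / (2 * (‖w‖ + 1)), by positivity, fun τ hτ => ?_⟩
    rw [dist_zero_right, norm_smul, Real.norm_of_nonneg hτ.1.le]
    have hn := norm_nonneg w
    have : τ * (2 * (‖w‖ + 1)) ≤ η := by
      have := hτ.2; rwa [le_div_iff₀ (by positivity)] at this
    nlinarith [hτ.1]
  have hs := Real.sin_sq_add_cos_sq θ
  have hn0 : nrm θ ≠ 0 := by
    intro h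
    have h1 : -Real.sin θ = 0 := congrArg Prod.fst h
    have h2 : Real.cos θ = 0 := congrArg Prod.snd h
    have h3 : Real.sin θ = 0 := by linarith
    rw [h2, h3] at hs; norm_num at hs
  obtain ⟨τ₀, hτ₀, hsm⟩ := hsmall (nrm θ)
  obtain ⟨τ₁, hτ₁, hsm'⟩ := hsmall (-nrm θ)
  refine ⟨he, (L.germ e he θ ρ hρ).2 hθ, ?_, fun z hz => L.nov θ ρ hρ z hz.symm, ?_, ?_, ?_⟩
  · intro g hg hm
    exact L.uniq hg he ((L.germ g hg θ ρ hρ).1 hm) hθ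
  · refine ⟨h1.2.1, τ₁ • (-nrm θ), smul_ne_zero hτ₁.ne' (neg_ne_zero.2 hn0), fun τ hτ => ?_⟩
    rw [smul_smul]
    obtain ⟨ρ', hρ', θ', hθ', heq, -, hneg, -⟩ := hb (hsm' (τ * τ₁)
      ⟨mul_pos hτ.1 hτ₁, by nlinarith [hτ.2]⟩)
    rw [add_assoc, heq]
    refine h1.2.2 θ' ⟨hθ'.1, hneg ?_⟩ ρ' hρ'
    rw [hlin]
    have : -(-nrm θ).1 * Real.sin θ + (-nrm θ).2 * Real.cos θ = -1 := by
      simp only [nrm, Prod.fst_neg, Prod.snd_neg]; linear_combination -hs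
    rw [this]
    nlinarith [mul_pos hτ.1 hτ₁]
  · refine ⟨h2.2.1, τ₀ • (nrm θ), smul_ne_zero hτ₀.ne' hn0, fun τ hτ => ?_⟩
    rw [smul_smul]
    obtain ⟨ρ', hρ', θ', hθ', heq, hpos, -, -⟩ := hb (hsm (τ * τ₀)
      ⟨mul_pos hτ.1 hτ₀, by nlinarith [hτ.2]⟩)
    rw [add_assoc, heq]
    refine h2.2.2 θ' ⟨hpos ?_, hθ'.2⟩ ρ' hρ'
    rw [hlin]
    have : -(nrm θ).1 * Real.sin θ + (nrm θ).2 * Real.cos θ = 1 := by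
      simp only [nrm]; linear_combination hs
    rw [this]
    nlinarith [mul_pos hτ.1 hτ₀]
  · rintro R'' ⟨hreg, w, hw, hacc⟩
    obtain ⟨τ₂, hτ₂, hsm2⟩ := hsmall w
    set τ := min τ₂ 1 with hτdef
    have hτ : 0 < τ := lt_min hτ₂ one_pos
    obtain ⟨ρ', hρ', θ', hθ', heq, hpos, hneg, hzero⟩ := hb (hsm2 τ ⟨hτ, min_le_left _ _⟩)
    have hm := hacc τ ⟨hτ, min_le_right _ _⟩
    rw [add_assoc, heq] at hm
    rcases lt_trichotomy (-(τ • w).1 * Real.sin θ + (τ • w).2 * Real.cos θ) 0 with h | h | h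
    · left
      exact hreg.eq h1.2.1 hm (h1.2.2 θ' ⟨hθ'.1, hneg h⟩ ρ' hρ')
    · exfalso
      rw [hzero h] at hm
      exact hreg.sub hm (D.mem_Sig.2 (Or.inl ⟨e, he, (L.germ e he θ ρ' hρ').2 hθ⟩))
    · right
      exact hreg.eq h2.2.1 hm (h2.2.2 θ' ⟨hpos h, hθ'.2⟩ ρ' hρ')

end Loc

end FCF


namespace FCF

open Set Filter Topology

variable {V : Type} {G : SimpleGraph V}

theorem near_polar {r : ℝ} (hr : 0 < r) (p : Plane) :
    ∀ᶠ q in 𝓝 p, q = p ∨ ∃ θ, ∃ ρ ∈ Ioo 0 r, q = p + ρ • pol θ := by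
  filter_upwards [Metric.ball_mem_nhds p (half_pos hr)] with q hq
  by_cases h : q = p
  · exact Or.inl h
  right
  obtain ⟨ρ, hρ, θ, hw⟩ := exists_pol (sub_ne_zero.2 h)
  refine ⟨θ, ρ, ⟨hρ, ?_⟩, by rw [← hw]; abel⟩
  have h1 : ‖q - p‖ < r / 2 := by rw [← dist_eq_norm]; exact hq
  have h2 : |(q - p).1| < r / 2 := (norm_fst_le (q - p)).trans_lt h1
  have h3 : |(q - p).2| < r / 2 := (norm_snd_le (q - p)).trans_lt h1
  have e1 : (q - p).1 = ρ * Real.cos θ := congrArg Prod.fst hw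
  have e2 : (q - p).2 = ρ * Real.sin θ := congrArg Prod.snd hw
  rw [e1, abs_lt] at h2
  rw [e2, abs_lt] at h3
  have hs := Real.sin_sq_add_cos_sq θ
  have c1 := Real.cos_le_one θ
  have c2 := Real.neg_one_le_cos θ
  have s1 := Real.sin_le_one θ
  have s2 := Real.neg_one_le_sin θ
  have k1 : ρ * Real.cos θ * Real.cos θ ≤ r / 2 := by nlinarith [abs_le.2 ⟨c2, c1⟩, abs_nonneg (Real.cos θ)]
  have k2 : ρ * Real.sin θ * Real.sin θ ≤ r / 2 := by nlinarith
  by_contra hcon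
  push Not at hcon
  -- strictness
  rcases eq_or_ne (Real.cos θ) 0 with h0 | h0
  · have : Real.sin θ ^ 2 = 1 := by rw [h0] at hs; linarith
    nlinarith
  · have k3 : ρ * Real.cos θ * Real.cos θ < r / 2 := by
      rcases lt_or_gt_of_ne h0 with h | h <;> nlinarith
    nlinarith

namespace Loc

variable {D : PD G} {p : Plane} (L : Loc D p)

theorem mem_of_F {e : Sym2 V} (he : e ∈ G.edgeSet) {d : Plane} (h : d ∈ L.F e) : p ∈ D.S e := by
  by_contra hp
  rw [L.empty e he hp] at h
  exact h

theorem Th_shift {θ : ℝ} : L.Th (θ + 2 * Real.pi) ↔ L.Th θ := by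
  simp only [Th, pol_two_pi]

variable {L}

theorem Sec.left_RE [Finite V] {a b : ℝ} {R : Set Plane} (h : L.Sec a b R) {e : Sym2 V}
    (he : e ∈ G.edgeSet) (ha : pol a ∈ L.F e) {ρ : ℝ} (hρ : ρ ∈ Ioo 0 L.r) :
    R ∈ D.Regs (p + ρ • pol a) := by
  obtain ⟨ε, hε, R1, R2, h1, h2, -⟩ := L.two_secs a
  have hab := h.1
  have : R = R2 := by
    have h3 : 0 < min (b - a) ε := lt_min (by linarith) hε
    have h4 := min_le_left (b - a) ε
    have h5 := min_le_right (b - a) ε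
    exact h.eq h2 (θ := a + min (b - a) ε / 2) ⟨by linarith, by linarith⟩ ⟨by linarith, by linarith⟩
  rw [this]
  exact (L.gate he ha h1 h2 hρ).right

theorem Sec.right_RE [Finite V] {a b : ℝ} {R : Set Plane} (h : L.Sec a b R) {e : Sym2 V}
    (he : e ∈ G.edgeSet) (hb : pol b ∈ L.F e) {ρ : ℝ} (hρ : ρ ∈ Ioo 0 L.r) :
    R ∈ D.Regs (p + ρ • pol b) := by
  obtain ⟨ε, hε, R1, R2, h1, h2, -⟩ := L.two_secs b
  have hab := h.1
  have : R = R1 := by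
    have h3 : 0 < min (b - a) ε := lt_min (by linarith) hε
    have h4 := min_le_left (b - a) ε
    have h5 := min_le_right (b - a) ε
    exact h.eq h1 (θ := b - min (b - a) ε / 2) ⟨by linarith, by linarith⟩ ⟨by linarith, by linarith⟩
  rw [this]
  exact (L.gate he hb h1 h2 hρ).left

variable (L)

theorem ray_mem {e : Sym2 V} (he : e ∈ G.edgeSet) {R : Set Plane} {θ : ℝ} (h : pol θ ∈ L.F e)
    (hR : ∀ ρ ∈ Ioo 0 L.r, R ∈ D.Regs (p + ρ • pol θ)) : R ∈ D.RE e := by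
  have hr := L.hr
  have hρ : L.r / 2 ∈ Ioo 0 L.r := ⟨by linarith, by linarith⟩
  exact ⟨_, (L.germ e he θ _ hρ).2 h, fun z hz => L.nov θ _ hρ z hz.symm, hR _ hρ⟩

/-- regions at a point of `e` close to `p` -/
theorem on_edge [Finite V] {e : Sym2 V} (he : e ∈ G.edgeSet) {θ ρ : ℝ} (hρ : ρ ∈ Ioo 0 L.r)
    (hq : p + ρ • pol θ ∈ D.S e) : pol θ ∈ L.F e ∧ ∃ R R' ε, L.Sec (θ - ε) θ R ∧ L.Sec θ (θ + ε) R' ∧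
      D.Gate e (p + ρ • pol θ) R R' := by
  have h := (L.germ e he θ ρ hρ).1 hq
  obtain ⟨ε, hε, R1, R2, h1, h2, -⟩ := L.two_secs θ
  exact ⟨h, R1, R2, ε, h1, h2, L.gate he h h1 h2 hρ⟩

theorem on_edge_sub [Finite V] {e : Sym2 V} (he : e ∈ G.edgeSet) {θ ρ : ℝ} (hρ : ρ ∈ Ioo 0 L.r)
    (hq : p + ρ • pol θ ∈ D.S e) : D.Regs (p + ρ • pol θ) ⊆ D.Regs p := by
  obtain ⟨-, R, R', ε, h1, h2, hg⟩ := L.on_edge he hρ hq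
  intro R'' hR''
  rcases hg.sub R'' hR'' with rfl | rfl
  · exact h1.regs
  · exact h2.regs

theorem next [Finite V] {θ : ℝ} (h : L.Th θ) :
    ∃ θ' ∈ Ioc θ (θ + 2 * Real.pi), L.Th θ' ∧ ∃ R, L.Sec θ θ' R := by
  have hpi := Real.pi_pos
  have hfin : {θ' ∈ Icc θ (θ + 2 * Real.pi) | L.Th θ' ∧ θ < θ'}.Finite :=
    (L.fin_Th θ (θ + 2 * Real.pi)).subset fun x hx => ⟨hx.1, hx.2.1⟩
  obtain ⟨θ', ⟨h1, h2, h3⟩, hmin⟩ := Set.exists_min_image _ id hfin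
    ⟨θ + 2 * Real.pi, ⟨by linarith, le_rfl⟩, L.Th_shift.2 h, by linarith⟩
  refine ⟨θ', ⟨h3, h1.2⟩, h2, L.sec_exists h3 fun α hα hT => ?_⟩
  have := hmin α ⟨⟨hα.1.le, hα.2.le.trans h1.2⟩, hT, hα.1⟩
  simp only [id] at this
  linarith [hα.2]

theorem prev [Finite V] {θ : ℝ} (h : L.Th θ) :
    ∃ θ' ∈ Ico (θ - 2 * Real.pi) θ, L.Th θ' ∧ ∃ R, L.Sec θ' θ R := by
  have hpi := Real.pi_pos
  have hfin : {θ' ∈ Icc (θ - 2 * Real.pi) θ | L.Th θ' ∧ θ' < θ}.Finite :=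
    (L.fin_Th (θ - 2 * Real.pi) θ).subset fun x hx => ⟨hx.1, hx.2.1⟩
  obtain ⟨θ', ⟨h1, h2, h3⟩, hmin⟩ := Set.exists_max_image _ id hfin
    ⟨θ - 2 * Real.pi, ⟨le_rfl, by linarith⟩, by rw [← L.Th_shift, sub_add_cancel]; exact h, by linarith⟩
  refine ⟨θ', ⟨h1.1, h3⟩, h2, L.sec_exists h3 fun α hα hT => ?_⟩
  have := hmin α ⟨⟨h1.1.trans hα.1.le, hα.2.le⟩, hT, hα.2⟩
  simp only [id] at this
  linarith [hα.1]

theorem cover {e : Sym2 V} (he : e ∈ G.edgeSet) {θp θ θn : ℝ} {R R' : Set Plane}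
    (h1 : L.Sec θp θ R) (h2 : L.Sec θ θn R') (hp : θ - 2 * Real.pi ≤ θp)
    (fp : pol θp ∈ L.F e) (f : pol θ ∈ L.F e) (fn : pol θn ∈ L.F e) (α : ℝ) :
    pol α ∈ L.F e ∨ ∃ α', pol α' = pol α ∧ (α' ∈ Ioo θp θ ∨ α' ∈ Ioo θ θn) := by
  have hpi := Real.pi_pos
  obtain ⟨d1, d2, hF⟩ := L.two e he (L.mem_of_F he f)
  obtain ⟨α', hα', heq⟩ : ∃ α' ∈ Ioc θ (θ + 2 * Real.pi), pol α' = pol α := by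
    refine ⟨toIocMod Real.two_pi_pos θ α, toIocMod_mem_Ioc _ _ _, ?_⟩
    rw [pol_eq_iff]
    refine ⟨-toIocDiv Real.two_pi_pos θ α, ?_⟩
    rw [toIocMod, zsmul_eq_mul]; push_cast; ring
  rcases eq_or_lt_of_le hα'.2 with h0 | h0
  · left; rw [← heq, h0, pol_two_pi]; exact f
  rcases lt_trichotomy α' θn with h3 | h3 | h3
  · exact Or.inr ⟨α', heq, Or.inr ⟨hα'.1, h3⟩⟩
  · left; rw [← heq, h3]; exact fn
  right
  have hsh : pol (θn - 2 * Real.pi) = pol θn := by rw [← pol_two_pi, sub_add_cancel]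
  have hθn : θ < θn := h2.1
  have hne : θp ≠ θ - 2 * Real.pi := by
    intro h
    refine h1.free (θn - 2 * Real.pi) ⟨by linarith, by linarith⟩ ⟨e, he, ?_⟩
    rw [hsh]; exact fn
  have hlt : θ - 2 * Real.pi < θp := lt_of_le_of_ne hp (Ne.symm hne)
  have hθp : θp < θ := h1.1
  have n1 : pol θn ≠ pol θ := fun h => by
    have := pol_inj_lt h (by rw [abs_lt]; constructor <;> linarith)
    linarith
  have n2 : pol θp ≠ pol θ := fun h => by
    have := pol_inj_lt h (by rw [abs_lt]; constructor <;> linarith)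
    linarith
  have n3 : pol θn = pol θp := by
    rw [hF] at fp f fn
    rcases f with f | f <;> rcases fp with fp | fp <;> rcases fn with fn | fn <;>
      first
      | (rw [fp, fn]; done)
      | exact absurd (fp.trans f.symm) n2
      | exact absurd (fn.trans f.symm) n1
  have n4 : θn - 2 * Real.pi = θp := by
    apply pol_inj_lt (by rw [hsh, n3])
    rw [abs_lt]; constructor <;> linarith
  refine ⟨α' - 2 * Real.pi, by rw [← heq, ← pol_two_pi, sub_add_cancel], Or.inl ⟨by linarith, by linarith⟩⟩

/-- if only `e` passes through `p`, the regions at `p` are the two regions along `e` -/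
theorem two_dirs [Finite V] {e : Sym2 V} (he : e ∈ G.edgeSet)
    (honly : ∀ g ∈ G.edgeSet, p ∈ D.S g → g = e) {θ ρ : ℝ} (hρ : ρ ∈ Ioo 0 L.r)
    (f : pol θ ∈ L.F e) : D.Regs p ⊆ D.Regs (p + ρ • pol θ) := by
  have hT : L.Th θ := ⟨e, he, f⟩
  have hlab : ∀ α, L.Th α → pol α ∈ L.F e := by
    rintro α ⟨g, hg, hα⟩
    rwa [← honly g hg (L.mem_of_F hg hα)]
  obtain ⟨θn, hn, hTn, R', h2⟩ := L.next hT
  obtain ⟨θp, hp, hTp, R, h1⟩ := L.prev hT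
  intro R'' hR''
  obtain ⟨a, b, h3⟩ := L.regs_sec hR''
  have hab := h3.1
  have hα : (a + b) / 2 ∈ Ioo a b := ⟨by linarith, by linarith⟩
  have hr := L.hr
  have hρ₀ : L.r / 2 ∈ Ioo 0 L.r := ⟨by linarith, by linarith⟩
  have hm := h3.2.2 _ hα _ hρ₀
  rcases L.cover he h1 h2 hp.1 (hlab _ hTp) f (hlab _ hTn) ((a + b) / 2) with h4 | ⟨α', hα', h4 | h4⟩
  · exact absurd ⟨e, he, h4⟩ (h3.free _ hα)
  · rw [← hα'] at hm
    rw [h3.2.1.eq h1.2.1 hm (h1.2.2 _ h4 _ hρ₀)]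
    exact h1.right_RE he f hρ
  · rw [← hα'] at hm
    rw [h3.2.1.eq h2.2.1 hm (h2.2.2 _ h4 _ hρ₀)]
    exact h2.left_RE he f hρ

end Loc

/-! ### Links -/

/-- regions linked by gates with labels in `N` -/
def Linked (D : PD G) (N : Set (Sym2 V)) : Set Plane → Set Plane → Prop :=
  Relation.ReflTransGen (fun R R' => ∃ f ∈ N, ∃ q, D.Gate f q R R')

theorem Linked.symm {D : PD G} {N : Set (Sym2 V)} {R R' : Set Plane} (h : Linked D N R R') :
    Linked D N R' R := by
  induction h with
  | refl => exact Relation.ReflTransGen.refl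
  | tail _ h ih =>
    obtain ⟨f, hf, q, hg⟩ := h
    exact Relation.ReflTransGen.head ⟨f, hf, q, hg.symm⟩ ih

theorem rot [Finite V] {D : PD G} {p : Plane} (N : Set (Sym2 V))
    (hN : ∀ e ∈ G.edgeSet, p ∈ D.S e → e ∈ N) {R R' : Set Plane} (hR : R ∈ D.Regs p)
    (hR' : R' ∈ D.Regs p) : Linked D N R R' := by
  obtain ⟨L⟩ := exists_loc D p
  have hr := L.hr
  have hρ₀ : L.r / 2 ∈ Ioo 0 L.r := ⟨by linarith, by linarith⟩
  set A : ℝ → Set Plane → Prop := fun θ R => ∃ a b, L.Sec a b R ∧ θ ∈ Icc a b with hA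
  have hAex : ∀ θ, ∃ R, A θ R := fun θ => by
    obtain ⟨ε, hε, R1, R2, h1, h2, -⟩ := L.two_secs θ
    exact ⟨R2, θ, θ + ε, h2, left_mem_Icc.2 (by linarith)⟩
  have key : ∀ θ θ' : ℝ, ∀ R R', A θ R → A θ' R' → Linked D N R R' := by
    intro θ θ'
    refine isPreconnected_univ.induction₂ (fun θ θ' => ∀ R R', A θ R → A θ' R' → Linked D N R R')
      ?_ ?_ ?_ (mem_univ θ) (mem_univ θ')
    · intro θ _
      obtain ⟨ε, hε, R1, R2, h1, h2, h3⟩ := L.two_secs θ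
      have hloc : ∀ θ' ∈ Ioo (θ - ε) (θ + ε), ∀ R, A θ' R → R = R1 ∨ R = R2 := by
        rintro θ' hθ' R ⟨a, b, hs, hm⟩
        have hab := hs.1
        -- find a point in the sector within the window, different from θ
        set a' := max a (θ - ε) with ha'
        set b' := min b (θ + ε) with hb'
        have hlt : a' < b' := by
          apply max_lt <;> apply lt_min
          · exact hab
          · linarith [hm.1, hθ'.2]
          · linarith [hm.2, hθ'.1]
          · linarith
        have q1 := le_max_left a (θ - ε)
        have q2 := le_max_right a (θ - ε)
        have q3 := min_le_left b (θ + ε)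
        have q4 := min_le_right b (θ + ε)
        rcases lt_or_ge a' θ with h | h
        · left
          have h5 : a' < min b' θ := lt_min hlt h
          have q5 := min_le_left b' θ
          have q6 := min_le_right b' θ
          exact hs.eq h1 (θ := (a' + min b' θ) / 2) ⟨by linarith, by linarith⟩
            ⟨by linarith, by linarith⟩
        · right
          exact hs.eq h2 (θ := (a' + b') / 2) ⟨by linarith, by linarith⟩ ⟨by linarith, by linarith⟩
      have hlink : Linked D N R1 R2 := by
        by_cases hT : L.Th θ
        · obtain ⟨e, he, hF⟩ := hT
          exact Relation.ReflTransGen.single ⟨e, hN e he (L.mem_of_F he hF), _, L.gate he hF h1 h2 hρ₀⟩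
        · rw [h3 hT]; exact Relation.ReflTransGen.refl
      rw [nhdsWithin_univ]
      filter_upwards [Ioo_mem_nhds (by linarith : θ - ε < θ) (by linarith : θ < θ + ε)] with
        θ' hθ' R R' hR hR'
      rcases hloc θ ⟨by linarith, by linarith⟩ R hR with rfl | rfl <;>
        rcases hloc θ' hθ' R' hR' with rfl | rfl
      · exact Relation.ReflTransGen.refl
      · exact hlink
      · exact hlink.symm
      · exact Relation.ReflTransGen.refl
    · intro x y z _ _ _ h1 h2 R R' hR hR'
      obtain ⟨R'', hR''⟩ := hAex y
      exact (h1 R R'' hR hR'').trans (h2 R'' R' hR'' hR')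
    · intro x y _ _ h R R' hR hR'
      exact (h R' R hR' hR).symm
  obtain ⟨a, b, h1⟩ := L.regs_sec hR
  obtain ⟨a', b', h2⟩ := L.regs_sec hR'
  exact key a a' R R' ⟨a, b, h1, left_mem_Icc.2 h1.1.le⟩ ⟨a', b', h2, left_mem_Icc.2 h2.1.le⟩

/-! ### Walking along an edge -/

/-- closed crossing neighbourhood -/
def PD.N (D : PD G) (e : Sym2 V) : Set (Sym2 V) := {f | f = e ∨ D.X e f}

theorem PD.param (D : PD G) {x y : V} (h : G.Adj x y) : ∃ γ, ArcOn γ 0 1 (D.S s(x, y)) ∧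
    γ 0 = D.pos x ∧ γ 1 = D.pos y ∧ (∀ s ∈ Ioo (0:ℝ) 1, ∀ z, γ s ≠ D.pos z) ∧
    ∀ p ∈ D.S s(x, y), (∀ z, p ≠ D.pos z) → ∃ s ∈ Ioo (0:ℝ) 1, γ s = p := by
  obtain ⟨γ, hγ, h0, h1⟩ := (D.pa x y h).param
  refine ⟨γ, hγ, h0, h1, ?_, ?_⟩
  · intro s hs z hz
    have hs' := Ioo_subset_Icc_self hs
    have hm : D.pos z ∈ D.S s(x, y) := by rw [← hz, ← hγ.img]; exact ⟨s, hs', rfl⟩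
    rcases Sym2.mem_iff.1 (D.nov _ h z hm) with rfl | rfl
    · have := hγ.inj hs' (by simp) (hz.trans h0.symm)
      linarith [hs.1]
    · have := hγ.inj hs' (by simp) (hz.trans h1.symm)
      linarith [hs.2]
  · intro p hp hv
    rw [← hγ.img] at hp
    obtain ⟨s, hs, rfl⟩ := hp
    refine ⟨s, ⟨lt_of_le_of_ne hs.1 ?_, lt_of_le_of_ne hs.2 ?_⟩, rfl⟩
    · rintro rfl; exact hv _ h0
    · rintro rfl; exact hv _ h1

theorem F1 [Finite V] (D : PD G) {e : Sym2 V} (he : e ∈ G.edgeSet) {R R' : Set Plane}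
    (hR : R ∈ D.RE e) (hR' : R' ∈ D.RE e) : Linked D (D.N e) R R' := by
  induction e using Sym2.ind with
  | _ x y =>
  obtain ⟨γ, hγ, h0, h1, hnv, hsurj⟩ := D.param he
  obtain ⟨p, hp, hpv, hRp⟩ := hR
  obtain ⟨p', hp', hpv', hRp'⟩ := hR'
  obtain ⟨s, hs, rfl⟩ := hsurj p hp hpv
  obtain ⟨s', hs', rfl⟩ := hsurj p' hp' hpv'
  have hmem : ∀ s ∈ Ioo (0:ℝ) 1, γ s ∈ D.S s(x, y) := fun s hs => by
    rw [← hγ.img]; exact ⟨s, Ioo_subset_Icc_self hs, rfl⟩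
  have hN : ∀ s ∈ Ioo (0:ℝ) 1, ∀ g ∈ G.edgeSet, γ s ∈ D.S g → g ∈ D.N s(x, y) := by
    intro s hs g hg hm
    by_cases hge : g = s(x, y)
    · exact Or.inl hge
    · exact Or.inr ⟨he, hg, Ne.symm hge, γ s, ⟨hmem s hs, hm⟩, hnv s hs⟩
  have hne : ∀ s ∈ Ioo (0:ℝ) 1, (D.Regs (γ s)).Nonempty := by
    intro s _
    obtain ⟨L⟩ := exists_loc D (γ s)
    obtain ⟨ε, hε, R1, R2, h1, h2, -⟩ := L.two_secs 0
    exact ⟨R1, h1.regs⟩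
  refine isPreconnected_Ioo.induction₂ (fun s s' => ∀ R ∈ D.Regs (γ s), ∀ R' ∈ D.Regs (γ s'),
    Linked D (D.N s(x, y)) R R') ?_ ?_ ?_ hs hs' R hRp R' hRp'
  · intro s hs
    obtain ⟨L⟩ := exists_loc D (γ s)
    have hc : ContinuousWithinAt γ (Ioo 0 1) s := (hγ.cont.mono Ioo_subset_Icc_self) s hs
    filter_upwards [hc.eventually (near_polar L.hr (γ s)), self_mem_nhdsWithin] with s' h hs' R hR R' hR'
    refine rot (p := γ s) _ (hN s hs) hR ?_
    rcases h with h | ⟨θ, ρ, hρ, h⟩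
    · rw [← h]; exact hR'
    · have hm := hmem s' hs'
      rw [h] at hR' hm
      exact L.on_edge_sub he hρ hm hR'
  · intro a b c ha hb hc h1 h2 R hR R' hR'
    obtain ⟨R'', hR''⟩ := hne b hb
    exact (h1 R hR R'' hR'').trans (h2 R'' hR'' R' hR')
  · intro a b _ _ h R hR R' hR'
    exact (h R' hR' R hR).symm

theorem walk [Finite V] (D : PD G) {e : Sym2 V} (he : e ∈ G.edgeSet) {u : V} {γ : ℝ → Plane}
    (hγ : ArcOn γ 0 1 (D.S e)) (h0 : γ 0 = D.pos u) {s₀ : ℝ} (hs₀ : s₀ ∈ Ioc (0:ℝ) 1)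
    (hord : ∀ s ∈ Ioo 0 s₀, ∀ g ∈ G.edgeSet, γ s ∈ D.S g → g = e) :
    ∀ s ∈ Ioo 0 s₀, D.Regs (γ s) ⊆ D.Regs (D.pos u) := by
  have hsub : Ioo 0 s₀ ⊆ Icc (0:ℝ) 1 := fun s hs => ⟨hs.1.le, hs.2.le.trans hs₀.2⟩
  have hmem : ∀ s ∈ Icc (0:ℝ) 1, γ s ∈ D.S e := fun s hs => by rw [← hγ.img]; exact ⟨s, hs, rfl⟩
  have hconst : ∀ s ∈ Ioo 0 s₀, ∀ s' ∈ Ioo 0 s₀, D.Regs (γ s) = D.Regs (γ s') := by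
    intro s hs s' hs'
    refine isPreconnected_Ioo.induction₂ (fun s s' => D.Regs (γ s) = D.Regs (γ s'))
      ?_ ?_ ?_ hs hs'
    · intro s hs
      obtain ⟨L⟩ := exists_loc D (γ s)
      have hc : ContinuousWithinAt γ (Ioo 0 s₀) s := (hγ.cont.mono hsub) s hs
      filter_upwards [hc.eventually (near_polar L.hr (γ s)), self_mem_nhdsWithin] with s' h hs'
      rcases h with h | ⟨θ, ρ, hρ, h⟩
      · rw [h]
      · have hm := hmem s' (hsub hs')
        rw [h] at hm ⊢
        exact Subset.antisymm (L.two_dirs he (hord s hs) hρ ((L.germ e he θ ρ hρ).1 hm))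
          (L.on_edge_sub he hρ hm)
    · intro a b c _ _ _ h1 h2; exact h1.trans h2
    · intro a b _ _ h; exact h.symm
  have hnear : ∃ s ∈ Ioo 0 s₀, D.Regs (γ s) ⊆ D.Regs (D.pos u) := by
    obtain ⟨L⟩ := exists_loc D (γ 0)
    have hc : ContinuousWithinAt γ (Ioo 0 s₀) 0 := (hγ.cont 0 (by simp)).mono hsub
    have hnb : (𝓝[Ioo 0 s₀] (0:ℝ)).NeBot := by
      rw [nhdsWithin_Ioo_eq_nhdsGT hs₀.1]; infer_instance
    obtain ⟨s, h, hs⟩ := ((hc.eventually (near_polar L.hr (γ 0))).and self_mem_nhdsWithin).exists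
    refine ⟨s, hs, ?_⟩
    rw [← h0]
    rcases h with h | ⟨θ, ρ, hρ, h⟩
    · rw [h]
    · have hm := hmem s (hsub hs)
      rw [h] at hm ⊢
      exact L.on_edge_sub he hρ hm
  obtain ⟨s₁, hs₁, h⟩ := hnear
  intro s hs
  rw [hconst s hs s₁ hs₁]
  exact h

theorem UNC [Finite V] (D : PD G) {e : Sym2 V} (he : e ∈ G.edgeSet) {v : V} (hv : v ∈ e)
    (hX : ∀ g, ¬ D.X e g) : D.RE e ⊆ D.Regs (D.pos v) := by
  obtain ⟨y, rfl⟩ := Sym2.mem_iff_exists.1 hv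
  obtain ⟨γ, hγ, h0, h1, hnv, hsurj⟩ := D.param he
  rintro R ⟨p, hp, hpv, hR⟩
  obtain ⟨s, hs, rfl⟩ := hsurj p hp hpv
  refine walk D he hγ h0 (s₀ := 1) (by simp) ?_ s hs hR
  intro s hs g hg hm
  by_contra hne
  exact hX g ⟨he, hg, Ne.symm hne, γ s, ⟨by rw [← hγ.img]; exact ⟨s, Ioo_subset_Icc_self hs, rfl⟩, hm⟩,
    hnv s hs⟩

theorem F3' [Finite V] (D : PD G) {e : Sym2 V} (he : e ∈ G.edgeSet) {u : V} (hu : u ∈ e) :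
    (D.RE e ∩ D.Regs (D.pos u)).Nonempty := by
  obtain ⟨y, rfl⟩ := Sym2.mem_iff_exists.1 hu
  obtain ⟨L⟩ := exists_loc D (D.pos u)
  obtain ⟨θ₀, hF⟩ := L.one _ he u hu rfl
  have hθ : pol θ₀ ∈ L.F s(u, y) := by rw [hF]; rfl
  obtain ⟨ε, hε, R1, R2, h1, h2, -⟩ := L.two_secs θ₀
  exact ⟨R2, L.ray_mem he hθ (fun ρ hρ => h2.left_RE he hθ hρ), h2.regs⟩

theorem F3 [Finite V] (D : PD G) {e g : Sym2 V} (he : e ∈ G.edgeSet) (hg : g ∈ G.edgeSet)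
    (hge : g ≠ e) {u : V} (hu : u ∈ e) {p : Plane} (hpe : p ∈ D.S e) (hpg : p ∈ D.S g)
    (hpu : p ≠ D.pos u) : ∃ h ∈ G.edgeSet, u ∉ h ∧ (D.RE h ∩ D.Regs (D.pos u)).Nonempty := by
  obtain ⟨y, rfl⟩ := Sym2.mem_iff_exists.1 hu
  obtain ⟨γ, hγ, h0, h1, hnv, hsurj⟩ := D.param he
  set e := s(u, y) with hedef
  set B : Set ℝ := {s ∈ Icc (0:ℝ) 1 | ∃ g ∈ G.edgeSet, g ≠ e ∧ γ s ∈ D.S g ∧ γ s ≠ D.pos u} with hB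
  have hmem : ∀ s ∈ Icc (0:ℝ) 1, γ s ∈ D.S e := fun s hs => by rw [← hγ.img]; exact ⟨s, hs, rfl⟩
  have hfin : B.Finite := by
    have hf : (⋃ g ∈ {g | g ∈ G.edgeSet ∧ g ≠ e}, (D.S e ∩ D.S g)).Finite :=
      (toFinite _).biUnion fun g hg => D.fin e he g hg.1 hg.2.symm
    refine Finite.of_finite_image (f := γ) (hf.subset ?_) (hγ.inj.mono fun s hs => hs.1)
    rintro _ ⟨s, ⟨hs, g, hg, hne, hm, -⟩, rfl⟩
    exact mem_biUnion (x := g) ⟨hg, hne⟩ ⟨hmem s hs, hm⟩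
  have hBne : B.Nonempty := by
    rw [← hγ.img] at hpe
    obtain ⟨s, hs, rfl⟩ := hpe
    exact ⟨s, hs, g, hg, hge, hpg, hpu⟩
  obtain ⟨s₀, ⟨hs₀, g₀, hg₀, hne₀, hm₀, hu₀⟩, hmin⟩ := Set.exists_min_image B id hfin hBne
  have hs₀' : s₀ ∈ Ioc (0:ℝ) 1 := ⟨lt_of_le_of_ne hs₀.1 (by rintro rfl; exact hu₀ h0), hs₀.2⟩
  have hsub : Ioo 0 s₀ ⊆ Icc (0:ℝ) 1 := fun s hs => ⟨hs.1.le, hs.2.le.trans hs₀.2⟩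
  have hw := walk D he hγ h0 hs₀' (by
    intro s hs g hg hm
    by_contra hne
    have := hmin s ⟨hsub hs, g, hg, hne, hm, fun h => by
      have := hγ.inj (hsub hs) (by simp) (h.trans h0.symm)
      linarith [hs.1]⟩
    simp only [id] at this
    linarith [hs.2])
  obtain ⟨L⟩ := exists_loc D (γ s₀)
  have hnb : (𝓝[Ioo 0 s₀] s₀).NeBot := by
    rw [nhdsWithin_Ioo_eq_nhdsLT hs₀'.1]; infer_instance
  have hc : ContinuousWithinAt γ (Ioo 0 s₀) s₀ := (hγ.cont s₀ hs₀).mono hsub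
  obtain ⟨s, h, hs⟩ := ((hc.eventually (near_polar L.hr (γ s₀))).and self_mem_nhdsWithin).exists
  rcases h with h | ⟨θ, ρ, hρ, h⟩
  · have := hγ.inj (hsub hs) hs₀ h
    exact absurd this hs.2.ne
  have hm := hmem s (hsub hs)
  have hregs := hw s hs
  rw [h] at hm hregs
  have hθ : pol θ ∈ L.F e := (L.germ e he θ ρ hρ).1 hm
  have hT : L.Th θ := ⟨e, he, hθ⟩
  obtain ⟨θn, hn, ⟨hn', hEn, hFn⟩, R', h2⟩ := L.next hT
  obtain ⟨θp, hp, ⟨hp', hEp, hFp⟩, R, h1⟩ := L.prev hT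
  have hun : ∀ h ∈ G.edgeSet, h ≠ e → γ s₀ ∈ D.S h → u ∉ h := by
    intro h hE hne hm' hu'
    exact hu₀ (D.shared e he h hE (Ne.symm hne) u hu hu' ⟨hmem s₀ hs₀, hm'⟩)
  by_cases c1 : hn' = e
  · by_cases c2 : hp' = e
    · exfalso
      rw [c1] at hFn
      rw [c2] at hFp
      obtain ⟨α, _, hα⟩ := L.two g₀ hg₀ hm₀
      have hαF : pol α ∈ L.F g₀ := by rw [hα]; simp
      rcases L.cover he h1 h2 hp.1 hFp hθ hFn α with h4 | ⟨α', hα', h4 | h4⟩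
      · exact hne₀ (L.uniq hg₀ he hαF h4)
      · exact h1.free α' h4 ⟨g₀, hg₀, by rw [hα']; exact hαF⟩
      · exact h2.free α' h4 ⟨g₀, hg₀, by rw [hα']; exact hαF⟩
    · exact ⟨hp', hEp, hun hp' hEp c2 (L.mem_of_F hEp hFp), R,
        L.ray_mem hEp hFp (fun ρ hρ => h1.left_RE hEp hFp hρ), hregs (h1.right_RE he hθ hρ)⟩
  · exact ⟨hn', hEn, hun hn' hEn c1 (L.mem_of_F hEn hFn), R',
      L.ray_mem hEn hFn (fun ρ hρ => h2.right_RE hEn hFn hρ), hregs (h2.left_RE he hθ hρ)⟩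

/-! ### Rotation around a vertex -/

/-- consecutive edges -/
def PD.Gam (D : PD G) (e f : Sym2 V) : Prop :=
  e ∈ G.edgeSet ∧ f ∈ G.edgeSet ∧ e ≠ f ∧ (∃ x, x ∈ e ∧ x ∈ f) ∧ (D.RE e ∩ D.RE f).Nonempty

theorem PD.Gam.symm {D : PD G} {e f : Sym2 V} (h : D.Gam e f) : D.Gam f e := by
  obtain ⟨h1, h2, h3, ⟨x, hx, hx'⟩, R, hR, hR'⟩ := h
  exact ⟨h2, h1, h3.symm, ⟨x, hx', hx⟩, R, hR', hR⟩

theorem between [Finite V] (D : PD G) {x : V} (L : Loc D (D.pos x)) (lam : Sym2 V → ℤ)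
    (hlam : ∀ e f, D.Gam e f → lam f ≤ lam e + 1) {a b : ℝ} (hab : a < b) {e e' : Sym2 V}
    (he : e ∈ G.edgeSet) (he' : e' ∈ G.edgeSet) (ha : pol a ∈ L.F e) (hb : pol b ∈ L.F e') {l : ℤ}
    (h1 : lam e < l) (h2 : l < lam e') :
    ∃ c ∈ Ioo a b, ∃ f ∈ G.edgeSet, pol c ∈ L.F f ∧ lam f = l := by
  have hx : ∀ f ∈ G.edgeSet, ∀ d ∈ L.F f, x ∈ f := fun f hf d hd => D.nov f hf x (L.mem_of_F hf hd)
  have hf1 : {θ ∈ Icc a b | ∃ f ∈ G.edgeSet, pol θ ∈ L.F f ∧ lam f < l}.Finite :=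
    (L.fin_Th a b).subset fun θ hθ => ⟨hθ.1, hθ.2.choose, hθ.2.choose_spec.1, hθ.2.choose_spec.2.1⟩
  obtain ⟨s, ⟨hs, f, hf, hsf, hfl⟩, hmax⟩ := Set.exists_max_image _ id hf1
    ⟨a, left_mem_Icc.2 hab.le, e, he, ha, h1⟩
  have hsb : s < b := lt_of_le_of_ne hs.2 (by
    rintro rfl
    have := L.uniq hf he' hsf hb
    subst this; omega)
  have hf2 : {θ ∈ Icc a b | L.Th θ ∧ s < θ}.Finite :=
    (L.fin_Th a b).subset fun θ hθ => ⟨hθ.1, hθ.2.1⟩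
  obtain ⟨c, ⟨hc, ⟨g, hg, hcg⟩, hsc⟩, hmin⟩ := Set.exists_min_image _ id hf2
    ⟨b, right_mem_Icc.2 hab.le, ⟨e', he', hb⟩, hsb⟩
  obtain ⟨R, hR⟩ := L.sec_exists hsc (fun α hα hT => by
    have := hmin α ⟨⟨by linarith [hs.1, hα.1], by linarith [hc.2, hα.2]⟩, hT, hα.1⟩
    simp only [id] at this
    linarith [hα.2])
  have hgl : l ≤ lam g := by
    by_contra hcon
    have := hmax c ⟨hc, g, hg, hcg, not_le.1 hcon⟩
    simp only [id] at this
    linarith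
  have hfg : f ≠ g := by rintro rfl; omega
  have := hlam f g ⟨hf, hg, hfg, ⟨x, hx f hf _ hsf, hx g hg _ hcg⟩, R,
    L.ray_mem hf hsf (fun ρ hρ => hR.left_RE hf hsf hρ),
    L.ray_mem hg hcg (fun ρ hρ => hR.right_RE hg hcg hρ)⟩
  have hgl' : lam g = l := by omega
  refine ⟨c, ⟨by linarith [hs.1], lt_of_le_of_ne hc.2 ?_⟩, g, hg, hcg, hgl'⟩
  rintro rfl
  have := L.uniq hg he' hcg hb
  subst this; omega

theorem F2 [Finite V] (D : PD G) (lam : Sym2 V → ℤ) (hlam : ∀ e f, D.Gam e f → lam f ≤ lam e + 1)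
    {x : V} {g g' : Sym2 V} (hg : g ∈ G.edgeSet) (hg' : g' ∈ G.edgeSet) (hx : x ∈ g) (hx' : x ∈ g')
    {l : ℤ} (h1 : lam g < l) (h2 : l < lam g') :
    ∃ f₁ ∈ G.edgeSet, ∃ f₂ ∈ G.edgeSet, f₁ ≠ f₂ ∧ x ∈ f₁ ∧ x ∈ f₂ ∧ lam f₁ = l ∧ lam f₂ = l := by
  obtain ⟨L⟩ := exists_loc D (D.pos x)
  have hpi := Real.pi_pos
  have hxm : ∀ f ∈ G.edgeSet, ∀ d ∈ L.F f, x ∈ f := fun f hf d hd => D.nov f hf x (L.mem_of_F hf hd)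
  obtain ⟨a, ha⟩ := L.one g hg x hx rfl
  obtain ⟨b₀, hb₀⟩ := L.one g' hg' x hx' rfl
  obtain ⟨b, hb, heq⟩ : ∃ b ∈ Ioc a (a + 2 * Real.pi), pol b = pol b₀ := by
    refine ⟨toIocMod Real.two_pi_pos a b₀, toIocMod_mem_Ioc _ _ _, ?_⟩
    rw [pol_eq_iff]
    refine ⟨-toIocDiv Real.two_pi_pos a b₀, ?_⟩
    rw [toIocMod, zsmul_eq_mul]; push_cast; ring
  have fa : pol a ∈ L.F g := by rw [ha]; rfl
  have fb : pol b ∈ L.F g' := by rw [hb₀, heq]; rfl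
  have fa' : pol (a + 2 * Real.pi) ∈ L.F g := by rw [pol_two_pi]; exact fa
  have hblt : b < a + 2 * Real.pi := lt_of_le_of_ne hb.2 (by
    rintro rfl
    have := L.uniq hg hg' fa' fb
    subst this; omega)
  obtain ⟨c₁, hc₁, f₁, hf₁, hF₁, hl₁⟩ := between D L lam hlam hb.1 hg hg' fa fb h1 h2
  obtain ⟨c₂, hc₂, f₂, hf₂, hF₂, hl₂⟩ := between D L (fun e => - lam e) (fun e f h => by
    have := hlam f e h.symm; omega) hblt hg' hg fb fa' (l := -l) (by omega) (by omega)
  refine ⟨f₁, hf₁, f₂, hf₂, ?_, hxm _ hf₁ _ hF₁, hxm _ hf₂ _ hF₂, hl₁, by omega⟩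
  rintro rfl
  obtain ⟨d, hd⟩ := L.one f₁ hf₁ x (hxm _ hf₁ _ hF₁) rfl
  rw [hd] at hF₁ hF₂
  have := pol_inj_lt (hF₁.trans hF₂.symm) (by
    rw [abs_lt]; constructor <;> linarith [hc₁.1, hc₁.2, hc₂.1, hc₂.2])
  linarith [hc₁.2, hc₂.1]

theorem F4 [Finite V] (D : PD G) {x : V} {e f : Sym2 V} (he : e ∈ G.edgeSet) (hf : f ∈ G.edgeSet)
    (hxe : x ∈ e) (hxf : x ∈ f) : Relation.ReflTransGen D.Gam e f := by
  classical
  by_contra hcon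
  obtain ⟨f₁, _, f₂, _, _, _, _, h, _⟩ := F2 D (fun g => if Relation.ReflTransGen D.Gam e g then 0 else 2)
    (by
      intro a b hab
      by_cases h : Relation.ReflTransGen D.Gam e a
      · simp [h, h.tail hab]
      · simp only [h, if_false]; split_ifs <;> norm_num) he hf hxe hxf (l := 1)
    (by simp [Relation.ReflTransGen.refl]) (by simp [hcon])
  split_ifs at h <;> omega

end FCF

namespace FCF
open Set Filter Topology

section Comb
variable {V : Type} [Fintype V] [DecidableEq V] (E : Set (Sym2 V)) (lam : Sym2 V → ℕ) (u v : V)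

open Classical in
/-- vertices (different from `u`, `v`) having an edge of level at most `c` -/
noncomputable def combW (c : ℕ) : Finset V :=
  Finset.univ.filter fun x => x ≠ u ∧ x ≠ v ∧ ∃ e ∈ E, x ∈ e ∧ lam e ≤ c

open Classical in
noncomputable def combNb (x : V) (c M : ℕ) : Finset V :=
  Finset.univ.filter fun y => s(x, y) ∈ E ∧ c < lam s(x, y) ∧ lam s(x, y) < M

theorem comb_count (H1 : ∀ x, ∀ g ∈ E, ∀ g' ∈ E, x ∈ g → x ∈ g' → ∀ l, lam g < l → l < lam g' →
      ∃ f₁ ∈ E, ∃ f₂ ∈ E, f₁ ≠ f₂ ∧ x ∈ f₁ ∧ x ∈ f₂ ∧ lam f₁ = l ∧ lam f₂ = l)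
    {x : V} {c M : ℕ} (h1 : ∃ g ∈ E, x ∈ g ∧ lam g ≤ c)
    (h2 : ∃ g ∈ E, x ∈ g ∧ lam g = M) (hcM : c < M) :
    2 * M ≤ (combNb E lam x c M).card + 2 * c + 2 := by
  classical
  obtain ⟨g, hg, hxg, hl⟩ := h1
  obtain ⟨g', hg', hxg', hl'⟩ := h2
  have hmap : ∀ y ∈ combNb E lam x c M, lam s(x, y) ∈ Finset.Ioo c M := by
    intro y hy
    simp only [combNb, Finset.mem_filter] at hy
    simp [hy.2.2]
  have hc := Finset.card_eq_sum_card_fiberwise hmap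
  have : (Finset.Ioo c M).card • 2 ≤ (combNb E lam x c M).card := by
    rw [hc]
    apply Finset.card_nsmul_le_sum
    intro l hl1
    rw [Finset.mem_Ioo] at hl1
    obtain ⟨f₁, hf₁, f₂, hf₂, hne, hx₁, hx₂, e₁, e₂⟩ := H1 x g hg g' hg' hxg hxg' l (by omega) (by omega)
    obtain ⟨y₁, rfl⟩ := Sym2.mem_iff_exists.1 hx₁
    obtain ⟨y₂, rfl⟩ := Sym2.mem_iff_exists.1 hx₂
    have hy : y₁ ≠ y₂ := by rintro rfl; exact hne rfl
    rw [← Finset.card_pair hy]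
    apply Finset.card_le_card
    intro z hz
    simp only [Finset.mem_insert, Finset.mem_singleton] at hz
    rcases hz with rfl | rfl <;> simp [combNb, *]
  rw [Nat.card_Ioo, smul_eq_mul] at this
  omega

/-- the inductive invariant -/
def combState (c : ℕ) : Prop :=
  ∀ x, (∃ g ∈ E, x ∈ g ∧ lam g ≤ c) → (∃ g ∈ E, x ∈ g ∧ c < lam g) →
    ∃ T ⊆ combW E lam u v c, x ∉ T ∧ (∀ y ∈ T, s(x, y) ∈ E → lam s(x, y) ≤ c) ∧
      2 * c + 3 ≤ T.card + (combW E lam u v c).card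

theorem comb_step (L : ℕ)
    (hdiag : ∀ e ∈ E, ¬ e.IsDiag) (huv : u ≠ v)
    (H1 : ∀ x, ∀ g ∈ E, ∀ g' ∈ E, x ∈ g → x ∈ g' → ∀ l, lam g < l → l < lam g' →
      ∃ f₁ ∈ E, ∃ f₂ ∈ E, f₁ ≠ f₂ ∧ x ∈ f₁ ∧ x ∈ f₂ ∧ lam f₁ = l ∧ lam f₂ = l)
    (H2 : ∀ l < L, ∃ e ∈ E, ∃ f ∈ E, ∃ x, x ∈ e ∧ x ∈ f ∧ lam e = l ∧ lam f = l + 1)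
    (H3 : ∀ e ∈ E, lam e ≤ L) (H3u : ∀ e ∈ E, u ∈ e → lam e = 0)
    (H3v : ∀ e ∈ E, v ∈ e → lam e = L)
    (H4' : ∀ x, s(v, x) ∈ E → (∃ g ∈ E, x ∈ g ∧ g ≠ s(v, x)) → ∃ g ∈ E, lam g = L ∧ v ∉ g) :
    ∀ k c, L - c = k → c < L → combState E lam u v c → L + 4 ≤ Fintype.card V := by
  classical
  intro k
  induction k using Nat.strong_induction_on with
  | _ k ih =>
  intro c hk hcL hS
  -- the maximal reachable level
  obtain ⟨M, ⟨x₀, hx₀, hx₀'⟩, hMmax⟩ : ∃ M, (∃ x, (∃ g ∈ E, x ∈ g ∧ lam g ≤ c) ∧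
      (∃ g ∈ E, x ∈ g ∧ lam g = M)) ∧ ∀ x, (∃ g ∈ E, x ∈ g ∧ lam g ≤ c) → ∀ g ∈ E, x ∈ g →
        lam g ≤ M := by
    have hne : ∃ M, ∃ x, (∃ g ∈ E, x ∈ g ∧ lam g ≤ c) ∧ (∃ g ∈ E, x ∈ g ∧ lam g = M) := by
      obtain ⟨e, he, f, hf, x, hxe, hxf, h1, h2⟩ := H2 c hcL
      exact ⟨c + 1, x, ⟨e, he, hxe, h1.le⟩, f, hf, hxf, h2⟩
    have hP : ∀ M, (∃ x, (∃ g ∈ E, x ∈ g ∧ lam g ≤ c) ∧ (∃ g ∈ E, x ∈ g ∧ lam g = M)) → M ≤ L := by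
      rintro M ⟨x, _, g, hg, _, rfl⟩
      exact H3 g hg
    obtain ⟨M₀, hM₀⟩ := hne
    refine ⟨Nat.findGreatest (fun M => ∃ x, (∃ g ∈ E, x ∈ g ∧ lam g ≤ c) ∧
      (∃ g ∈ E, x ∈ g ∧ lam g = M)) L, Nat.findGreatest_spec (P := fun M => ∃ x, (∃ g ∈ E, x ∈ g ∧ lam g ≤ c) ∧
      (∃ g ∈ E, x ∈ g ∧ lam g = M)) (hP _ hM₀) hM₀, ?_⟩
    intro x hx g hg hxg
    exact Nat.le_findGreatest (H3 g hg) ⟨x, hx, g, hg, hxg, rfl⟩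
  have hcM : c < M := by
    obtain ⟨e, he, f, hf, x, hxe, hxf, h1, h2⟩ := H2 c hcL
    have := hMmax x ⟨e, he, hxe, h1.le⟩ f hf hxf
    omega
  have hML : M ≤ L := by
    obtain ⟨g, hg, _, rfl⟩ := hx₀'
    exact H3 g hg
  have hcard : (Finset.univ \ {u, v} : Finset V).card + 2 = Fintype.card V := by
    rw [Finset.card_sdiff_of_subset (Finset.subset_univ _), Finset.card_pair huv, Finset.card_univ]
    have : ({u, v} : Finset V).card ≤ Fintype.card V := Finset.card_le_univ _
    rw [Finset.card_pair huv] at this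
    omega
  have hWV : ∀ c, combW E lam u v c ⊆ Finset.univ \ {u, v} := by
    intro c x hx
    simp only [combW, Finset.mem_filter] at hx
    simp [hx.2.1, hx.2.2.1]
  -- properties of candidates
  have hcand : ∀ x, (∃ g ∈ E, x ∈ g ∧ lam g ≤ c) → (∃ g ∈ E, x ∈ g ∧ lam g = M) →
      x ∈ combW E lam u v c := by
    intro x hx hx'
    simp only [combW, Finset.mem_filter, Finset.mem_univ, true_and]
    refine ⟨?_, ?_, hx⟩
    · rintro rfl
      obtain ⟨g, hg, hu, h⟩ := hx'
      have := H3u g hg hu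
      omega
    · rintro rfl
      obtain ⟨g, hg, hu, h⟩ := hx
      have := H3v g hg hu
      omega
  have hWmono : combW E lam u v c ⊆ combW E lam u v M := by
    intro x hx
    simp only [combW, Finset.mem_filter, Finset.mem_univ, true_and] at hx ⊢
    obtain ⟨h1, h2, g, hg, hxg, hl⟩ := hx
    exact ⟨h1, h2, g, hg, hxg, by omega⟩
  have hnbW : ∀ x, combNb E lam x c M ⊆ combW E lam u v M := by
    intro x y hy
    simp only [combNb, combW, Finset.mem_filter, Finset.mem_univ, true_and] at hy ⊢
    refine ⟨?_, ?_, s(x, y), hy.1, by simp, by omega⟩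
    · rintro rfl
      have := H3u _ hy.1 (by simp)
      omega
    · rintro rfl
      have := H3v _ hy.1 (by simp)
      omega
  -- big set
  have hbig : ∀ x, (∃ g ∈ E, x ∈ g ∧ lam g ≤ c) → (∃ g ∈ E, x ∈ g ∧ lam g = M) →
      ∀ T ⊆ combW E lam u v c, x ∉ T → (∀ y ∈ T, s(x, y) ∈ E → lam s(x, y) ≤ c) →
      (T.card + 1 + (combNb E lam x c M).card ≤ (combW E lam u v M).card) ∧
      ∀ y, s(x, y) ∈ E → lam s(x, y) = M → y ≠ v →
      (T.card + 2 + (combNb E lam x c M).card ≤ (combW E lam u v M).card) := by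
    intro x hx hx' T hT hxT hTl
    have hxnb : x ∉ combNb E lam x c M := by
      intro h
      simp only [combNb, Finset.mem_filter, Finset.mem_univ, true_and] at h
      exact hdiag _ h.1 (by simp)
    have hd : Disjoint (insert x T) (combNb E lam x c M) := by
      rw [Finset.disjoint_insert_left]
      refine ⟨hxnb, ?_⟩
      rw [Finset.disjoint_left]
      intro y hy hy'
      simp only [combNb, Finset.mem_filter, Finset.mem_univ, true_and] at hy'
      have := hTl y hy hy'.1
      omega
    have hsub : insert x T ∪ combNb E lam x c M ⊆ combW E lam u v M := by
      apply Finset.union_subset _ (hnbW x)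
      rw [Finset.insert_subset_iff]
      exact ⟨hWmono (hcand x hx hx'), hT.trans hWmono⟩
    have hc1 : (insert x T ∪ combNb E lam x c M).card = T.card + 1 + (combNb E lam x c M).card := by
      rw [Finset.card_union_of_disjoint hd, Finset.card_insert_of_notMem hxT]
    refine ⟨hc1 ▸ Finset.card_le_card hsub, ?_⟩
    intro y hy hyl hyv
    have hyn : y ∉ insert x T ∪ combNb E lam x c M := by
      simp only [Finset.mem_union, Finset.mem_insert, not_or]
      refine ⟨⟨?_, ?_⟩, ?_⟩
      · rintro rfl
        exact hdiag _ hy (by simp)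
      · intro h
        have := hTl y h hy
        omega
      · intro h
        simp only [combNb, Finset.mem_filter, Finset.mem_univ, true_and] at h
        omega
    have := Finset.card_le_card (s := insert y (insert x T ∪ combNb E lam x c M))
      (t := combW E lam u v M) (by
        rw [Finset.insert_subset_iff]
        refine ⟨?_, hsub⟩
        simp only [combW, Finset.mem_filter, Finset.mem_univ, true_and]
        refine ⟨?_, hyv, s(x, y), hy, by simp, hyl.le⟩
        rintro rfl
        have := H3u _ hy (by simp)
        omega)
    rw [Finset.card_insert_of_notMem hyn, hc1] at this
    omega
  have hWcV := Finset.card_le_card (hWV c)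
  have hWMV := Finset.card_le_card (hWV M)
  rcases hML.lt_or_eq with hML | rfl
  · -- step
    refine ih (L - M) (by omega) M rfl hML ?_
    obtain ⟨T, hT, hxT, hTl, hTc⟩ := hS x₀ hx₀ (by
      obtain ⟨g, hg, h, h'⟩ := hx₀'
      exact ⟨g, hg, h, by omega⟩)
    obtain ⟨-, h2⟩ := hbig x₀ hx₀ hx₀' T hT hxT hTl
    have h3 := comb_count E lam H1 hx₀ hx₀' hcM
    obtain ⟨g, hg, hxg, hgM⟩ := hx₀'
    obtain ⟨y, rfl⟩ := Sym2.mem_iff_exists.1 hxg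
    have h4 := h2 y hg hgM (by
      rintro rfl
      have := H3v _ hg (by simp)
      omega)
    intro x hx hx'
    refine ⟨combW E lam u v c, hWmono, ?_, ?_, by omega⟩
    · intro hxW
      simp only [combW, Finset.mem_filter, Finset.mem_univ, true_and] at hxW
      obtain ⟨g, hg, hxg, hl⟩ := hx'
      have := hMmax x hxW.2.2 g hg hxg
      omega
    · intro y hy hxy
      simp only [combW, Finset.mem_filter, Finset.mem_univ, true_and] at hy
      exact hMmax y hy.2.2 _ hxy (by simp)
  · -- end
    by_cases hA : ∃ x y, (∃ g ∈ E, x ∈ g ∧ lam g ≤ c) ∧ s(x, y) ∈ E ∧ lam s(x, y) = M ∧ y ≠ v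
    · obtain ⟨x, y, hx, hxy, hl, hyv⟩ := hA
      have hx' : ∃ g ∈ E, x ∈ g ∧ lam g = M := ⟨_, hxy, by simp, hl⟩
      obtain ⟨T, hT, hxT, hTl, hTc⟩ := hS x hx ⟨_, hxy, by simp, by omega⟩
      obtain ⟨-, h2⟩ := hbig x hx hx' T hT hxT hTl
      have h3 := comb_count E lam H1 hx hx' hcM
      have h4 := h2 y hxy hl hyv
      omega
    · push Not at hA
      obtain ⟨T, hT, hxT, hTl, hTc⟩ := hS x₀ hx₀ (by
        obtain ⟨g, hg, h, h'⟩ := hx₀'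
        exact ⟨g, hg, h, by omega⟩)
      obtain ⟨h2, -⟩ := hbig x₀ hx₀ hx₀' T hT hxT hTl
      have h3 := comb_count E lam H1 hx₀ hx₀' hcM
      obtain ⟨g, hg, hxg, hgM⟩ := hx₀'
      obtain ⟨y, rfl⟩ := Sym2.mem_iff_exists.1 hxg
      have := hA x₀ y hx₀ hg hgM
      subst this
      obtain ⟨g', hg', hvg', hne'⟩ := H4' x₀ (by rwa [Sym2.eq_swap]) (by
        obtain ⟨g', hg', h, h'⟩ := hx₀
        refine ⟨g', hg', h, ?_⟩
        rintro rfl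
        rw [Sym2.eq_swap] at h'
        omega)
      induction g' using Sym2.ind with
      | _ a b =>
      have hab : a ≠ b := by rintro rfl; exact hdiag _ hg' (by simp)
      have hva : a ≠ y := by rintro rfl; exact hne' (by simp)
      have hvb : b ≠ y := by rintro rfl; exact hne' (by simp)
      have hua : a ≠ u := by
        rintro rfl
        have := H3u _ hg' (by simp)
        omega
      have hub : b ≠ u := by
        rintro rfl
        have := H3u _ hg' (by simp)
        omega
      have ha : a ∉ combW E lam u y c := by
        intro h
        simp only [combW, Finset.mem_filter, Finset.mem_univ, true_and] at h
        exact hvb (hA a b h.2.2 hg' hvg')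
      have hb : b ∉ combW E lam u y c := by
        intro h
        simp only [combW, Finset.mem_filter, Finset.mem_univ, true_and] at h
        exact hva (hA b a h.2.2 (by rwa [Sym2.eq_swap]) (by rwa [Sym2.eq_swap]))
      have h5 := Finset.card_le_card (s := insert a (insert b (combW E lam u y c)))
        (t := Finset.univ \ {u, y}) (by
          rw [Finset.insert_subset_iff, Finset.insert_subset_iff]
          refine ⟨?_, ?_, hWV c⟩ <;> simp [*])
      rw [Finset.card_insert_of_notMem (by simp [hab, ha]), Finset.card_insert_of_notMem hb] at h5
      omega

theorem comb_main (L : ℕ) (hL : 0 < L)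
    (hdiag : ∀ e ∈ E, ¬ e.IsDiag) (huv : u ≠ v)
    (H1 : ∀ x, ∀ g ∈ E, ∀ g' ∈ E, x ∈ g → x ∈ g' → ∀ l, lam g < l → l < lam g' →
      ∃ f₁ ∈ E, ∃ f₂ ∈ E, f₁ ≠ f₂ ∧ x ∈ f₁ ∧ x ∈ f₂ ∧ lam f₁ = l ∧ lam f₂ = l)
    (H2 : ∀ l < L, ∃ e ∈ E, ∃ f ∈ E, ∃ x, x ∈ e ∧ x ∈ f ∧ lam e = l ∧ lam f = l + 1)
    (H3 : ∀ e ∈ E, lam e ≤ L) (H3u : ∀ e ∈ E, u ∈ e → lam e = 0)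
    (H3v : ∀ e ∈ E, v ∈ e → lam e = L)
    (H4 : ∀ x, s(u, x) ∈ E → (∃ g ∈ E, x ∈ g ∧ g ≠ s(u, x)) → ∃ g ∈ E, lam g = 0 ∧ u ∉ g)
    (H4' : ∀ x, s(v, x) ∈ E → (∃ g ∈ E, x ∈ g ∧ g ≠ s(v, x)) → ∃ g ∈ E, lam g = L ∧ v ∉ g) :
    L + 4 ≤ Fintype.card V := by
  classical
  refine comb_step E lam u v L hdiag huv H1 H2 H3 H3u H3v H4' _ 0 rfl hL ?_
  intro x hx hx'
  have hxu : x ≠ u := by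
    rintro rfl
    obtain ⟨g, hg, h, h'⟩ := hx'
    have := H3u g hg h
    omega
  have hxv : x ≠ v := by
    rintro rfl
    obtain ⟨g, hg, h, h'⟩ := hx
    have := H3v g hg h
    omega
  have hxW : x ∈ combW E lam u v 0 := by
    simp only [combW, Finset.mem_filter, Finset.mem_univ, true_and]
    exact ⟨hxu, hxv, hx⟩
  have hzero : ∀ a b, s(a, b) ∈ E → lam s(a, b) = 0 → a ≠ u → a ∈ combW E lam u v 0 := by
    intro a b h h0 hu
    simp only [combW, Finset.mem_filter, Finset.mem_univ, true_and]
    refine ⟨hu, ?_, _, h, by simp, h0.le⟩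
    rintro rfl
    have := H3v _ h (by simp)
    omega
  by_cases hz : ∃ z, s(x, z) ∈ E ∧ lam s(x, z) = 0 ∧ z ≠ u
  · obtain ⟨z, hxz, hl, hzu⟩ := hz
    have hne : x ≠ z := by rintro rfl; exact hdiag _ hxz (by simp)
    have hzW := hzero z x (by rwa [Sym2.eq_swap]) (by rwa [Sym2.eq_swap]) hzu
    refine ⟨{z}, by simpa using hzW, by simpa using hne, by simp [hl], ?_⟩
    have := Finset.card_le_card (s := {x, z}) (t := combW E lam u v 0) (by
      rw [Finset.insert_subset_iff]; simp [hxW, hzW])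
    rw [Finset.card_pair hne] at this
    simp; omega
  · push Not at hz
    obtain ⟨g, hg, hxg, hl⟩ := hx
    obtain ⟨y, rfl⟩ := Sym2.mem_iff_exists.1 hxg
    have := hz y hg (by omega)
    subst this
    obtain ⟨g', hg', hl', hu'⟩ := H4 x (by rwa [Sym2.eq_swap]) (by
      obtain ⟨g', hg', h, h'⟩ := hx'
      refine ⟨g', hg', h, ?_⟩
      rintro rfl
      rw [Sym2.eq_swap] at h'
      omega)
    induction g' using Sym2.ind with
    | _ a b =>
    have hab : a ≠ b := by rintro rfl; exact hdiag _ hg' (by simp)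
    have hua : a ≠ y := by rintro rfl; exact hu' (by simp)
    have hub : b ≠ y := by rintro rfl; exact hu' (by simp)
    have hxa : x ≠ a := by rintro rfl; exact hub (hz b hg' hl')
    have hxb : x ≠ b := by
      rintro rfl; exact hua (hz a (by rwa [Sym2.eq_swap]) (by rwa [Sym2.eq_swap]))
    refine ⟨∅, by simp, by simp, by simp, ?_⟩
    have := Finset.card_le_card (s := {x, a, b}) (t := combW E lam y v 0) (by
      rw [Finset.insert_subset_iff, Finset.insert_subset_iff, Finset.singleton_subset_iff]
      exact ⟨hxW, hzero a b hg' hl' hua, hzero b a (by rwa [Sym2.eq_swap]) (by rwa [Sym2.eq_swap]) hub⟩)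
    rw [Finset.card_eq_three.2 ⟨x, a, b, hxa, hxb, hab, rfl⟩] at this
    simp; omega

end Comb
end FCF

namespace FCF
open Set Filter Topology
variable {V : Type} {G : SimpleGraph V}

theorem PD.pos_mem (D : PD G) {e : Sym2 V} (he : e ∈ G.edgeSet) {z : V} (hz : z ∈ e) :
    D.pos z ∈ D.S e := by
  obtain ⟨y, rfl⟩ := Sym2.mem_iff_exists.1 hz
  exact (D.pa z y he).left_mem

theorem four_le [Fintype V] {a b c d : V} (h1 : a ≠ b) (h2 : a ≠ c) (h3 : a ≠ d) (h4 : b ≠ c) (h5 : b ≠ d)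
    (h6 : c ≠ d) : 4 ≤ Fintype.card V := by
  classical
  have : ({a, b, c, d} : Finset V).card = 4 := by
    rw [Finset.card_insert_of_notMem (by simp [*]), Finset.card_insert_of_notMem (by simp [*]),
      Finset.card_pair h6]
  rw [← this]
  exact Finset.card_le_univ _

theorem four_le_of_X [Fintype V] (D : PD G) {e f : Sym2 V} (h : D.X e f) : 4 ≤ Fintype.card V := by
  have hd := h.disj
  have he := h.1
  have hf := h.2.1
  induction e using Sym2.ind with
  | _ a b =>
  induction f using Sym2.ind with
  | _ c d =>
  have h1 := hd a (by simp)
  have h2 := hd b (by simp)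
  simp only [Sym2.mem_iff, not_or] at h1 h2
  exact four_le he.ne h1.1 h1.2 h2.1 h2.2 hf.ne

/-- edges having a region in common with `u` -/
def PD.Est (D : PD G) (u : V) : Set (Sym2 V) :=
  {e | e ∈ G.edgeSet ∧ (D.RE e ∩ D.Regs (D.pos u)).Nonempty}

def PD.lev (D : PD G) (u : V) : ℕ → Set (Sym2 V)
  | 0 => D.Est u
  | k + 1 => {f | ∃ e ∈ D.lev u k, D.Gam e f}

theorem PD.lev_chain (D : PD G) (u : V) : ∀ (k : ℕ) (e : Sym2 V), e ∈ D.lev u k →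
    ∃ c : ℕ → Sym2 V, c k = e ∧ c 0 ∈ D.Est u ∧ ∀ i < k, D.Gam (c i) (c (i + 1))
  | 0, e, he => ⟨fun _ => e, rfl, he, by simp⟩
  | k + 1, f, hf => by
    obtain ⟨e, he, hef⟩ := hf
    obtain ⟨c, h1, h2, h3⟩ := PD.lev_chain D u k e he
    refine ⟨fun i => if i ≤ k then c i else f, by simp, by simpa using h2, ?_⟩
    intro i hi
    rcases (Nat.lt_succ_iff_lt_or_eq.1 hi) with h | h
    · have := h3 i h
      simpa [h.le, Nat.succ_le_iff.2 h] using this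
    · subst h
      simpa [h1] using hef

theorem small_case [Fintype V] (D : PD G) {u v : V} (huv : u ≠ v) (hr : G.Reachable u v)
    (hn : Fintype.card V < 4) : (D.Regs (D.pos u) ∩ D.Regs (D.pos v)).Nonempty := by
  classical
  have hX : ∀ e f, ¬ D.X e f := fun e f h => by
    have := four_le_of_X D h
    omega
  have hr' := (SimpleGraph.reachable_iff_reflTransGen _ _).1 hr
  by_cases hadj : G.Adj u v
  · obtain ⟨R, hR, hR'⟩ := F3' D (e := s(u, v)) hadj (u := u) (by simp)
    exact ⟨R, hR', UNC D (e := s(u, v)) hadj (by simp) (hX _) hR⟩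
  · rcases Relation.ReflTransGen.cases_head hr' with h | ⟨x, hux, -⟩
    · exact absurd h huv
    rcases Relation.ReflTransGen.cases_tail hr' with h | ⟨y, -, hyv⟩
    · exact absurd h.symm huv
    have hxv : x ≠ v := by rintro rfl; exact hadj hux
    have hyu : u ≠ y := by rintro rfl; exact hadj hyv
    have hxy : x = y := by
      by_contra hne
      have := four_le huv hux.ne hyu hxv.symm hyv.ne' hne
      omega
    subst hxy
    obtain ⟨h, hh, huh, R, hR, hR'⟩ := F3 D (e := s(u, x)) (g := s(x, v)) hux hyv
      (by intro h; simp only [Sym2.eq_iff] at h; rcases h with ⟨h, -⟩ | ⟨-, h⟩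
          · exact hyu h.symm
          · exact huv h.symm) (u := u) (by simp) (D.pos_mem (by exact hux) (z := x) (by simp))
      (D.pos_mem (by exact hyv) (z := x) (by simp)) (fun h => hyu (D.inj h).symm)
    refine ⟨R, hR', UNC D hh ?_ (hX _) hR⟩
    by_contra hv
    induction h using Sym2.ind with
    | _ a b =>
    simp only [Sym2.mem_iff, not_or] at huh hv
    have := four_le huv huh.1 huh.2 hv.1 hv.2 hh.ne
    omega

theorem chain_exists [Fintype V] (D : PD G) {u v : V} (huv : u ≠ v) (hr : G.Reachable u v) :
    (D.Regs (D.pos u) ∩ D.Regs (D.pos v)).Nonempty ∨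
    ∃ (s : ℕ) (c : ℕ → Sym2 V), s + 4 ≤ Fintype.card V ∧ (∀ i < s, D.Gam (c i) (c (i + 1))) ∧
      c 0 ∈ D.Est u ∧ c s ∈ D.Est v := by
  classical
  rcases lt_or_ge (Fintype.card V) 4 with hn | hn
  · exact Or.inl (small_case D huv hr hn)
  right
  have hr' := (SimpleGraph.reachable_iff_reflTransGen _ _).1 hr
  have hEst : ∀ z, ∀ e ∈ G.edgeSet, z ∈ e → e ∈ D.Est z := fun z e he hz => ⟨he, F3' D he hz⟩
  have hex : ∃ k, ∃ e ∈ D.lev u k, e ∈ D.Est v := by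
    rcases Relation.ReflTransGen.cases_head hr' with h | ⟨x, hux, -⟩
    · exact absurd h huv
    rcases Relation.ReflTransGen.cases_tail hr' with h | ⟨y, -, hyv⟩
    · exact absurd h.symm huv
    have key : ∀ z, Relation.ReflTransGen G.Adj u z → ∀ f ∈ G.edgeSet, z ∈ f →
        Relation.ReflTransGen D.Gam s(u, x) f := by
      intro z hz
      induction hz with
      | refl => intro f hf hz; exact F4 D hux hf (by simp) hz
      | @tail b c _ hbc ih =>
        intro f hf hz
        exact (ih s(b, c) hbc (by simp)).trans (F4 D (x := c) hbc hf (by simp) hz)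
    have h1 := key v hr' s(y, v) hyv (by simp)
    have h2 : ∀ f, Relation.ReflTransGen D.Gam s(u, x) f → ∃ k, f ∈ D.lev u k := by
      intro f hf
      induction hf with
      | refl => exact ⟨0, hEst u _ hux (by simp)⟩
      | tail _ h ih =>
        obtain ⟨k, hk⟩ := ih
        exact ⟨k + 1, _, hk, h⟩
    obtain ⟨k, hk⟩ := h2 _ h1
    exact ⟨k, _, hk, hEst v _ hyv (by simp)⟩
  obtain ⟨L, hL⟩ : ∃ L, L = Nat.find hex := ⟨_, rfl⟩
  obtain ⟨e, he, hev⟩ := Nat.find_spec hex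
  rw [← hL] at he
  have hmin : ∀ k, ∀ e ∈ D.lev u k, e ∈ D.Est v → L ≤ k := by
    intro k e h h'
    rw [hL]
    exact Nat.find_min' hex ⟨e, h, h'⟩
  obtain ⟨c, hcL, hc0, hcs⟩ := D.lev_chain u L e he
  refine ⟨L, c, ?_, hcs, hc0, hcL ▸ hev⟩
  rcases Nat.eq_zero_or_pos L with h0 | hpos
  · omega
  have hlx : ∀ e, ∃ k, e ∈ D.lev u k ∨ k = L := fun e => ⟨L, Or.inr rfl⟩
  obtain ⟨lam, hlam⟩ : ∃ lam : Sym2 V → ℕ, ∀ e, lam e = Nat.find (hlx e) := ⟨_, fun _ => rfl⟩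
  have l1 : ∀ e, e ∈ D.lev u (lam e) ∨ lam e = L := by
    intro e; rw [hlam]; exact Nat.find_spec (hlx e)
  have l2 : ∀ e k, (e ∈ D.lev u k ∨ k = L) → lam e ≤ k := by
    intro e k h; rw [hlam]; exact Nat.find_min' (hlx e) h
  have l3 : ∀ e f, D.Gam e f → lam f ≤ lam e + 1 := by
    intro e f h
    rcases l1 e with h' | h'
    · exact l2 f _ (Or.inl ⟨e, h', h⟩)
    · have := l2 f L (Or.inr rfl)
      omega
  have l0 : ∀ e ∈ D.Est u, lam e = 0 := fun e h => Nat.le_zero.1 (l2 e 0 (Or.inl h))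
  have lL : ∀ e ∈ D.Est v, lam e = L := by
    intro e h
    rcases l1 e with h' | h'
    · have := hmin _ e h' h
      have := l2 e L (Or.inr rfl)
      omega
    · exact h'
  have lc : ∀ j ≤ L, lam (c (L - j)) = L - j := by
    have up : ∀ i ≤ L, lam (c i) ≤ i := by
      intro i
      induction i with
      | zero => intro _; exact (l0 _ hc0).le
      | succ i ih =>
        intro h
        have := l3 _ _ (hcs i (by omega))
        have := ih (by omega)
        omega
    have lo : ∀ j ≤ L, L - j ≤ lam (c (L - j)) := by
      intro j
      induction j with
      | zero => intro _; simp [hcL, lL _ hev]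
      | succ j ih =>
        intro h
        have h1 := l3 _ _ (hcs (L - (j + 1)) (by omega))
        rw [show L - (j + 1) + 1 = L - j by omega] at h1
        have := ih (by omega)
        omega
    intro j hj
    exact le_antisymm (up _ (by omega)) (lo j hj)
  have lc' : ∀ i ≤ L, lam (c i) = i := by
    intro i hi
    have := lc (L - i) (by omega)
    rwa [show L - (L - i) = i by omega] at this
  have hx4 : ∀ z x, s(z, x) ∈ G.edgeSet → (∃ g ∈ G.edgeSet, x ∈ g ∧ g ≠ s(z, x)) →
      ∃ g ∈ G.edgeSet, g ∈ D.Est z ∧ z ∉ g := by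
    rintro z x hzx ⟨g, hg, hxg, hne⟩
    obtain ⟨h, hh, hz, hR⟩ := F3 D hzx hg hne (u := z) (by simp) (p := D.pos x)
      (D.pos_mem hzx (by simp)) (D.pos_mem hg hxg) (fun h => (G.ne_of_adj hzx) (D.inj h).symm)
    exact ⟨h, hh, ⟨hh, hR⟩, hz⟩
  refine comb_main G.edgeSet lam u v L hpos (fun e he => G.not_isDiag_of_mem_edgeSet he) huv ?_ ?_
    (fun e _ => l2 e L (Or.inr rfl)) (fun e he h => l0 e (hEst u e he h))
    (fun e he h => lL e (hEst v e he h)) ?_ ?_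
  · intro x g hg g' hg' hx hx' l h1 h2
    obtain ⟨f₁, hf₁, f₂, hf₂, hne, hx₁, hx₂, e₁, e₂⟩ := F2 D (fun e => (lam e : ℤ))
      (fun e f h => by have := l3 e f h; push_cast; omega) hg hg' hx hx' (l := l)
      (by exact_mod_cast h1) (by exact_mod_cast h2)
    exact ⟨f₁, hf₁, f₂, hf₂, hne, hx₁, hx₂, by exact_mod_cast e₁, by exact_mod_cast e₂⟩
  · intro l hl
    obtain ⟨a1, a2, -, ⟨x, hx, hx'⟩, -⟩ := hcs l hl
    exact ⟨_, a1, _, a2, x, hx, hx', lc' l hl.le, lc' (l + 1) hl⟩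
  · intro x hx hg
    obtain ⟨g, hg, h1, h2⟩ := hx4 u x hx hg
    exact ⟨g, hg, l0 g h1, h2⟩
  · intro x hx hg
    obtain ⟨g, hg, h1, h2⟩ := hx4 v x hx hg
    exact ⟨g, hg, lL g h1, h2⟩

end FCF

namespace FCF
open Set Filter Topology
variable {V : Type} {G : SimpleGraph V}

theorem open_reach {R : Set Plane} (ho : IsOpen R) (hp : IsPreconnected R) {a b : Plane} (ha : a ∈ R)
    (hb : b ∈ R) : Relation.ReflTransGen (fun a b => segment ℝ a b ⊆ R) a b := by
  by_contra hcon
  let P := fun c => Relation.ReflTransGen (fun a b => segment ℝ a b ⊆ R) a c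
  have key : ∀ c ∈ R, ∃ r > (0:ℝ), Metric.ball c r ⊆ R ∧ ∀ d ∈ Metric.ball c r, (P c ↔ P d) := by
    intro c hc
    obtain ⟨r, hr, hb⟩ := Metric.isOpen_iff.1 ho c hc
    refine ⟨r, hr, hb, fun d hd => ?_⟩
    have hs : segment ℝ c d ⊆ R :=
      ((convex_ball c r).segment_subset (Metric.mem_ball_self hr) hd).trans hb
    exact ⟨fun h => h.tail hs, fun h => h.tail (by rwa [segment_symm])⟩
  have hU : IsOpen {c | c ∈ R ∧ P c} := by
    rw [Metric.isOpen_iff]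
    rintro c ⟨hc, hPc⟩
    obtain ⟨r, hr, h1, h2⟩ := key c hc
    exact ⟨r, hr, fun d hd => ⟨h1 hd, (h2 d hd).1 hPc⟩⟩
  have hW : IsOpen {c | c ∈ R ∧ ¬ P c} := by
    rw [Metric.isOpen_iff]
    rintro c ⟨hc, hPc⟩
    obtain ⟨r, hr, h1, h2⟩ := key c hc
    exact ⟨r, hr, fun d hd => ⟨h1 hd, fun h => hPc ((h2 d hd).2 h)⟩⟩
  obtain ⟨z, -, hz1, hz2⟩ := hp _ _ hU hW (fun c hc => by
    by_cases h : P c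
    · exact Or.inl ⟨hc, h⟩
    · exact Or.inr ⟨hc, h⟩) ⟨a, ha, ha, Relation.ReflTransGen.refl⟩ ⟨b, hb, hb, hcon⟩
  exact hz2.2 hz1.2

theorem Acc.seg {p : Plane} {R : Set Plane} (h : Acc p R) : ∃ a ∈ R, segment ℝ p a ⊆ insert p R := by
  obtain ⟨w, -, hw⟩ := h
  refine ⟨p + w, by simpa using hw 1 (by simp), ?_⟩
  rw [segment_eq_image']
  rintro _ ⟨τ, hτ, rfl⟩
  rcases eq_or_lt_of_le hτ.1 with h | h
  · left; simp [← h]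
  · right
    have := hw τ ⟨h, hτ.2⟩
    simpa using this

theorem region_arc [Finite V] (D : PD G) {R : Set Plane} {p p' : Plane} (hp : R ∈ D.Regs p)
    (hp' : R ∈ D.Regs p') (hne : p ≠ p') : ∃ S ⊆ insert p (insert p' R), PA p p' S := by
  obtain ⟨a, ha, hs⟩ := hp.2.seg
  obtain ⟨b, hb, hs'⟩ := hp'.2.seg
  have h := open_reach hp.1.open hp.1.preconn ha hb
  have h1 : Relation.ReflTransGen (fun a b => segment ℝ a b ⊆ insert p (insert p' R)) a b :=
    Relation.ReflTransGen.mono (r := fun a b => segment ℝ a b ⊆ R) (fun x y (hxy : segment ℝ x y ⊆ R) => hxy.trans fun z hz => Or.inr (Or.inr hz)) _ _ h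
  have h2 : Relation.ReflTransGen (fun a b => segment ℝ a b ⊆ insert p (insert p' R)) p p' := by
    refine Relation.ReflTransGen.head (hs.trans ?_) (h1.tail ?_)
    · intro z hz
      rcases hz with hz | hz
      · exact Or.inl hz
      · exact Or.inr (Or.inr hz)
    · rw [segment_symm]
      exact hs'.trans fun z hz => Or.inr hz
  exact (arc_of_reach h2).resolve_left hne

/-- gluing arcs -/
theorem glue (Q : ℕ → Plane) (Rg S : ℕ → Set Plane) (T : ℕ → ℝ) : ∀ n : ℕ,
    (∀ i < n, T i < T (i + 1)) → (∀ i ≤ n, ∀ j ≤ n, Q i = Q j → i = j) →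
    (∀ i < n, ∀ j < n, i ≠ j → Disjoint (Rg i) (Rg j)) → (∀ i ≤ n, ∀ j < n, Q i ∉ Rg j) →
    (∀ i < n, PA (Q i) (Q (i + 1)) (S i)) →
    (∀ i < n, S i ⊆ insert (Q i) (insert (Q (i + 1)) (Rg i))) → 0 < n →
    ∃ γ : ℝ → Plane, ArcOn γ (T 0) (T n) (⋃ i ∈ Iio n, S i) ∧ (∀ i ≤ n, γ (T i) = Q i) ∧
      (∀ s ∈ Icc (T 0) (T n), (∃ i ≤ n, s = T i) ∨ ∃ i < n, γ s ∈ Rg i) := by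
  intro n
  induction n with
  | zero => intro _ _ _ _ _ _ h; exact absurd h (by simp)
  | succ n ih =>
  intro hT hQ hR hQR hPA hS _
  obtain ⟨g, hg, hg0, hg1⟩ := (hPA n (by omega)).param
  have hTn := hT n (by omega)
  have hg' := hg.rescale zero_lt_one hTn
  set g' : ℝ → Plane := fun s => g (0 + (s - T n) * ((1 - 0) / (T (n + 1) - T n))) with hg'def
  have hg'0 : g' (T n) = Q n := by simp [hg'def, hg0]
  have hg'1 : g' (T (n + 1)) = Q (n + 1) := by
    have : T (n + 1) - T n ≠ 0 := by linarith
    simp [hg'def, this, hg1]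
  have hpiece : ∀ s ∈ Icc (T n) (T (n + 1)), s = T n ∨ s = T (n + 1) ∨ g' s ∈ Rg n := by
    intro s hs
    have : g' s ∈ S n := by rw [← hg'.img]; exact ⟨s, hs, rfl⟩
    rcases hS n (by omega) this with h | h | h
    · left
      exact hg'.inj hs (left_mem_Icc.2 hTn.le) (h.trans hg'0.symm)
    · right; left
      exact hg'.inj hs (right_mem_Icc.2 hTn.le) (h.trans hg'1.symm)
    · exact Or.inr (Or.inr h)
  rcases Nat.eq_zero_or_pos n with rfl | hn
  · refine ⟨g', ?_, ?_, ?_⟩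
    · have : (⋃ i ∈ Iio (0 + 1), S i) = S 0 := by
        ext z; simp
      rw [this]; exact hg'
    · intro i hi
      interval_cases i
      · exact hg'0
      · exact hg'1
    · intro s hs
      rcases hpiece s hs with h | h | h
      · exact Or.inl ⟨0, by simp, h⟩
      · exact Or.inl ⟨1, by simp, h⟩
      · exact Or.inr ⟨0, by simp, h⟩
  · obtain ⟨γ, h1, h2, h3⟩ := ih (fun i hi => hT i (by omega))
      (fun i hi j hj => hQ i (by omega) j (by omega))
      (fun i hi j hj => hR i (by omega) j (by omega))
      (fun i hi j hj => hQR i (by omega) j (by omega))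
      (fun i hi => hPA i (by omega)) (fun i hi => hS i (by omega)) hn
    have hmono : ∀ i ≤ n, T i ≤ T n := by
      have : ∀ k ≤ n, T (n - k) ≤ T n := by
        intro k
        induction k with
        | zero => intro _; simp
        | succ k ihk =>
          intro hk
          have a1 := hT (n - (k + 1)) (by omega)
          rw [show n - (k + 1) + 1 = n - k by omega] at a1
          exact a1.le.trans (ihk (by omega))
      intro i hi
      have := this (n - i) (by omega)
      rwa [show n - (n - i) = i by omega] at this
    have h0n : T 0 < T n := by
      have a1 := hT 0 (by omega)
      have : ∀ k, 1 ≤ k → k ≤ n → T 0 < T k := by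
        intro k hk
        induction k, hk using Nat.le_induction with
        | base => intro _; exact a1
        | succ k hk ih2 =>
          intro hkn
          exact (ih2 (by omega)).trans (hT k (by omega))
      exact this n hn le_rfl
    have hi : (⋃ i ∈ Iio n, S i) ∩ S n ⊆ {γ (T n)} := by
      rintro z ⟨hz, hz'⟩
      simp only [mem_iUnion, mem_Iio] at hz
      obtain ⟨i, hi, hzi⟩ := hz
      rw [h2 n le_rfl]
      rcases hS i (by omega) hzi with e1 | e1 | e1 <;> rcases hS n (by omega) hz' with e2 | e2 | e2
      · exact e2
      · have := hQ i (by omega) (n + 1) (by omega) (e1.symm.trans e2); omega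
      · exact absurd (e1 ▸ e2) (hQR i (by omega) n (by omega))
      · exact e2
      · have := hQ (i + 1) (by omega) (n + 1) (by omega) (e1.symm.trans e2); omega
      · exact absurd (e1 ▸ e2) (hQR (i + 1) (by omega) n (by omega))
      · exact e2
      · exact absurd (e2 ▸ e1) (hQR (n + 1) (by omega) i (by omega))
      · exact absurd e2 (disjoint_left.1 (hR i (by omega) n (by omega) (by omega)) e1)
    have hc := h1.concat hg' h0n.le hTn.le ((h2 n le_rfl).trans hg'0.symm) hi
    refine ⟨fun s => if s ≤ T n then γ s else g' s, ?_, ?_, ?_⟩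
    · have : (⋃ i ∈ Iio (n + 1), S i) = (⋃ i ∈ Iio n, S i) ∪ S n := by
        ext z
        simp only [mem_iUnion, mem_Iio, mem_union]
        constructor
        · rintro ⟨i, hi, hz⟩
          rcases Nat.lt_succ_iff_lt_or_eq.1 hi with h | rfl
          · exact Or.inl ⟨i, h, hz⟩
          · exact Or.inr hz
        · rintro (⟨i, hi, hz⟩ | hz)
          · exact ⟨i, by omega, hz⟩
          · exact ⟨n, by omega, hz⟩
      rw [this]; exact hc
    · intro i hi
      rcases Nat.le_succ_iff.1 hi with h | rfl
      · simp only [hmono i h, if_true]; exact h2 i h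
      · simp only [not_le.2 hTn, if_false]; exact hg'1
    · intro s hs
      by_cases h : s ≤ T n
      · simp only [h, if_true]
        rcases h3 s ⟨hs.1, h⟩ with ⟨i, hi, e⟩ | ⟨i, hi, e⟩
        · exact Or.inl ⟨i, by omega, e⟩
        · exact Or.inr ⟨i, by omega, e⟩
      · simp only [h, if_false]
        rcases hpiece s ⟨(not_le.1 h).le, hs.2⟩ with h' | h' | h'
        · exact Or.inl ⟨n, by omega, h'⟩
        · exact Or.inl ⟨n + 1, by omega, h'⟩
        · exact Or.inr ⟨n, by omega, h'⟩

/-! ### Routes -/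

/-- a route through distinct regions -/
structure Route (D : PD G) (c : ℕ → Sym2 V) (u : V) (i : ℕ) (R : Set Plane) where
  m : ℕ
  Rg : ℕ → Set Plane
  q : ℕ → Plane
  f : ℕ → Sym2 V
  τ : ℕ → ℕ
  h0 : Rg 0 ∈ D.Regs (D.pos u)
  last : Rg m = R
  inj : ∀ j ≤ m, ∀ k ≤ m, Rg j = Rg k → j = k
  gate : ∀ j < m, D.Gate (f j) (q j) (Rg j) (Rg (j + 1))
  fN : ∀ j < m, f j ∈ D.N (c (τ j))
  le : ∀ j < m, τ j ≤ i
  mono : ∀ j k, j ≤ k → k < m → τ j ≤ τ k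

theorem Route.start (D : PD G) (c : ℕ → Sym2 V) {u : V} {R : Set Plane} (h : R ∈ D.Regs (D.pos u)) :
    Nonempty (Route D c u 0 R) :=
  ⟨{ m := 0, Rg := fun _ => R, q := fun _ => 0, f := fun _ => c 0, τ := fun _ => 0, h0 := h, last := rfl,
     inj := by intro j hj k hk _; omega
     gate := by intro j hj; omega
     fN := by intro j hj; omega
     le := by intro j hj; omega
     mono := by intro j k _ h; omega }⟩

theorem Route.up {D : PD G} {c : ℕ → Sym2 V} {u : V} {i : ℕ} {R : Set Plane} (r : Route D c u i R) :
    Nonempty (Route D c u (i + 1) R) :=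
  ⟨{ r with le := fun j hj => (r.le j hj).trans (by omega) }⟩

theorem Route.step {D : PD G} {c : ℕ → Sym2 V} {u : V} {i : ℕ} {R R' : Set Plane} (r : Route D c u i R)
    {f : Sym2 V} {q : Plane} (hf : f ∈ D.N (c i)) (hg : D.Gate f q R R') :
    Nonempty (Route D c u i R') := by
  by_cases h : ∃ k ≤ r.m, r.Rg k = R'
  · obtain ⟨k, hk, hR⟩ := h
    exact ⟨{ r with
      m := k, last := hR
      inj := fun j hj l hl => r.inj j (by omega) l (by omega)
      gate := fun j hj => r.gate j (by omega)
      fN := fun j hj => r.fN j (by omega)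
      le := fun j hj => r.le j (by omega)
      mono := fun j l hjl hl => r.mono j l hjl (by omega) }⟩
  · push Not at h
    refine ⟨{
      m := r.m + 1
      Rg := fun j => if j ≤ r.m then r.Rg j else R'
      q := fun j => if j < r.m then r.q j else q
      f := fun j => if j < r.m then r.f j else f
      τ := fun j => if j < r.m then r.τ j else i
      h0 := by simpa using r.h0
      last := by simp
      inj := ?_
      gate := ?_
      fN := ?_
      le := ?_
      mono := ?_ }⟩
    · intro j hj k hk hjk
      by_cases h1 : j ≤ r.m <;> by_cases h2 : k ≤ r.m
      · simp only [h1, h2, if_true] at hjk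
        exact r.inj j h1 k h2 hjk
      · simp only [h1, h2, if_true, if_false] at hjk
        exact absurd hjk (h j h1)
      · simp only [h1, h2, if_true, if_false] at hjk
        exact absurd hjk.symm (h k h2)
      · omega
    · intro j hj
      rcases Nat.lt_succ_iff_lt_or_eq.1 hj with h1 | rfl
      · simp only [h1, h1.le, Nat.succ_le_iff.2 h1, if_true]
        exact r.gate j h1
      · simp only [lt_irrefl, le_refl, if_true, if_false, show ¬ (r.m + 1 ≤ r.m) by omega]
        rw [r.last]; exact hg
    · intro j hj
      rcases Nat.lt_succ_iff_lt_or_eq.1 hj with h1 | rfl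
      · simp only [h1, if_true]
        exact r.fN j h1
      · simpa using hf
    · intro j hj
      rcases Nat.lt_succ_iff_lt_or_eq.1 hj with h1 | rfl
      · simp only [h1, if_true]
        exact r.le j h1
      · simp
    · intro j k hjk hk
      by_cases h2 : k < r.m
      · simp only [h2, lt_of_le_of_lt hjk h2, if_true]
        exact r.mono j k hjk h2
      · simp only [h2, if_false]
        split_ifs with h1
        · exact r.le j h1
        · exact le_rfl

theorem Route.linked {D : PD G} {c : ℕ → Sym2 V} {u : V} {i : ℕ} {R R' : Set Plane}
    (r : Route D c u i R) (h : Linked D (D.N (c i)) R R') : Nonempty (Route D c u i R') := by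
  induction h with
  | refl => exact ⟨r⟩
  | tail _ h ih =>
    obtain ⟨r'⟩ := ih
    obtain ⟨f, hf, q, hq⟩ := h
    exact r'.step hf hq

theorem route_chain [Finite V] (D : PD G) (c : ℕ → Sym2 V) {u : V} {s : ℕ}
    (hc : ∀ i < s, D.Gam (c i) (c (i + 1))) (h0 : c 0 ∈ D.Est u) :
    ∀ i ≤ s, c i ∈ G.edgeSet ∧ ∀ R ∈ D.RE (c i), Nonempty (Route D c u i R) := by
  intro i
  induction i with
  | zero =>
    intro _
    obtain ⟨hE, R₀, hR₀, hR₀'⟩ := h0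
    refine ⟨hE, fun R hR => ?_⟩
    obtain ⟨r⟩ := Route.start D c hR₀'
    exact r.linked (F1 D hE hR₀ hR)
  | succ i ih =>
    intro hi
    obtain ⟨a1, a2, -, -, R₀, hR₀, hR₀'⟩ := hc i (by omega)
    refine ⟨a2, fun R hR => ?_⟩
    obtain ⟨r⟩ := (ih (by omega)).2 R₀ hR₀
    obtain ⟨r⟩ := r.up
    exact r.linked (F1 D a2 hR₀' hR)

end FCF

namespace FCF
open Set Filter Topology
variable {V : Type} {G : SimpleGraph V}

/-- vertices of the added path -/
def cv (u v : V) (t : ℕ) (k : Fin (t + 2)) : V ⊕ Fin t :=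
  chainVertex (Sum.inl u) (Sum.inl v) (fun i => Sum.inr i) k

def ce (u v : V) (t : ℕ) (i : Fin (t + 1)) : Sym2 (V ⊕ Fin t) :=
  s(cv u v t i.castSucc, cv u v t i.succ)

noncomputable def newPos (D : Drawing G) (t : ℕ) (γ : ℝ → Plane) : V ⊕ Fin t → Plane
  | Sum.inl x => D.pos x
  | Sum.inr i => γ ((i : ℕ) + 1)

theorem newPos_cv (D : Drawing G) {u v : V} {t : ℕ} {γ : ℝ → Plane} (h0 : γ 0 = D.pos u)
    (h1 : γ (t + 1) = D.pos v) (k : Fin (t + 2)) : newPos D t γ (cv u v t k) = γ (k : ℕ) := by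
  unfold cv chainVertex
  split_ifs with h h'
  · simp [newPos, h, h0]
  · simp [newPos, h', h1]
  · simp only [newPos]
    congr 1
    have : ((k : ℕ) - 1 : ℕ) + 1 = (k : ℕ) := by omega
    exact_mod_cast this

theorem cv_inl {u v z : V} {t : ℕ} {k : Fin (t + 2)} (h : cv u v t k = Sum.inl z) :
    ((k : ℕ) = 0 ∧ z = u) ∨ ((k : ℕ) = t + 1 ∧ z = v) := by
  unfold cv chainVertex at h
  split_ifs at h with h1 h2
  · left; exact ⟨h1, (Sum.inl.inj h).symm⟩
  · right; exact ⟨h2, (Sum.inl.inj h).symm⟩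

theorem edge_cases {u v : V} {t : ℕ} {E : Sym2 (V ⊕ Fin t)} (h : E ∈ (pathAdd G u v t ∅).edgeSet) :
    (∃ e ∈ G.edgeSet, E = e.map Sum.inl) ∨ ∃ i, E = ce u v t i := by
  rw [pathAdd, SimpleGraph.edgeSet_fromEdgeSet] at h
  rcases h.1 with (⟨e, he, rfl⟩ | ⟨i, hi⟩) | h
  · exact Or.inl ⟨e, he, rfl⟩
  · exact Or.inr ⟨i, hi⟩
  · exact absurd h (by simp)

open Classical in
noncomputable def newCurve (D : Drawing G) (u v : V) (t : ℕ) (γ : ℝ → Plane) (E : Sym2 (V ⊕ Fin t)) :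
    ℝ → Plane :=
  if h : ∃ e ∈ G.edgeSet, E = e.map Sum.inl then D.curve h.choose
  else if h : ∃ i, E = ce u v t i then fun s => γ ((h.choose : ℕ) + s)
  else fun _ => 0

theorem curve_cases (D : Drawing G) {u v : V} {t : ℕ} (γ : ℝ → Plane) {E : Sym2 (V ⊕ Fin t)}
    (h : E ∈ (pathAdd G u v t ∅).edgeSet) :
    (∃ e ∈ G.edgeSet, E = e.map Sum.inl ∧ newCurve D u v t γ E = D.curve e) ∨
    ((¬ ∃ e ∈ G.edgeSet, E = e.map Sum.inl) ∧ ∃ i, E = ce u v t i ∧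
      newCurve D u v t γ E = fun s => γ ((i : ℕ) + s)) := by
  by_cases h1 : ∃ e ∈ G.edgeSet, E = e.map Sum.inl
  · left
    exact ⟨h1.choose, h1.choose_spec.1, h1.choose_spec.2, by simp only [newCurve, dif_pos h1]⟩
  · right
    have h2 := (edge_cases h).resolve_left h1
    refine ⟨h1, h2.choose, h2.choose_spec, ?_⟩
    simp only [newCurve, dif_neg h1, dif_pos h2]

theorem piece_image (γ : ℝ → Plane) (i : ℕ) :
    (fun s : ℝ => γ ((i : ℝ) + s)) '' Icc 0 1 = γ '' Icc (i : ℝ) (i + 1) := by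
  ext p; constructor
  · rintro ⟨s, hs, rfl⟩
    exact ⟨i + s, ⟨by linarith [hs.1], by linarith [hs.2]⟩, rfl⟩
  · rintro ⟨s, hs, rfl⟩
    exact ⟨s - i, ⟨by linarith [hs.1], by linarith [hs.2]⟩, by simp⟩

theorem max_piece {i j : ℕ} (hij : i ≠ j) {s : ℝ} (h1 : s ∈ Icc (i : ℝ) (i + 1))
    (h2 : s ∈ Icc (j : ℝ) (j + 1)) : s = (max i j : ℕ) := by
  rcases Nat.lt_or_gt_of_ne hij with h | h
  · rw [max_eq_right h.le]
    have : (i : ℝ) + 1 ≤ j := by exact_mod_cast h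
    linarith [h1.2, h2.1]
  · rw [max_eq_left h.le]
    have : (j : ℝ) + 1 ≤ i := by exact_mod_cast h
    linarith [h2.2, h1.1]

theorem assembly (D : Drawing G) (hD : D.FanCrossingFree) {u v : V} (huv : u ≠ v) (t : ℕ)
    (γ : ℝ → Plane) (hc : ContinuousOn γ (Icc 0 (t + 1))) (hi : InjOn γ (Icc 0 (t + 1)))
    (h0 : γ 0 = D.pos u) (h1 : γ (t + 1) = D.pos v)
    (hnv : ∀ s ∈ Ioo (0:ℝ) (t + 1), ∀ z, γ s ≠ D.pos z)
    (hfin : ∀ e ∈ G.edgeSet, (γ '' Icc 0 (t + 1) ∩ img D e).Finite)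
    (hw : ∀ i : ℕ, 1 ≤ i → i ≤ t → ∀ e ∈ G.edgeSet, γ i ∉ img D e)
    (Hit : ℕ → Sym2 V → Prop)
    (hHit : ∀ (i : ℕ), i ≤ t → ∀ e ∈ G.edgeSet, ∀ s ∈ Ioo (i:ℝ) (i + 1), γ s ∈ img D e → Hit i e)
    (ha : ∀ i e f, Hit i e → Hit i f → e ≠ f → ∀ x, x ∈ e → x ∉ f)
    (hb : ∀ i e, Hit i e → ¬ Hit (i + 1) e)
    (hc0 : ∀ e, ¬ Hit 0 e) (hct : ∀ e, ¬ Hit t e) :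
    IsFanCrossingFreeGraph (pathAdd G u v t ∅) := by
  have hsub : ∀ i : Fin (t + 1), Icc ((i : ℕ) : ℝ) ((i : ℕ) + 1) ⊆ Icc (0:ℝ) (t + 1) := by
    intro i s hs
    have : ((i : ℕ) : ℝ) ≤ t := by exact_mod_cast Nat.lt_succ_iff.1 i.2
    exact ⟨(Nat.cast_nonneg _).trans hs.1, by linarith [hs.2]⟩
  have hpos := newPos_cv D h0 h1
  have hposS : ∀ i : Fin (t + 1), newPos D t γ (cv u v t i.succ) = γ ((i : ℕ) + 1) := by
    intro i; rw [hpos]; simp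
  have hposC : ∀ i : Fin (t + 1), newPos D t γ (cv u v t i.castSucc) = γ (i : ℕ) := by
    intro i; rw [hpos]; simp
  have hinr : ∀ j : Fin t, ((j : ℕ) : ℝ) + 1 ∈ Ioo (0:ℝ) (t + 1) := by
    intro j
    have : ((j : ℕ) : ℝ) + 1 ≤ t := by exact_mod_cast j.2
    exact ⟨by positivity, by linarith⟩
  have hinj : Function.Injective (newPos D t γ) := by
    rintro (x | i) (y | j) h
    · rw [D.pos_inj h]
    · exact absurd h.symm (hnv _ (hinr j) x)
    · exact absurd h (hnv _ (hinr i) y)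
    · have := hi (Ioo_subset_Icc_self (hinr i)) (Ioo_subset_Icc_self (hinr j)) h
      have : (i : ℕ) = j := by
        have h' : ((i : ℕ) : ℝ) = (j : ℕ) := by linarith
        exact_mod_cast h'
      rw [Fin.ext this]
  -- vertices of a piece
  have hmem : ∀ (i : Fin (t + 1)) x, x ∈ ce u v t i → ∃ k : Fin (t + 2), x = cv u v t k ∧
      ((k : ℕ) = i ∨ (k : ℕ) = i + 1) := by
    intro i x hx
    rw [ce, Sym2.mem_iff] at hx
    rcases hx with h | h
    · exact ⟨_, h, Or.inl rfl⟩
    · exact ⟨_, h, Or.inr (by simp)⟩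
  have hshareBB : ∀ (i j : Fin (t + 1)) x, i ≠ j → x ∈ ce u v t i → x ∈ ce u v t j →
      newPos D t γ x = γ ((max (i : ℕ) j : ℕ)) ∧ ((i : ℕ) = j + 1 ∨ (j : ℕ) = i + 1) := by
    intro i j x hij hx hx'
    obtain ⟨k, rfl, hk⟩ := hmem i x hx
    obtain ⟨k', hkk, hk'⟩ := hmem j _ hx'
    have hkt : ∀ k : Fin (t + 2), ((k : ℕ) : ℝ) ∈ Icc (0:ℝ) (t + 1) := by
      intro k
      have : ((k : ℕ) : ℝ) ≤ t + 1 := by exact_mod_cast Nat.lt_succ_iff.1 k.2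
      exact ⟨by positivity, this⟩
    have hkk' : (k : ℕ) = k' := by
      have := congrArg (newPos D t γ) hkk
      rw [hpos, hpos] at this
      exact_mod_cast hi (hkt k) (hkt k') this
    have hij' : (i : ℕ) ≠ j := fun h => hij (Fin.ext h)
    rw [hpos]
    refine ⟨?_, by omega⟩
    congr 2
    omega
  let D' : Drawing (pathAdd G u v t ∅) :=
    { pos := newPos D t γ
      curve := newCurve D u v t γ
      pos_inj := hinj
      curve_cont := by
        intro E hE
        rcases curve_cases D γ hE with ⟨e, he, -, h⟩ | ⟨-, i, -, h⟩
        · rw [h]; exact D.curve_cont e he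
        · rw [h]
          refine hc.comp (by fun_prop) fun s hs => hsub i ⟨by linarith [hs.1], by linarith [hs.2]⟩
      curve_inj := by
        intro E hE
        rcases curve_cases D γ hE with ⟨e, he, -, h⟩ | ⟨-, i, -, h⟩
        · rw [h]; exact D.curve_inj e he
        · rw [h]
          intro s hs s' hs' heq
          have := hi (hsub i ⟨by linarith [hs.1], by linarith [hs.2]⟩)
            (hsub i ⟨by linarith [hs'.1], by linarith [hs'.2]⟩) heq
          linarith
      curve_ends := by
        intro x y hxy
        rcases curve_cases D γ ((SimpleGraph.mem_edgeSet _).2 hxy) with ⟨e, he, hE, h⟩ | ⟨-, i, hE, h⟩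
        · rw [h]
          induction e using Sym2.ind with
          | _ a b =>
          rw [D.curve_ends a b he]
          rw [Sym2.map_mk, Sym2.eq_iff] at hE
          rcases hE with ⟨rfl, rfl⟩ | ⟨rfl, rfl⟩
          · rfl
          · exact pair_comm _ _
        · rw [h]
          rw [ce, Sym2.eq_iff] at hE
          simp only [add_zero]
          rcases hE with ⟨rfl, rfl⟩ | ⟨rfl, rfl⟩
          · rw [hposC, hposS]
          · rw [hposC, hposS, pair_comm]
      no_vertex_interior := by
        intro E hE s hs x
        rcases curve_cases D γ hE with ⟨e, he, -, h⟩ | ⟨-, i, -, h⟩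
        · rw [h]
          rcases x with z | j
          · exact D.no_vertex_interior e he s hs z
          · intro heq
            refine hw (j + 1) (by omega) j.2 e he ?_
            push_cast
            exact ⟨s, Ioo_subset_Icc_self hs, heq⟩
        · rw [h]
          have hit : ((i : ℕ) : ℝ) ≤ t := by exact_mod_cast Nat.lt_succ_iff.1 i.2
          have hI : ((i : ℕ) : ℝ) + s ∈ Ioo (0:ℝ) (t + 1) :=
            ⟨by have : (0:ℝ) ≤ (i : ℕ) := Nat.cast_nonneg _
                linarith [hs.1], by linarith [hs.2]⟩
          rcases x with z | j
          · exact hnv _ hI z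
          · intro heq
            have := hi (Ioo_subset_Icc_self hI) (Ioo_subset_Icc_self (hinr j)) heq
            have a1 : ((i : ℕ) : ℝ) < (j : ℕ) + 1 := by linarith [hs.1]
            have a2 : ((j : ℕ) : ℝ) < (i : ℕ) := by linarith [hs.2]
            have a1' : (i : ℕ) < j + 1 := by exact_mod_cast a1
            have a2' : (j : ℕ) < i := by exact_mod_cast a2
            omega
      finite_meets := by
        intro E hE F hF hne
        rcases curve_cases D γ hE with ⟨e, he, rfl, h⟩ | ⟨-, i, rfl, h⟩ <;>
        rcases curve_cases D γ hF with ⟨f, hf, rfl, h'⟩ | ⟨-, j, rfl, h'⟩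
        · rw [h, h']
          exact D.finite_meets e he f hf (fun h => hne (by rw [h]))
        · rw [h, h', piece_image, inter_comm]
          exact (hfin e he).subset (inter_subset_inter_left _ (image_mono (hsub j)))
        · rw [h, h', piece_image]
          exact (hfin f hf).subset (inter_subset_inter_left _ (image_mono (hsub i)))
        · rw [h, h', piece_image, piece_image]
          have hij : (i : ℕ) ≠ j := fun h => hne (by rw [Fin.ext h])
          refine (finite_singleton (γ (max (i : ℕ) j : ℕ))).subset ?_
          rintro p ⟨⟨s, hs, rfl⟩, s', hs', heq⟩
          have := hi (hsub _ hs') (hsub _ hs) heq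
          subst this
          rw [mem_singleton_iff, max_piece hij hs hs']
      shared_endpoint := by
        have key : ∀ e ∈ G.edgeSet, ∀ i : Fin (t + 1), (¬ ∃ e ∈ G.edgeSet, ce u v t i = e.map Sum.inl) →
            ∀ x, x ∈ e.map Sum.inl → x ∈ ce u v t i → ∀ p ∈ img D e, p ∈ γ '' Icc ((i:ℕ):ℝ) ((i:ℕ) + 1) →
            p = newPos D t γ x := by
          rintro e he i hnot x hxe hxi p hpe ⟨s, hs, rfl⟩
          rw [Sym2.mem_map] at hxe
          obtain ⟨z, hz, rfl⟩ := hxe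
          obtain ⟨k, hk, hki⟩ := hmem i _ hxi
          have hit : (i : ℕ) ≤ t := Nat.lt_succ_iff.1 i.2
          have hno : ¬ s ∈ Ioo ((i : ℕ) : ℝ) ((i:ℕ) + 1) := by
            intro hs'
            have := hHit i hit e he s hs' hpe
            rcases cv_inl hk.symm with ⟨h, -⟩ | ⟨h, -⟩
            · rw [show (i : ℕ) = 0 by omega] at this
              exact hc0 _ this
            · rw [show (i : ℕ) = t by omega] at this
              exact hct _ this
          have hno2 : ¬ (u ∈ e ∧ v ∈ e ∧ t = 0) := by
            rintro ⟨hu, hv, rfl⟩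
            have : e = s(u, v) := (Sym2.mem_and_mem_iff huv).1 ⟨hu, hv⟩
            apply hnot
            refine ⟨e, he, ?_⟩
            rw [this, Sym2.map_mk, ce]
            have hi0 : (i : ℕ) = 0 := by omega
            simp [cv, chainVertex, hi0]
          have hse : s = (i : ℕ) ∨ s = (i : ℕ) + 1 := by
            by_contra hcon
            push Not at hcon
            exact hno ⟨lt_of_le_of_ne hs.1 hcon.1.symm, lt_of_le_of_ne hs.2 hcon.2⟩
          rcases cv_inl hk.symm with ⟨h, rfl⟩ | ⟨h, rfl⟩
          · have hi0 : (i : ℕ) = 0 := by omega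
            rcases hse with h | h
            · rw [h, hi0]; simpa [newPos] using h0
            · exfalso
              rcases Nat.eq_zero_or_pos t with ht | ht
              · subst ht
                refine hno2 ⟨hz, ?_, rfl⟩
                apply img_pos_mem D he
                rw [← h1]
                rw [h, hi0] at hpe
                simpa using hpe
              · refine hw 1 le_rfl ht e he ?_
                rw [h, hi0] at hpe
                simpa using hpe
          · have hi0 : (i : ℕ) = t := by omega
            rcases hse with h | h
            · exfalso
              rcases Nat.eq_zero_or_pos t with ht | ht
              · subst ht
                refine hno2 ⟨?_, hz, rfl⟩
                apply img_pos_mem D he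
                rw [← h0]
                rw [h, hi0] at hpe
                simpa using hpe
              · refine hw t ht le_rfl e he ?_
                rw [h, hi0] at hpe
                exact hpe
            · rw [h, hi0]; simpa [newPos] using h1
        intro E hE F hF hne x hx hx'
        rcases curve_cases D γ hE with ⟨e, he, rfl, h⟩ | ⟨hn, i, rfl, h⟩ <;>
        rcases curve_cases D γ hF with ⟨f, hf, rfl, h'⟩ | ⟨hn', j, rfl, h'⟩
        · rw [h, h']
          rw [Sym2.mem_map] at hx hx'
          obtain ⟨z, hz, rfl⟩ := hx
          obtain ⟨z', hz', h2⟩ := hx'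
          rw [Sum.inl.inj h2] at hz'
          exact D.shared_endpoint e he f hf (fun h => hne (by rw [h])) z hz hz'
        · rw [h, h', piece_image]
          rintro p ⟨hp, hp'⟩
          exact key e he j hn' x hx hx' p hp hp'
        · rw [h, h', piece_image]
          rintro p ⟨hp, hp'⟩
          exact key f hf i hn x hx' hx p hp' hp
        · rw [h, h', piece_image, piece_image]
          have hij : (i : ℕ) ≠ j := fun h => hne (by rw [Fin.ext h])
          rintro p ⟨⟨s, hs, rfl⟩, s', hs', heq⟩
          have := hi (hsub _ hs') (hsub _ hs) heq
          subst this
          rw [mem_singleton_iff, max_piece hij hs hs', (hshareBB i j x (fun h => hij (by rw [h])) hx hx').1] }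
  -- classification of crossings
  have himgA : ∀ E e, newCurve D u v t γ E = D.curve e → img D' E = img D e := by
    intro E e h
    change newCurve D u v t γ E '' _ = _
    rw [h]; rfl
  have himgB : ∀ E (i : Fin (t + 1)), (newCurve D u v t γ E = fun s => γ ((i : ℕ) + s)) →
      img D' E = γ '' Icc ((i:ℕ):ℝ) ((i:ℕ) + 1) := by
    intro E i h
    change newCurve D u v t γ E '' _ = _
    rw [h, piece_image]
  have cAB : ∀ e ∈ G.edgeSet, ∀ i : Fin (t + 1), (∃ p ∈ img D e ∩ γ '' Icc ((i:ℕ):ℝ) ((i:ℕ) + 1),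
      ∀ z, p ≠ newPos D t γ z) → Hit i e := by
    rintro e he i ⟨_, ⟨hp, s, hs, rfl⟩, hz⟩
    refine hHit i (Nat.lt_succ_iff.1 i.2) e he s ⟨lt_of_le_of_ne hs.1 ?_, lt_of_le_of_ne hs.2 ?_⟩ hp
    · rintro h; exact hz _ (by rw [← h]; exact (hposC i).symm)
    · rintro h; exact hz _ (by rw [h]; exact (hposS i).symm)
  have cBB : ∀ i j : Fin (t + 1), i ≠ j → ¬ ∃ p ∈ γ '' Icc ((i:ℕ):ℝ) ((i:ℕ) + 1) ∩
      γ '' Icc ((j:ℕ):ℝ) ((j:ℕ) + 1), ∀ z, p ≠ newPos D t γ z := by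
    rintro i j hij ⟨p, ⟨⟨s, hs, rfl⟩, s', hs', heq⟩, hz⟩
    have := hi (hsub _ hs') (hsub _ hs) heq
    subst this
    rw [max_piece (fun h => hij (Fin.ext h)) hs hs'] at hz
    rcases le_total (i : ℕ) j with h | h
    · rw [max_eq_right h] at hz; exact hz _ (hposC j).symm
    · rw [max_eq_left h] at hz; exact hz _ (hposC i).symm
  have cAA : ∀ e ∈ G.edgeSet, ∀ f ∈ G.edgeSet, e ≠ f → (∃ p ∈ img D e ∩ img D f,
      ∀ z, p ≠ newPos D t γ z) → D.Crosses e f := by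
    rintro e he f hf hef ⟨p, hp, hz⟩
    exact (crosses_iff D).2 ⟨he, hf, hef, p, hp, fun z => hz (Sum.inl z)⟩
  have sAB : ∀ e, ∀ i : Fin (t + 1), ∀ x, x ∈ Sym2.map Sum.inl e → x ∈ ce u v t i → ∀ g, ¬ Hit i g := by
    intro e i x hxe hxi g hg
    rw [Sym2.mem_map] at hxe
    obtain ⟨z, hz, rfl⟩ := hxe
    obtain ⟨k, hk, hki⟩ := hmem i _ hxi
    have hit : (i : ℕ) ≤ t := Nat.lt_succ_iff.1 i.2
    rcases cv_inl hk.symm with ⟨h, -⟩ | ⟨h, -⟩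
    · rw [show (i : ℕ) = 0 by omega] at hg
      exact hc0 _ hg
    · rw [show (i : ℕ) = t by omega] at hg
      exact hct _ hg
  refine ⟨D', ?_⟩
  rintro ⟨E, F, F', x, hne, hx, hx', hc1, hc2⟩
  rw [crosses_iff] at hc1 hc2
  obtain ⟨hE, hF, hEF, hc1⟩ := hc1
  obtain ⟨-, hF', hEF', hc2⟩ := hc2
  rcases curve_cases D γ hE with ⟨e, he, rfl, h⟩ | ⟨-, i, rfl, h⟩ <;>
  rcases curve_cases D γ hF with ⟨f, hf, rfl, h'⟩ | ⟨-, j, rfl, h'⟩ <;>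
  rcases curve_cases D γ hF' with ⟨f', hf', rfl, h''⟩ | ⟨-, j', rfl, h''⟩
  · rw [himgA _ _ h, himgA _ _ h'] at hc1
    rw [himgA _ _ h, himgA _ _ h''] at hc2
    rw [Sym2.mem_map] at hx hx'
    obtain ⟨z, hz, rfl⟩ := hx
    obtain ⟨z', hz', h2⟩ := hx'
    rw [Sum.inl.inj h2] at hz'
    exact hD ⟨e, f, f', z, fun h => hne (by rw [h]), hz, hz',
      cAA e he f hf (fun h => hEF (by rw [h])) hc1, cAA e he f' hf' (fun h => hEF' (by rw [h])) hc2⟩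
  · rw [himgA _ _ h, himgB _ _ h''] at hc2
    exact sAB _ _ _ hx hx' _ (cAB e he j' hc2)
  · rw [himgA _ _ h, himgB _ _ h'] at hc1
    exact sAB _ _ _ hx' hx _ (cAB e he j hc1)
  · rw [himgA _ _ h, himgB _ _ h'] at hc1
    rw [himgA _ _ h, himgB _ _ h''] at hc2
    have a1 := cAB e he j hc1
    have a2 := cAB e he j' hc2
    rcases (hshareBB j j' x (fun h => hne (by rw [h])) hx hx').2 with h3 | h3
    · rw [h3] at a1; exact hb _ _ a2 a1
    · rw [h3] at a2; exact hb _ _ a1 a2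
  · rw [himgB _ _ h, himgA _ _ h', inter_comm] at hc1
    rw [himgB _ _ h, himgA _ _ h'', inter_comm] at hc2
    rw [Sym2.mem_map] at hx hx'
    obtain ⟨z, hz, rfl⟩ := hx
    obtain ⟨z', hz', h2⟩ := hx'
    rw [Sum.inl.inj h2] at hz'
    exact ha i f f' (cAB f hf i hc1) (cAB f' hf' i hc2) (fun h => hne (by rw [h])) z hz hz'
  · rw [himgB _ _ h, himgB _ _ h''] at hc2
    exact cBB i j' (fun h => hEF' (by rw [h])) hc2
  · rw [himgB _ _ h, himgB _ _ h'] at hc1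
    exact cBB i j (fun h => hEF (by rw [h])) hc1
  · rw [himgB _ _ h, himgB _ _ h'] at hc1
    exact cBB i j (fun h => hEF (by rw [h])) hc1

end FCF

namespace FCF
open Set Filter Topology
variable {V : Type} {G : SimpleGraph V}

theorem Gam_disj {D : PD G} {e e' f : Sym2 V} (h : D.Gam e e') (h1 : f ∈ D.N e) (h2 : f ∈ D.N e') : False := by
  obtain ⟨he, he', hne, ⟨x, hx, hx'⟩, -⟩ := h
  rcases h1 with rfl | h1 <;> rcases h2 with h2 | h2
  · exact hne h2
  · exact h2.disj x hx' hx
  · subst h2; exact h1.disj x hx hx'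
  · exact h1.symm.fan h2.symm hne x hx hx'

theorem route_draw [Finite V] (D : PD G) {c : ℕ → Sym2 V} {u v : V} (huv : u ≠ v) {s t : ℕ}
    {R : Set Plane} (r : Route D c u s R) (hR : R ∈ D.Regs (D.pos v))
    (hc : ∀ i < s, D.Gam (c i) (c (i + 1))) (hst : r.m = 0 ∨ s + 2 ≤ t) :
    IsFanCrossingFreeGraph (pathAdd G u v t ∅) := by
  obtain ⟨m, Rg, q, f, τ, h0, last, inj, gate, fN, le, mono⟩ := r
  simp only at hst
  obtain ⟨Q, Q0, Qm, Qe⟩ : ∃ Q : ℕ → Plane, Q 0 = D.pos u ∧ (∀ j < m, Q (j + 1) = q j) ∧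
      Q (m + 1) = D.pos v :=
    ⟨fun j => if j = 0 then D.pos u else if j ≤ m then q (j - 1) else D.pos v, by simp, by
      intro j hj; simp [Nat.succ_le_iff.2 hj], by simp⟩
  obtain ⟨T, T0, Tm, Te⟩ : ∃ T : ℕ → ℝ, T 0 = 0 ∧
      (∀ j < m, T (j + 1) = ((τ j + 1 : ℕ) : ℝ) + ((j : ℝ) + 1) / (m + 1)) ∧ T (m + 1) = t + 1 :=
    ⟨fun j => if j = 0 then 0 else if j ≤ m then ((τ (j - 1) + 1 : ℕ) : ℝ) + ((j - 1 : ℕ) + 1) / (m + 1)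
      else t + 1, by simp, by
      intro j hj; simp [Nat.succ_le_iff.2 hj], by simp⟩
  have frac : ∀ j < m, 0 < ((j : ℝ) + 1) / (m + 1) ∧ ((j : ℝ) + 1) / (m + 1) < 1 := by
    intro j hj
    have : (j : ℝ) < m := by exact_mod_cast hj
    refine ⟨by positivity, ?_⟩
    rw [div_lt_one (by positivity)]
    linarith
  have idx : ∀ i ≤ m + 1, i = 0 ∨ (∃ j < m, i = j + 1) ∨ i = m + 1 := by
    intro i hi
    rcases Nat.eq_zero_or_pos i with h | h
    · exact Or.inl h
    · rcases Nat.lt_or_ge i (m + 1) with h' | h'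
      · exact Or.inr (Or.inl ⟨i - 1, by omega, by omega⟩)
      · exact Or.inr (Or.inr (by omega))
  have hT : ∀ i < m + 1, T i < T (i + 1) := by
    intro i hi
    rcases idx i (by omega) with rfl | ⟨j, hj, rfl⟩ | rfl
    · rw [T0]
      rcases Nat.eq_zero_or_pos m with rfl | hm
      · rw [Te]; positivity
      · rw [Tm 0 hm]; have := (frac 0 hm).1; positivity
    · rw [Tm j hj]
      rcases Nat.lt_or_ge (j + 1) m with h | h
      · rw [Tm (j + 1) h]
        have a1 : ((τ j + 1 : ℕ) : ℝ) ≤ ((τ (j + 1) + 1 : ℕ) : ℝ) := by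
          have := mono j (j + 1) (by omega) h
          exact_mod_cast Nat.succ_le_succ this
        have a2 : ((j : ℝ) + 1) / (m + 1) < (((j + 1 : ℕ) : ℝ) + 1) / (m + 1) := by
          apply div_lt_div_of_pos_right _ (by positivity)
          push_cast; linarith
        linarith
      · have : j + 1 = m := by omega
        rw [this, Te]
        have a1 : ((τ j + 1 : ℕ) : ℝ) ≤ t := by
          have := le j hj
          have : τ j + 1 ≤ t := by omega
          exact_mod_cast this
        have a2 := (frac j hj).2
        linarith
    · omega
  have hreg : ∀ i ≤ m, D.IsReg (Rg i) := by
    intro i hi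
    rcases Nat.eq_zero_or_pos i with rfl | h
    · exact h0.1
    · have := (gate (i - 1) (by omega)).right.1
      rwa [show i - 1 + 1 = i by omega] at this
  have hQSig : ∀ i ≤ m + 1, Q i ∈ D.Sig := by
    intro i hi
    rw [D.mem_Sig]
    rcases idx i hi with rfl | ⟨j, hj, rfl⟩ | rfl
    · exact Or.inr ⟨u, Q0.symm⟩
    · rw [Qm j hj]; exact Or.inl ⟨f j, (gate j hj).edge, (gate j hj).mem⟩
    · exact Or.inr ⟨v, Qe.symm⟩
  have qlt : ∀ j < m, ∀ k < m, j < k → q j ≠ q k := by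
    intro j hj k hk hjk h
    have g1 := (gate k hk).left
    have g2 := (gate k hk).right
    rw [← h] at g1 g2
    rcases (gate j hj).sub _ g1 with e1 | e1
    · have := inj k (by omega) j (by omega) e1; omega
    rcases (gate j hj).sub _ g2 with e2 | e2
    · have := inj (k + 1) (by omega) j (by omega) e2; omega
    · have := inj (k + 1) (by omega) (j + 1) (by omega) e2; omega
  have hQ : ∀ i ≤ m + 1, ∀ j ≤ m + 1, Q i = Q j → i = j := by
    intro i hi j hj h
    rcases idx i hi with rfl | ⟨i', hi', rfl⟩ | rfl <;> rcases idx j hj with rfl | ⟨j', hj', rfl⟩ | rfl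
    · rfl
    · rw [Q0, Qm j' hj'] at h; exact absurd h.symm ((gate j' hj').nov u)
    · rw [Q0, Qe] at h; exact absurd (D.inj h) huv
    · rw [Q0, Qm i' hi'] at h; exact absurd h ((gate i' hi').nov u)
    · rw [Qm i' hi', Qm j' hj'] at h
      rcases lt_trichotomy i' j' with h' | h' | h'
      · exact absurd h (qlt i' hi' j' hj' h')
      · rw [h']
      · exact absurd h.symm (qlt j' hj' i' hi' h')
    · rw [Qe, Qm i' hi'] at h; exact absurd h ((gate i' hi').nov v)
    · rw [Q0, Qe] at h; exact absurd (D.inj h).symm huv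
    · rw [Qe, Qm j' hj'] at h; exact absurd h.symm ((gate j' hj').nov v)
    · rfl
  have hRQ : ∀ i < m + 1, Rg i ∈ D.Regs (Q i) ∧ Rg i ∈ D.Regs (Q (i + 1)) := by
    intro i hi
    constructor
    · rcases idx i (by omega) with rfl | ⟨j, hj, rfl⟩ | rfl
      · rw [Q0]; exact h0
      · rw [Qm j hj]; exact (gate j hj).right
      · omega
    · rcases Nat.lt_or_ge i m with h | h
      · rw [Qm i h]; exact (gate i h).left
      · rw [show i = m by omega, Qe, last]; exact hR
  have hS : ∀ i, ∃ S : Set Plane, i < m + 1 → S ⊆ insert (Q i) (insert (Q (i + 1)) (Rg i)) ∧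
      PA (Q i) (Q (i + 1)) S := by
    intro i
    by_cases hi : i < m + 1
    · obtain ⟨S, h1, h2⟩ := region_arc D (hRQ i hi).1 (hRQ i hi).2 (fun h => by
        have := hQ i (by omega) (i + 1) (by omega) h; omega)
      exact ⟨S, fun _ => ⟨h1, h2⟩⟩
    · exact ⟨∅, fun h => absurd h hi⟩
  choose S hS using hS
  obtain ⟨γ, hγ, hγT, hγR⟩ := glue Q Rg S T (m + 1) hT hQ
    (by
      intro i hi j hj hij
      rw [disjoint_left]
      intro z hz hz'
      exact hij (inj i (by omega) j (by omega) ((hreg i (by omega)).eq (hreg j (by omega)) hz hz')))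
    (by
      intro i hi j hj h
      exact (hreg j (by omega)).sub h (hQSig i hi))
    (fun i hi => (hS i hi).2) (fun i hi => (hS i hi).1) (by omega)
  rw [T0, Te] at hγ
  rw [T0, Te] at hγR
  -- points of Σ on γ
  have hSig : ∀ z ∈ Icc (0:ℝ) (t + 1), γ z ∈ D.Sig → ∃ i ≤ m + 1, z = T i := by
    intro z hz h
    rcases hγR z hz with h' | ⟨i, hi, h'⟩
    · exact h'
    · exact absurd h ((hreg i (by omega)).sub h')
  have hSig' : ∀ z ∈ Ioo (0:ℝ) (t + 1), γ z ∈ D.Sig → ∃ j < m, z = T (j + 1) ∧ γ z = q j := by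
    intro z hz h
    obtain ⟨i, hi, rfl⟩ := hSig z (Ioo_subset_Icc_self hz) h
    rcases idx i hi with rfl | ⟨j, hj, rfl⟩ | rfl
    · rw [T0] at hz; exact absurd hz.1 (lt_irrefl _)
    · exact ⟨j, hj, rfl, by rw [hγT _ hi, Qm j hj]⟩
    · rw [Te] at hz; exact absurd hz.2 (lt_irrefl _)
  obtain ⟨D', hpos, himg, hfan⟩ := D.toDrawing
  have hpiece : ∀ j < m, ∀ i : ℕ, T (j + 1) ∈ Icc (i : ℝ) (i + 1) → i = τ j + 1 := by
    intro j hj i hi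
    rw [Tm j hj] at hi
    have a := frac j hj
    have a1 : (i : ℝ) < ((τ j + 1 : ℕ) : ℝ) + 1 := by linarith [hi.1]
    have a2 : ((τ j + 1 : ℕ) : ℝ) < (i : ℝ) + 1 := by linarith [hi.2]
    have a1' : i < τ j + 1 + 1 := by exact_mod_cast a1
    have a2' : τ j + 1 < i + 1 := by exact_mod_cast a2
    omega
  refine assembly D' hfan huv t γ hγ.cont hγ.inj ?_ ?_ ?_ ?_ ?_
    (fun i e => ∃ j < m, e = f j ∧ i = τ j + 1) ?_ ?_ ?_ ?_ ?_
  · rw [hpos, ← Q0, ← hγT 0 (by omega), T0]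
  · rw [hpos, ← Qe, ← hγT (m + 1) le_rfl, Te]
  · intro z hz x h
    rw [hpos] at h
    obtain ⟨j, hj, -, h'⟩ := hSig' z hz (D.mem_Sig.2 (Or.inr ⟨x, h.symm⟩))
    exact (gate j hj).nov x (h' ▸ h)
  · intro e he
    rw [himg e he]
    refine ((finite_Iic (m + 1)).image Q).subset ?_
    rintro _ ⟨⟨z, hz, rfl⟩, h⟩
    obtain ⟨i, hi, rfl⟩ := hSig z hz (D.mem_Sig.2 (Or.inl ⟨e, he, h⟩))
    exact ⟨i, hi, (hγT i hi).symm⟩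
  · intro i hi1 hit e he h
    rw [himg e he] at h
    have hi1' : (1:ℝ) ≤ i := by exact_mod_cast hi1
    have hit' : (i:ℝ) ≤ t := by exact_mod_cast hit
    obtain ⟨j, hj, h1, h2⟩ := hSig' i ⟨by linarith, by linarith⟩ (D.mem_Sig.2 (Or.inl ⟨e, he, h⟩))
    have := hpiece j hj i (by rw [← h1]; exact ⟨le_rfl, by linarith⟩)
    rw [Tm j hj, this] at h1
    have := (frac j hj).1
    linarith
  · intro i hit e he z hz h
    rw [himg e he] at h
    have hi0 : (0:ℝ) ≤ i := Nat.cast_nonneg _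
    have hit' : (i:ℝ) ≤ t := by exact_mod_cast hit
    obtain ⟨j, hj, h1, h2⟩ := hSig' z ⟨by linarith [hz.1], by linarith [hz.2]⟩ (D.mem_Sig.2 (Or.inl ⟨e, he, h⟩))
    refine ⟨j, hj, ?_, hpiece j hj i (h1 ▸ Ioo_subset_Icc_self hz)⟩
    rw [h2] at h
    exact (gate j hj).only e he h
  · rintro i _ _ ⟨j, hj, rfl, h1⟩ ⟨k, hk, rfl, h2⟩ hne x hx hx'
    have hτ : τ j = τ k := by omega
    have n1 := fN j hj
    have n2 := fN k hk
    rw [← hτ] at n2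
    rcases n1 with n1 | n1 <;> rcases n2 with n2 | n2
    · exact hne (n1.trans n2.symm)
    · rw [← n1] at n2; exact n2.disj x hx hx'
    · rw [← n2] at n1; exact n1.disj x hx' hx
    · exact n1.fan n2 hne x hx hx'
  · rintro i _ ⟨j, hj, rfl, h1⟩ ⟨k, hk, h2, h3⟩
    have n1 := fN j hj
    have n2 := fN k hk
    rw [← h2, show τ k = τ j + 1 by omega] at n2
    refine Gam_disj (hc (τ j) ?_) n1 n2
    have := le k hk
    omega
  · rintro e ⟨j, hj, -, h⟩
    omega
  · rintro e ⟨j, hj, -, h⟩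
    have := le j hj
    omega

theorem reachable_case [Fintype V] (D : PD G) {u v : V} (huv : u ≠ v) (hr : G.Reachable u v) (t : ℕ)
    (ht : Fintype.card V - 1 ≤ t + 1) : IsFanCrossingFreeGraph (pathAdd G u v t ∅) := by
  rcases chain_exists D huv hr with ⟨R, h1, h2⟩ | ⟨s, c, hs, hc, h0, he, R, hR, hR'⟩
  · exact route_draw D huv (c := fun _ => s(u, v)) (s := 0) (t := t)
      { m := 0, Rg := fun _ => R, q := fun _ => 0, f := fun _ => s(u, v), τ := fun _ => 0, h0 := h1, last := rfl,
        inj := by intro j hj k hk _; omega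
        gate := by intro j hj; omega
        fN := by intro j hj; omega
        le := by intro j hj; omega
        mono := by intro j k _ h; omega } h2 (by intro i hi; omega) (Or.inl rfl)
  · obtain ⟨r⟩ := (route_chain D c hc h0 s le_rfl).2 R hR
    exact route_draw D huv r hR' hc (Or.inr (by omega))

end FCF

namespace FCF
open Set Filter Topology
variable {V : Type} {G : SimpleGraph V}

theorem exists_K (w w' c : Plane) (hw : w ≠ 0) (hw' : w' ≠ 0) : ∃ K : Plane → Plane,
    ContinuousOn K {c}ᶜ ∧ InjOn K {c}ᶜ ∧ K (c + w') = w ∧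
      ∀ z ≠ c, ∀ k : ℝ, k ≠ 0 → K z = k • w → z = c + k⁻¹ • w' := by
  set L := Complex.equivRealProdCLM with hL
  have hs : ∀ z ≠ c, L.symm z - L.symm c ≠ 0 := fun z hz h => hz (L.symm.injective (sub_eq_zero.1 h))
  have ha : L.symm w ≠ 0 := fun h => hw (by simpa using h)
  have hb : L.symm w' ≠ 0 := fun h => hw' (by simpa using h)
  refine ⟨fun z => L (L.symm w * L.symm w' / (L.symm z - L.symm c)), ?_, ?_, ?_, ?_⟩
  · refine L.continuous.comp_continuousOn (ContinuousOn.div continuousOn_const ?_ fun z hz => hs z hz)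
    exact (L.symm.continuous.continuousOn).sub continuousOn_const
  · intro z hz z' hz' h
    have h1 := L.injective h
    rw [div_eq_div_iff (hs z hz) (hs z' hz')] at h1
    have h2 := mul_left_cancel₀ (mul_ne_zero ha hb) h1
    exact L.symm.injective (sub_left_injective h2).symm
  · simp only [map_add, add_sub_cancel_left]
    rw [mul_div_assoc, div_self hb, mul_one]
    simp
  · intro z hz k hk h
    apply L.symm.injective
    have h1 : L.symm w * L.symm w' / (L.symm z - L.symm c) = L.symm (k • w) := by
      rw [← h]; simp
    rw [map_smul, div_eq_iff (hs z hz), Complex.real_smul] at h1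
    have h3 : L.symm w' = k * (L.symm z - L.symm c) := by
      apply mul_left_cancel₀ ha
      rw [h1]; ring
    rw [map_add, map_smul, h3, Complex.real_smul]
    have : (k : ℂ) ≠ 0 := by exact_mod_cast hk
    push_cast
    field_simp
    ring

open Classical in
noncomputable def gsel (φ : Plane → Plane) (b : Prop) (p : Plane) : Plane := if b then φ p else p

theorem redraw (D : Drawing G) (hD : D.FanCrossingFree) (C : Set V)
    (hC : ∀ x y, G.Adj x y → (x ∈ C ↔ y ∈ C)) (Sg : Set Plane) (hSe : ∀ e ∈ G.edgeSet, img D e ⊆ Sg)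
    (hSp : ∀ z, D.pos z ∈ Sg) (φ : Plane → Plane) (hφc : ContinuousOn φ Sg) (hφi : InjOn φ Sg)
    (hd : ∀ p ∈ Sg, φ p ∉ Sg) : ∃ D' : Drawing G, D'.FanCrossingFree ∧
      (∀ z ∈ C, D'.pos z = φ (D.pos z)) ∧ (∀ z ∉ C, D'.pos z = D.pos z) ∧
      ∀ e ∈ G.edgeSet, img D' e ⊆ Sg ∪ φ '' Sg := by
  classical
  let cl : Sym2 V → Prop := fun e => ∃ z ∈ e, z ∈ C
  have hcl : ∀ e ∈ G.edgeSet, ∀ x ∈ e, (cl e ↔ x ∈ C) := by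
    intro e he x hx
    obtain ⟨y, rfl⟩ := Sym2.mem_iff_exists.1 hx
    constructor
    · rintro ⟨z, hz, hzC⟩
      rw [Sym2.mem_iff] at hz
      rcases hz with rfl | rfl
      · exact hzC
      · exact (hC _ _ he).2 hzC
    · intro h; exact ⟨x, hx, h⟩
  have gi : ∀ (b b' : Prop) p p', p ∈ Sg → p' ∈ Sg → gsel φ b p = gsel φ b' p' → p = p' := by
    intro b b' p p' hp hp' h
    unfold gsel at h
    split_ifs at h with h1 h2
    · exact hφi hp hp' h
    · exact absurd (h ▸ hp') (hd p hp)
    · exact absurd (h ▸ hp) (hd p' hp')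
    · exact h
  have gc : ∀ b : Prop, ContinuousOn (gsel φ b) Sg := by
    intro b
    by_cases h : b
    · have : gsel φ b = φ := by ext1 p; simp [gsel, h]
      rw [this]; exact hφc
    · have : gsel φ b = id := by ext1 p; simp [gsel, h]
      rw [this]; exact continuousOn_id
  have hmem : ∀ e ∈ G.edgeSet, ∀ s ∈ Icc (0:ℝ) 1, D.curve e s ∈ Sg := fun e he s hs => hSe e he ⟨s, hs, rfl⟩
  have hinter : ∀ e ∈ G.edgeSet, ∀ f ∈ G.edgeSet,
      ((fun s => gsel φ (cl e) (D.curve e s)) '' Icc 0 1 ∩ (fun s => gsel φ (cl f) (D.curve f s)) '' Icc 0 1)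
        ⊆ gsel φ (cl e) '' (img D e ∩ img D f) := by
    rintro e he f hf p ⟨⟨s, hs, rfl⟩, s', hs', h⟩
    have := gi _ _ _ _ (hmem f hf s' hs') (hmem e he s hs) h
    exact ⟨D.curve e s, ⟨⟨s, hs, rfl⟩, ⟨s', hs', this⟩⟩, rfl⟩
  let D' : Drawing G :=
    { pos := fun z => gsel φ (z ∈ C) (D.pos z)
      curve := fun e s => gsel φ (cl e) (D.curve e s)
      pos_inj := fun x y h => D.pos_inj (gi _ _ _ _ (hSp x) (hSp y) h)
      curve_cont := fun e he => (gc (cl e)).comp (D.curve_cont e he) (hmem e he)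
      curve_inj := fun e he s hs s' hs' h =>
        D.curve_inj e he hs hs' (gi _ _ _ _ (hmem e he s hs) (hmem e he s' hs') h)
      curve_ends := by
        intro x y hxy
        have h1 : (cl s(x, y)) = (x ∈ C) := propext (hcl s(x, y) hxy x (by simp))
        have h2 : (y ∈ C) = (x ∈ C) := propext (hC x y hxy).symm
        have := congrArg (fun A => gsel φ (x ∈ C) '' A) (D.curve_ends x y hxy)
        simp only [image_pair] at this
        simp only [h1, h2]
        exact this
      no_vertex_interior := fun e he s hs x h =>
        D.no_vertex_interior e he s hs x (gi _ _ _ _ (hmem e he s (Ioo_subset_Icc_self hs)) (hSp x) h)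
      finite_meets := fun e he f hf hne =>
        ((D.finite_meets e he f hf hne).image _).subset (hinter e he f hf)
      shared_endpoint := by
        intro e he f hf hne x hx hx' p hp
        obtain ⟨a, ha, rfl⟩ := hinter e he f hf hp
        have := D.shared_endpoint e he f hf hne x hx hx' ha
        rw [mem_singleton_iff] at this ⊢
        rw [this, show (cl e) = (x ∈ C) from propext (hcl e he x hx)] }
  refine ⟨D', ?_, ?_, ?_, ?_⟩
  · have hcr : ∀ e f, D'.Crosses e f → D.Crosses e f := by
      intro e f h
      rw [crosses_iff] at h ⊢
      obtain ⟨he, hf, hne, p, hp, hz⟩ := h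
      obtain ⟨a, ha, rfl⟩ := hinter e he f hf hp
      refine ⟨he, hf, hne, a, ha, ?_⟩
      rintro z rfl
      refine hz z ?_
      have := img_pos_mem D he ha.1
      change _ = gsel φ (z ∈ C) (D.pos z)
      rw [show (cl e) = (z ∈ C) from propext (hcl e he z this)]
    rintro ⟨e, f, g, x, hne, hx, hx', h1, h2⟩
    exact hD ⟨e, f, g, x, hne, hx, hx', hcr _ _ h1, hcr _ _ h2⟩
  · intro z hz
    change gsel φ (z ∈ C) (D.pos z) = _
    simp [gsel, hz]
  · intro z hz
    change gsel φ (z ∈ C) (D.pos z) = _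
    simp [gsel, hz]
  · rintro e he _ ⟨s, hs, rfl⟩
    change gsel φ (cl e) (D.curve e s) ∈ _
    unfold gsel
    split_ifs
    · exact Or.inr ⟨_, hmem e he s hs, rfl⟩
    · exact Or.inl (hmem e he s hs)

theorem regs_nonempty [Finite V] (D : PD G) (p : Plane) : ∃ w : Plane, w ≠ 0 ∧
    ∀ τ ∈ Ioc (0:ℝ) 1, p + τ • w ∉ D.Sig := by
  obtain ⟨L⟩ := exists_loc D p
  obtain ⟨ε, hε, R, R', h1, h2, -⟩ := L.two_secs 0
  obtain ⟨hR, w, hw, h⟩ := Loc.Sec.regs h1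
  exact ⟨w, hw, fun τ hτ => hR.sub (h τ hτ)⟩

theorem PD.compact_Sig [Finite V] (D : PD G) : IsCompact D.Sig := by
  refine IsCompact.union ?_ (finite_range D.pos).isCompact
  refine (toFinite G.edgeSet).isCompact_biUnion fun e he => ?_
  induction e using Sym2.ind with
  | _ x y => exact (D.pa x y he).compact

theorem unreachable_case [Finite V] (D : PD G) {u v : V} (huv : u ≠ v) (hr : ¬ G.Reachable u v) (t : ℕ) :
    IsFanCrossingFreeGraph (pathAdd G u v t ∅) := by
  obtain ⟨w, hw, hwS⟩ := regs_nonempty D (D.pos u)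
  obtain ⟨w', hw', hwS'⟩ := regs_nonempty D (D.pos v)
  set c₁ := D.pos u + w with hc₁
  set c := D.pos v + w' with hc
  have hcS : c ∉ D.Sig := by simpa using hwS' 1 (by simp)
  have hc₁S : c₁ ∉ D.Sig := by simpa using hwS 1 (by simp)
  obtain ⟨K, Kc, Ki, Kv, Kr⟩ := exists_K (-w) (-w') c (by simpa using hw) (by simpa using hw')
  have hsub : D.Sig ⊆ {c}ᶜ := by
    rintro z hz rfl; exact hcS hz
  obtain ⟨M, hM⟩ := (D.compact_Sig.image_of_continuousOn (Kc.mono hsub)).isBounded.exists_norm_le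
  obtain ⟨ρ, hρ, hball⟩ := Metric.isOpen_iff.1 D.closed_Sig.isOpen_compl c₁ hc₁S
  obtain ⟨ε, hε, hε1, hεM⟩ : ∃ ε > (0:ℝ), ε < 1 ∧ ε * M < ρ := by
    refine ⟨min (1 / 2) (ρ / (2 * (|M| + 1))), by positivity, ?_, ?_⟩
    · exact lt_of_le_of_lt (min_le_left _ _) (by norm_num)
    · have hm : (0:ℝ) < |M| + 1 := by positivity
      calc min (1 / 2) (ρ / (2 * (|M| + 1))) * M ≤ min (1 / 2) (ρ / (2 * (|M| + 1))) * |M| := by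
            gcongr; exact le_abs_self M
        _ ≤ (ρ / (2 * (|M| + 1))) * |M| := by gcongr; exact min_le_right _ _
        _ ≤ (ρ / (2 * (|M| + 1))) * (|M| + 1) := by gcongr; linarith
        _ = ρ / 2 := by field_simp
        _ < ρ := by linarith
  set φ : Plane → Plane := fun z => c₁ + ε • K z with hφ
  have hφb : ∀ p ∈ D.Sig, φ p ∉ D.Sig := by
    intro p hp
    apply hball
    rw [Metric.mem_ball, dist_eq_norm]
    simp only [hφ, add_sub_cancel_left, norm_smul, Real.norm_eq_abs, abs_of_pos hε]
    refine lt_of_le_of_lt ?_ hεM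
    gcongr
    exact hM _ ⟨p, hp, rfl⟩
  obtain ⟨D', hpos, himg, hfan⟩ := D.toDrawing
  have hpS : ∀ z, D.pos z ∈ D.Sig := fun z => D.mem_Sig.2 (Or.inr ⟨z, rfl⟩)
  obtain ⟨D'', hfan'', hposC, hposN, himg''⟩ := redraw D' hfan {z | G.Reachable v z}
    (fun x y h => ⟨fun h' => SimpleGraph.Reachable.trans h' h.reachable,
      fun h' => SimpleGraph.Reachable.trans h' h.symm.reachable⟩) D.Sig
    (fun e he => by rw [himg e he]; intro p hp; exact D.mem_Sig.2 (Or.inl ⟨e, he, hp⟩))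
    (fun z => by rw [hpos]; exact hpS z) φ
    (continuousOn_const.add ((continuous_const_smul ε).comp_continuousOn (Kc.mono hsub)))
    (fun p hp p' hp' h => Ki (hsub hp) (hsub hp') (by
      simp only [hφ] at h
      exact smul_right_injective _ hε.ne' (add_left_cancel h))) hφb
  rw [hpos] at hposC hposN
  have hφv : φ (D.pos v) = D.pos u + (1 - ε) • w := by
    have : D.pos v = c + -w' := by rw [hc]; abel
    simp only [hφ]
    rw [this, Kv, hc₁]
    module
  have hpu : D''.pos u = D.pos u := hposN u (fun h => hr (SimpleGraph.Reachable.symm h))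
  have hpv : D''.pos v = D.pos u + (1 - ε) • w := by
    rw [hposC v (SimpleGraph.Reachable.refl v), hφv]
  have hp'' : ∀ z, D''.pos z ∈ D.Sig ∪ φ '' D.Sig := by
    intro z
    by_cases h : G.Reachable v z
    · rw [hposC z h]; exact Or.inr ⟨_, hpS z, rfl⟩
    · rw [hposN z h]; exact Or.inl (hpS z)
  -- points strictly inside are free
  have hfree : ∀ τ ∈ Ioo 0 (1 - ε), D.pos u + τ • w ∉ D.Sig ∪ φ '' D.Sig := by
    rintro τ hτ (h | ⟨z, hz, h⟩)
    · exact hwS τ ⟨hτ.1, by linarith [hτ.2]⟩ h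
    · have hσ : ε < 1 - τ := by linarith [hτ.2]
      have hk : (1 - τ) / ε ≠ 0 := (div_pos (by linarith) hε).ne'
      have h1 : K z = ((1 - τ) / ε) • (-w) := by
        have : ε • K z = (1 - τ) • (-w) := by
          have h2 : ε • K z = (D.pos u + τ • w) - c₁ := by rw [← h]; simp [hφ]
          rw [h2, hc₁]; module
        rw [div_eq_inv_mul, mul_smul, ← this, smul_smul, inv_mul_cancel₀ hε.ne', one_smul]
      have h2 := Kr z (hsub hz) _ hk h1
      have h3 : z = D.pos v + (1 - ε / (1 - τ)) • w' := by
        rw [h2, hc, inv_div]; module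
      refine hwS' (1 - ε / (1 - τ)) ⟨?_, ?_⟩ (h3 ▸ hz)
      · have : ε / (1 - τ) < 1 := by rw [div_lt_one (by linarith)]; exact hσ
        linarith
      · have : 0 < ε / (1 - τ) := div_pos hε (by linarith)
        linarith
  have ht : (0:ℝ) < t + 1 := by positivity
  set γ : ℝ → Plane := fun s => D.pos u + (s / (t + 1) * (1 - ε)) • w with hγ
  have hin : ∀ s ∈ Ioo (0:ℝ) (t + 1), γ s ∉ D.Sig ∪ φ '' D.Sig := by
    intro s hs
    apply hfree
    have h1 : 0 < s / (t + 1) := div_pos hs.1 ht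
    have h2 : s / (t + 1) < 1 := by rw [div_lt_one ht]; exact hs.2
    have h3 : 0 < 1 - ε := by linarith
    exact ⟨by positivity, by nlinarith⟩
  refine assembly D'' hfan'' huv t γ ?_ ?_ ?_ ?_ ?_ ?_ ?_ (fun _ _ => False) ?_ ?_ ?_ ?_ ?_
  · exact Continuous.continuousOn (by fun_prop)
  · intro s _ s' _ h
    simp only [hγ] at h
    have h1 := smul_left_injective ℝ hw (add_left_cancel h)
    have h2 := mul_right_cancel₀ (show (1 - ε) ≠ 0 by linarith) h1
    rwa [div_left_inj' ht.ne'] at h2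
  · rw [hpu]; simp [hγ]
  · rw [hpv]; simp [hγ, div_self ht.ne']
  · intro s hs z h
    exact hin s hs (h ▸ hp'' z)
  · intro e he
    refine (toFinite {γ 0, γ (t + 1)}).subset ?_
    rintro _ ⟨⟨s, hs, rfl⟩, h⟩
    by_contra hcon
    simp only [mem_insert_iff, mem_singleton_iff, not_or] at hcon
    refine hin s ⟨lt_of_le_of_ne hs.1 ?_, lt_of_le_of_ne hs.2 ?_⟩ (himg'' e he h)
    · rintro rfl; exact hcon.1 rfl
    · rintro rfl; exact hcon.2 rfl
  · intro i h1 h2 e he h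
    have h1' : (1:ℝ) ≤ i := by exact_mod_cast h1
    have h2' : (i:ℝ) ≤ t := by exact_mod_cast h2
    exact hin i ⟨by linarith, by linarith⟩ (himg'' e he h)
  · intro i hi e he s hs h
    have h1' : (0:ℝ) ≤ i := Nat.cast_nonneg _
    have h2' : (i:ℝ) ≤ t := by exact_mod_cast hi
    exact hin s ⟨by linarith [hs.1], by linarith [hs.2]⟩ (himg'' e he h)
  · intro i e f h; exact h.elim
  · intro i e h; exact h.elim
  · intro e h; exact h
  · intro e h; exact h

theorem main_aux [Fintype V] (hG : IsFanCrossingFreeGraph G) {u v : V} (huv : u ≠ v) (t : ℕ)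
    (ht : Fintype.card V - 1 ≤ t + 1) : IsFanCrossingFreeGraph (pathAdd G u v t ∅) := by
  obtain ⟨D₀, hD₀⟩ := hG
  obtain ⟨D⟩ := exists_PD D₀ hD₀
  by_cases hr : G.Reachable u v
  · exact reachable_case D huv hr t ht
  · exact unreachable_case D huv hr t

end FCF

/-- The class of fan-crossing free graphs is closed under path-addition
(with empty supplementary edge set, the class being hereditary). -/
theorem fanCrossingFree_closed_under_pathAddition
    {V : Type} [Fintype V] (G : SimpleGraph V) (hG : IsFanCrossingFreeGraph G)
    (u v : V) (huv : u ≠ v)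
    (t : ℕ) (ht : Fintype.card V - 1 ≤ t + 1) :
    IsFanCrossingFreeGraph (pathAdd G u v t ∅) := by
  exact FCF.main_aux hG huv t ht
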